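/- Let g ≥ 5 be a Sophie Germain prime and let h denote the cardinality of the class group of the order ℤ[√-(2g+1)]. Then the set of primes p with p ≠ 2g+1 such that p = x² + (2g+1)y² for some integers x, y and p ≡ 1 (mod 2g+1) has relative natural density 1/(2hg) among all primes; that is, #{p ≤ x : p prime, p ≠ 2g+1, p representable and p ≡ 1 (mod 2g+1)} / #{p ≤ x : p prime} tends to 1/(2hg) as x → ∞. -/

import Mathlib

namespace SophieGermain
open MeasureTheory Filter Topology Set

/-- The Fejér kernel `2 (1 - cos v) / v²`. -/
noncomputable def fejer (v : ℝ) : ℝ := if v = 0 then 1 else 2 * (1 - Real.cos v) / v ^ 2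

lemma fejer_nonneg (v : ℝ) : 0 ≤ fejer v := by
  unfold fejer
  split_ifs
  · norm_num
  · have := Real.cos_le_one v
    apply div_nonneg <;> nlinarith [sq_nonneg v]

lemma fejer_le (v : ℝ) : fejer v ≤ 5 * (1 + v ^ 2)⁻¹ := by
  rw [← div_eq_mul_inv, le_div_iff₀ (by positivity)]
  unfold fejer
  split_ifs with h
  · subst h; norm_num
  · have h1 := Real.one_sub_sq_div_two_le_cos (x := v)
    have h2 := Real.neg_one_le_cos v
    have h3 : 0 < v ^ 2 := by positivity
    rw [div_mul_eq_mul_div, div_le_iff₀ h3]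
    nlinarith

lemma fejer_eq_integral (v : ℝ) :
    (fejer v : ℂ) = ∫ t in (-1 : ℝ)..1, ((1 - |t| : ℝ) : ℂ) * Complex.exp (Complex.I * (t * v)) := by
  have hc : Continuous fun t : ℝ => ((1 - |t| : ℝ) : ℂ) * Complex.exp (Complex.I * (t * v)) := by
    fun_prop
  rw [← intervalIntegral.integral_add_adjacent_intervals (hc.intervalIntegrable (-1) 0)
    (hc.intervalIntegrable 0 1)]
  have h1 : ∫ t in (-1 : ℝ)..0, ((1 - |t| : ℝ) : ℂ) * Complex.exp (Complex.I * (t * v)) =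
      ∫ t in (0 : ℝ)..1, ((1 - |t| : ℝ) : ℂ) * Complex.exp (-(Complex.I * (t * v))) := by
    have := intervalIntegral.integral_comp_neg (a := (0 : ℝ)) (b := 1)
      (f := fun t : ℝ => ((1 - |t| : ℝ) : ℂ) * Complex.exp (Complex.I * (t * v)))
    simp only [neg_zero, abs_neg] at this
    rw [← this]
    congr 1; ext t; push_cast; ring_nf
  rw [h1, ← intervalIntegral.integral_add (Continuous.intervalIntegrable (by fun_prop) _ _)
    (hc.intervalIntegrable 0 1)]
  have h2 : ∀ t ∈ Set.uIcc (0 : ℝ) 1, ((1 - |t| : ℝ) : ℂ) * Complex.exp (-(Complex.I * (t * v))) +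
      ((1 - |t| : ℝ) : ℂ) * Complex.exp (Complex.I * (t * v)) =
      ((2 * (1 - t) * Real.cos (t * v) : ℝ) : ℂ) := by
    intro t ht
    rw [Set.uIcc_of_le zero_le_one] at ht
    rw [abs_of_nonneg ht.1]
    push_cast
    rw [Complex.cos]
    ring_nf
  rw [intervalIntegral.integral_congr h2, intervalIntegral.integral_ofReal]
  congr 1
  unfold fejer
  split_ifs with h
  · subst h
    simp only [mul_zero, Real.cos_zero, mul_one]
    rw [intervalIntegral.integral_eq_sub_of_hasDerivAt (f := fun t => 2 * t - t ^ 2)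
      (fun t _ => ?_) (Continuous.intervalIntegrable (by fun_prop) _ _)]
    · norm_num
    · exact (((hasDerivAt_id t).const_mul 2).sub (hasDerivAt_pow 2 t)).congr_deriv
        (by norm_num; ring)
  · rw [intervalIntegral.integral_eq_sub_of_hasDerivAt
      (f := fun t => 2 * (1 - t) * (Real.sin (t * v) / v) - 2 * (Real.cos (t * v) / v ^ 2))
      (fun t _ => ?_) (Continuous.intervalIntegrable (by fun_prop) _ _)]
    · simp; field_simp; ring
    · have e0 : HasDerivAt (fun t : ℝ => t * v) v t := by
        simpa using (hasDerivAt_id t).mul_const v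
      have e1 := (e0.sin).div_const v
      have e2 := ((e0.cos).div_const (v ^ 2)).const_mul 2
      have e3 : HasDerivAt (fun t : ℝ => 2 * (1 - t)) (-2) t := by
        simpa using ((hasDerivAt_id t).const_sub 1).const_mul 2
      exact ((e3.mul e1).sub e2).congr_deriv (by field_simp; ring)

lemma continuous_fejer : Continuous fejer := by
  have h : Continuous fun v : ℝ => ∫ t in (-1 : ℝ)..1, ((1 - |t| : ℝ) : ℂ) *
      Complex.exp (Complex.I * (t * v)) := by
    apply intervalIntegral.continuous_parametric_intervalIntegral_of_continuous'
    unfold Function.uncurry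
    fun_prop
  have : fejer = fun v : ℝ => (∫ t in (-1 : ℝ)..1, ((1 - |t| : ℝ) : ℂ) *
      Complex.exp (Complex.I * (t * v))).re := by
    ext v
    rw [← fejer_eq_integral, Complex.ofReal_re]
  rw [this]
  exact Complex.continuous_re.comp h

lemma integrable_fejer : Integrable fejer :=
  (integrable_inv_one_add_sq.const_mul 5).mono' continuous_fejer.aestronglyMeasurable
    (Eventually.of_forall fun v => by
      rw [Real.norm_of_nonneg (fejer_nonneg v)]; exact fejer_le v)

lemma integral_fejer_pos : 0 < ∫ v, fejer v := by
  exact integral_pos_of_integrable_nonneg_nonzero (x := 0) continuous_fejer integrable_fejer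
    fejer_nonneg (by simp [fejer])

lemma laplace_fejer_aux {B : ℝ → ℝ} {C : ℝ} (hB : Measurable B) (hC : ∀ u, |B u| ≤ C)
    {g : ℂ → ℂ} (hL : ∀ s : ℂ, 1 < s.re →
      ∫ u in Ioi (0 : ℝ), (B u : ℂ) * Complex.exp (-(s - 1) * u) = g s)
    (l y ε : ℝ) (hε : 0 < ε) :
    ∫ u in Ioi (0 : ℝ), (B u : ℂ) * Complex.exp (-ε * u) * fejer (l * (y - u)) =
      ∫ t in (-1 : ℝ)..1, ((1 - |t| : ℝ) : ℂ) * Complex.exp (Complex.I * (t * (l * y))) *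
        g (1 + ε + Complex.I * (l * t)) := by
  have e1 : ∀ u : ℝ, (B u : ℂ) * Complex.exp (-ε * u) * fejer (l * (y - u)) =
      ∫ t in Ioc (-1 : ℝ) 1, (B u : ℂ) * Complex.exp (-ε * u) * (((1 - |t| : ℝ) : ℂ) *
        Complex.exp (Complex.I * (t * ((l * (y - u) : ℝ) : ℂ)))) := by
    intro u
    rw [fejer_eq_integral, intervalIntegral.integral_of_le (by norm_num), integral_const_mul]
  simp_rw [e1]
  rw [integral_integral_swap, intervalIntegral.integral_of_le (by norm_num)]
  · congr 1
    ext t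
    rw [← hL _ (by simp [hε]), ← integral_const_mul]
    congr 1
    ext u
    have : Complex.exp (-ε * u) * Complex.exp (Complex.I * (t * ((l * (y - u) : ℝ) : ℂ))) =
        Complex.exp (Complex.I * (t * (l * y))) *
          Complex.exp (-(1 + ε + Complex.I * (l * t) - 1) * u) := by
      rw [← Complex.exp_add, ← Complex.exp_add]
      congr 1; push_cast; ring
    linear_combination ((1 - |t| : ℝ) : ℂ) * (B u : ℂ) * this
  · have hb : Integrable (fun z : ℝ × ℝ => C * Real.exp (-ε * z.1))
        ((volume.restrict (Ioi 0)).prod (volume.restrict (Ioc (-1 : ℝ) 1))) := by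
      have h1 : Integrable (fun u : ℝ => C * Real.exp (-ε * u)) (volume.restrict (Ioi 0)) :=
        (exp_neg_integrableOn_Ioi 0 hε).const_mul C
      have h2 : Integrable (fun _ : ℝ => (1 : ℝ)) (volume.restrict (Ioc (-1 : ℝ) 1)) :=
        integrable_const 1
      simpa using h1.mul_prod h2
    refine hb.mono' ?_ ?_
    · apply Measurable.aestronglyMeasurable
      unfold Function.uncurry
      have : Measurable fun z : ℝ × ℝ => (B z.1 : ℂ) :=
        Complex.measurable_ofReal.comp (hB.comp measurable_fst)
      apply Measurable.mul (this.mul (by fun_prop))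
      apply Continuous.measurable
      fun_prop
    · rw [Measure.prod_restrict]
      refine (ae_restrict_iff' (measurableSet_Ioi.prod measurableSet_Ioc)).2
        (Eventually.of_forall fun z hz => ?_)
      simp only [Function.uncurry, norm_mul, Complex.norm_real, Real.norm_eq_abs]
      have a1 : ‖Complex.exp (-ε * z.1)‖ = Real.exp (-ε * z.1) := by
        rw [Complex.norm_exp]; simp
      have a2 : ‖Complex.exp (Complex.I * (z.2 * ((l * (y - z.1) : ℝ) : ℂ)))‖ = 1 := by
        rw [Complex.norm_exp]; simp
      rw [a1, a2, mul_one]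
      have a3 : |1 - abs z.2| ≤ 1 := by
        have := abs_le.2 ⟨hz.2.1.le, hz.2.2⟩
        have := abs_nonneg z.2
        rw [abs_le]; constructor <;> linarith
      have a4 : 0 ≤ |B z.1| * Real.exp (-ε * z.1) := by positivity
      calc _ ≤ |B z.1| * Real.exp (-ε * z.1) * 1 := by gcongr
        _ ≤ _ := by rw [mul_one]; gcongr; exact hC _

lemma integrable_fejer_comp (l y : ℝ) (hl : 0 < l) :
    Integrable fun u => fejer (l * (y - u)) := by
  have := (integrable_fejer.comp_mul_left' hl.ne').comp_sub_left y
  simpa using this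

lemma laplace_fejer {B : ℝ → ℝ} {C : ℝ} (hB : Measurable B) (hC : ∀ u, |B u| ≤ C)
    {g : ℂ → ℂ} (hg : ContinuousOn g {s | 1 ≤ s.re}) (hL : ∀ s : ℂ, 1 < s.re →
      ∫ u in Ioi (0 : ℝ), (B u : ℂ) * Complex.exp (-(s - 1) * u) = g s)
    (l y : ℝ) (hl : 0 < l) :
    ((∫ u in Ioi (0 : ℝ), B u * fejer (l * (y - u)) : ℝ) : ℂ) =
      ∫ t in (-1 : ℝ)..1, ((1 - |t| : ℝ) : ℂ) * Complex.exp (Complex.I * (t * (l * y))) *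
        g (1 + Complex.I * (l * t)) := by
  have hε : Tendsto (fun n : ℕ => 1 / ((n : ℝ) + 1)) atTop (𝓝 0) :=
    tendsto_one_div_add_atTop_nhds_zero_nat
  have hpos : ∀ n : ℕ, 0 < 1 / ((n : ℝ) + 1) := fun n => by positivity
  have t1 : Tendsto (fun n : ℕ => ∫ u in Ioi (0 : ℝ), (B u : ℂ) *
      Complex.exp (-(1 / ((n : ℝ) + 1) : ℝ) * u) * fejer (l * (y - u))) atTop
      (𝓝 (∫ u in Ioi (0 : ℝ), (B u : ℂ) * fejer (l * (y - u)))) := by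
    refine tendsto_integral_of_dominated_convergence (fun u => C * fejer (l * (y - u))) ?_ ?_ ?_ ?_
    · intro n
      apply Measurable.aestronglyMeasurable
      refine Measurable.mul (Measurable.mul (Complex.measurable_ofReal.comp hB) (by fun_prop)) ?_
      exact Complex.measurable_ofReal.comp (continuous_fejer.measurable.comp (by fun_prop))
    · exact ((integrable_fejer_comp l y hl).const_mul C).integrableOn
    · intro n
      refine (ae_restrict_iff' measurableSet_Ioi).2 (Eventually.of_forall fun u hu => ?_)
      have a1 : ‖Complex.exp (-(1 / ((n : ℝ) + 1) : ℝ) * u)‖ ≤ 1 := by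
        rw [Complex.norm_exp, Real.exp_le_one_iff]
        have := mul_pos (hpos n) hu
        simp only [neg_mul, Complex.neg_re, ← Complex.ofReal_mul, Complex.ofReal_re]
        linarith
      simp only [norm_mul, Complex.norm_real, Real.norm_eq_abs, abs_of_nonneg (fejer_nonneg _)]
      have := fejer_nonneg (l * (y - u))
      calc _ ≤ C * 1 * fejer (l * (y - u)) := by
            gcongr
            · exact (abs_nonneg _).trans (hC u)
            · exact hC u
        _ = _ := by ring
    · refine Eventually.of_forall fun u => ?_
      have : Tendsto (fun n : ℕ => Complex.exp (-((1 / ((n : ℝ) + 1) : ℝ) : ℂ) * u)) atTop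
          (𝓝 (Complex.exp (-((0 : ℝ) : ℂ) * u))) := by
        have hc : Continuous fun e : ℝ => Complex.exp (-(e : ℂ) * u) := by fun_prop
        exact (hc.tendsto 0).comp hε
      simp only [Complex.ofReal_zero, neg_zero, zero_mul, Complex.exp_zero] at this
      simpa using (this.const_mul (B u : ℂ)).mul_const (fejer (l * (y - u)) : ℂ)
  have t2 : Tendsto (fun n : ℕ => ∫ t in (-1 : ℝ)..1, ((1 - |t| : ℝ) : ℂ) *
      Complex.exp (Complex.I * (t * (l * y))) *
        g (1 + (1 / ((n : ℝ) + 1) : ℝ) + Complex.I * (l * t))) atTop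
      (𝓝 (∫ t in (-1 : ℝ)..1, ((1 - |t| : ℝ) : ℂ) * Complex.exp (Complex.I * (t * (l * y))) *
        g (1 + Complex.I * (l * t)))) := by
    have hc : Continuous fun e : ℝ => ∫ t in (-1 : ℝ)..1, ((1 - |t| : ℝ) : ℂ) *
        Complex.exp (Complex.I * (t * (l * y))) *
          g (1 + (max e 0 : ℝ) + Complex.I * (l * t)) := by
      apply intervalIntegral.continuous_parametric_intervalIntegral_of_continuous'
      unfold Function.uncurry
      refine Continuous.mul (by fun_prop) (hg.comp_continuous (by fun_prop) fun z => ?_)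
      simp
    have := (hc.tendsto 0).comp hε
    simp only [Function.comp_def, max_self, Complex.ofReal_zero, add_zero,
      fun n => max_eq_left (hpos n).le] at this
    exact this
  rw [← integral_complex_ofReal]
  simp only [Complex.ofReal_mul (B _)]
  refine tendsto_nhds_unique t1 (t2.congr fun n => ?_)
  rw [laplace_fejer_aux hB hC hL l y _ (hpos n)]

lemma tendsto_fejer_convolution {B : ℝ → ℝ} {C : ℝ} (hB : Measurable B) (hC : ∀ u, |B u| ≤ C)
    {g : ℂ → ℂ} (hg : ContinuousOn g {s | 1 ≤ s.re}) (hL : ∀ s : ℂ, 1 < s.re →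
      ∫ u in Ioi (0 : ℝ), (B u : ℂ) * Complex.exp (-(s - 1) * u) = g s)
    (l : ℝ) (hl : 0 < l) :
    Tendsto (fun y => ∫ u in Ioi (0 : ℝ), B u * fejer (l * (y - u))) atTop (𝓝 0) := by
  have h := Real.tendsto_integral_exp_smul_cocompact (fun t : ℝ => (Ioc (-1 : ℝ) 1).indicator
    (fun t => ((1 - |t| : ℝ) : ℂ) * g (1 + Complex.I * (l * t))) t)
  have h2 : Tendsto (fun y : ℝ => -(l / (2 * Real.pi)) * y) atTop (cocompact ℝ) := by
    refine Tendsto.mono_right ?_ atBot_le_cocompact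
    exact tendsto_id.const_mul_atTop_of_neg (by have := Real.pi_pos; simp; positivity)
  have h3 := (h.comp h2)
  have h4 : Tendsto (fun y => ((∫ u in Ioi (0 : ℝ), B u * fejer (l * (y - u)) : ℝ) : ℂ)) atTop
      (𝓝 0) := by
    refine h3.congr fun y => ?_
    rw [laplace_fejer hB hC hg hL l y hl, intervalIntegral.integral_of_le (by norm_num),
      ← integral_indicator measurableSet_Ioc]
    simp only [Function.comp_def]
    congr 1
    ext t
    by_cases ht : t ∈ Ioc (-1 : ℝ) 1
    · simp only [indicator_of_mem ht, Circle.smul_def, Real.fourierChar_apply, smul_eq_mul]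
      have : ((2 * Real.pi * -(t * (-(l / (2 * Real.pi)) * y)) : ℝ) : ℂ) * Complex.I =
          Complex.I * (t * (l * y)) := by
        push_cast
        have : (Real.pi : ℂ) ≠ 0 := by exact_mod_cast Real.pi_pos.ne'
        field_simp
      rw [this]
      ring
    · simp [indicator_of_notMem ht]
  exact (Complex.continuous_re.tendsto _).comp h4

lemma tendsto_fejer_average {B : ℝ → ℝ} {C δ : ℝ} (hB : Measurable B) (hC : ∀ u, |B u| ≤ C)
    (hB0 : ∀ u < 0, B u = 0) {l : ℝ} (hl : 0 < l)
    (h : Tendsto (fun y => ∫ u in Ioi (0 : ℝ), (B u - δ) * fejer (l * (y - u))) atTop (𝓝 0)) :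
    Tendsto (fun y => ∫ v, B (y - v / l) * fejer v) atTop (𝓝 (δ * ∫ v, fejer v)) := by
  have hm : ∀ y, Measurable fun v => B (y - v / l) := fun y => hB.comp (by fun_prop)
  have i1 : ∀ y, Integrable fun v => B (y - v / l) * fejer v := fun y =>
    integrable_fejer.bdd_mul (c := C) (hm y).aestronglyMeasurable
      (Eventually.of_forall fun v => hC _)
  have i2 : ∀ y, Integrable fun v => (Iio (l * y)).indicator (fun v => δ * fejer v) v := fun y =>
    (integrable_fejer.const_mul δ).indicator measurableSet_Iio
  have e1 : ∀ y, l * ∫ u in Ioi (0 : ℝ), (B u - δ) * fejer (l * (y - u)) =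
      (∫ v, B (y - v / l) * fejer v) -
        ∫ v, (Iio (l * y)).indicator (fun v => δ * fejer v) v := by
    intro y
    rw [← integral_sub (i1 y) (i2 y), ← integral_indicator measurableSet_Ioi]
    have h1 := integral_sub_left_eq_self (fun v => (Ioi (0 : ℝ)).indicator
      (fun u => (B u - δ) * fejer (l * (y - u))) v) volume y
    rw [← h1]
    have h2 := Measure.integral_comp_mul_left (fun v => (Ioi (0 : ℝ)).indicator
      (fun u => (B u - δ) * fejer (l * (y - u))) (y - v / l)) l
    rw [abs_of_pos (inv_pos.2 hl), smul_eq_mul] at h2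
    have h3 : ∀ x, y - l * x / l = y - x := fun x => by field_simp
    simp only [h3] at h2
    rw [h2, ← mul_assoc, mul_inv_cancel₀ hl.ne', one_mul]
    apply integral_congr_ae
    have hne : ∀ᵐ v : ℝ, v ≠ l * y := by
      simp [ae_iff]
    filter_upwards [hne] with v hv
    have e : l * (y - (y - v / l)) = v := by field_simp; ring
    by_cases hlt : v < l * y
    · have : y - v / l ∈ Ioi (0 : ℝ) := by
        rw [mem_Ioi, sub_pos, div_lt_iff₀ hl]; linarith
      rw [indicator_of_mem this, indicator_of_mem (show v ∈ Iio (l * y) from hlt), e]; ring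
    · have hgt : l * y < v := lt_of_le_of_ne (not_lt.1 hlt) (Ne.symm hv)
      have h4 : y - v / l < 0 := by
        rw [sub_neg, lt_div_iff₀ hl]; linarith
      have : y - v / l ∉ Ioi (0 : ℝ) := fun h => absurd h4 (not_lt.2 (le_of_lt h))
      rw [indicator_of_notMem this, indicator_of_notMem (show v ∉ Iio (l * y) from hlt),
        hB0 _ h4]; ring
  have t2 : Tendsto (fun y => ∫ v, (Iio (l * y)).indicator (fun v => δ * fejer v) v) atTop
      (𝓝 (∫ v, δ * fejer v)) := by
    refine tendsto_integral_filter_of_dominated_convergence (fun v => |δ| * fejer v) ?_ ?_ ?_ ?_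
    · exact Eventually.of_forall fun y => (i2 y).aestronglyMeasurable
    · refine Eventually.of_forall fun y => Eventually.of_forall fun v => ?_
      refine (norm_indicator_le_norm_self _ _).trans ?_
      rw [norm_mul, Real.norm_eq_abs, Real.norm_of_nonneg (fejer_nonneg v)]
    · exact integrable_fejer.const_mul _
    · refine Eventually.of_forall fun v => tendsto_const_nhds.congr' ?_
      filter_upwards [(tendsto_id.const_mul_atTop hl).eventually_gt_atTop v] with y hy
      rw [indicator_of_mem]
      exact hy
  rw [integral_const_mul] at t2
  have t3 := (h.const_mul l).add t2
  rw [mul_zero, zero_add] at t3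
  refine t3.congr fun y => ?_
  rw [e1]; ring

lemma tendsto_of_fejer_average {B : ℝ → ℝ} {C δ : ℝ} (hB : Measurable B) (hC : ∀ u, |B u| ≤ C)
    (hB0 : ∀ u, 0 ≤ B u) (hmono : ∀ u v, u ≤ v → B u * Real.exp u ≤ B v * Real.exp v)
    (h : ∀ l > 0, Tendsto (fun y => ∫ v, B (y - v / l) * fejer v) atTop
      (𝓝 (δ * ∫ v, fejer v))) :
    Tendsto B atTop (𝓝 δ) := by
  set J := ∫ v, fejer v with hJ
  have hJ0 : 0 < J := integral_fejer_pos
  set JR : ℕ → ℝ := fun n => ∫ v in Icc (-(n : ℝ)) n, fejer v with hJR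
  have hJt : Tendsto JR atTop (𝓝 J) := by
    have := (aecover_Icc (μ := volume) (a := fun n : ℕ => -(n : ℝ)) (b := fun n : ℕ => (n : ℝ))
      (tendsto_neg_atTop_atBot.comp tendsto_natCast_atTop_atTop)
      tendsto_natCast_atTop_atTop).integral_tendsto_of_countably_generated integrable_fejer
    exact this
  have hm : ∀ l y, Measurable fun v => B (y - v / l) := fun l y => hB.comp (by fun_prop)
  have i1 : ∀ l y, Integrable fun v => B (y - v / l) * fejer v := fun l y =>
    integrable_fejer.bdd_mul (c := C) (hm l y).aestronglyMeasurable
      (Eventually.of_forall fun v => hC _)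
  have hC0 : 0 ≤ C := (abs_nonneg _).trans (hC 0)
  have hBC : ∀ u, B u ≤ C := fun u => (le_abs_self _).trans (hC u)
  have step : ∀ u v r, u ≤ v → v ≤ u + r → B u * Real.exp (-r) ≤ B v := by
    intro u v r h1 h2
    have h3 := hmono u v h1
    have h4 : B u * Real.exp u * Real.exp (-v) ≤ B v := by
      calc _ ≤ B v * Real.exp v * Real.exp (-v) := by gcongr
        _ = B v := by rw [mul_assoc, ← Real.exp_add]; simp
    refine le_trans ?_ h4
    rw [mul_assoc, ← Real.exp_add]
    exact mul_le_mul_of_nonneg_left (Real.exp_le_exp.2 (by linarith)) (hB0 u)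
  have upper : ∀ n : ℕ, 0 < n → ∀ y, B y * Real.exp (-(2 / n)) * JR n ≤
      ∫ v, B ((y + 1 / n) - v / (n ^ 2 : ℝ)) * fejer v := by
    intro n hn y
    have hn' : (0 : ℝ) < n := by exact_mod_cast hn
    refine le_trans ?_ (setIntegral_le_integral (s := Icc (-(n : ℝ)) n) (i1 _ _)
      (Eventually.of_forall fun v => mul_nonneg (hB0 _) (fejer_nonneg _)))
    rw [hJR, ← integral_const_mul]
    refine setIntegral_mono_on (integrable_fejer.const_mul _).integrableOn (i1 _ _).integrableOn
      measurableSet_Icc fun v hv => ?_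
    refine mul_le_mul_of_nonneg_right (step _ _ _ ?_ ?_) (fejer_nonneg v)
    · have : v / (n : ℝ) ^ 2 ≤ 1 / n := by
        rw [div_le_div_iff₀ (by positivity) hn']; nlinarith [hv.2]
      linarith
    · have : -(1 / (n : ℝ)) ≤ v / (n : ℝ) ^ 2 := by
        rw [neg_div', div_le_div_iff₀ hn' (by positivity)]; nlinarith [hv.1]
      have e : 2 / (n : ℝ) = 1 / n + 1 / n := by ring
      linarith
  have lower : ∀ n : ℕ, 0 < n → ∀ y, ∫ v, B ((y - 1 / n) - v / (n ^ 2 : ℝ)) * fejer v ≤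
      B y * Real.exp (2 / n) * J + C * (J - JR n) := by
    intro n hn y
    have hn' : (0 : ℝ) < n := by exact_mod_cast hn
    have e2 := integral_add_compl (μ := volume) (s := Icc (-(n : ℝ)) n) measurableSet_Icc
      integrable_fejer
    rw [← integral_add_compl (s := Icc (-(n : ℝ)) n) measurableSet_Icc (i1 _ _)]
    have e3 : C * (J - JR n) = ∫ v in (Icc (-(n : ℝ)) n)ᶜ, C * fejer v := by
      rw [integral_const_mul, hJ, ← e2]; ring
    rw [e3]
    refine add_le_add ?_ ?_
    · have hle : ∫ v in Icc (-(n : ℝ)) n, B y * Real.exp (2 / n) * fejer v ≤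
          B y * Real.exp (2 / n) * J := by
        rw [hJ, ← integral_const_mul]
        exact setIntegral_le_integral (integrable_fejer.const_mul _) (Eventually.of_forall
          fun v => mul_nonneg (mul_nonneg (hB0 _) (Real.exp_nonneg _)) (fejer_nonneg _))
      refine le_trans ?_ hle
      refine setIntegral_mono_on (i1 _ _).integrableOn (integrable_fejer.const_mul _).integrableOn
        measurableSet_Icc fun v hv => ?_
      refine mul_le_mul_of_nonneg_right ?_ (fejer_nonneg v)
      have h5 : -(1 / (n : ℝ)) ≤ v / (n : ℝ) ^ 2 := by
        rw [neg_div', div_le_div_iff₀ hn' (by positivity)]; nlinarith [hv.1]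
      have h6 : v / (n : ℝ) ^ 2 ≤ 1 / n := by
        rw [div_le_div_iff₀ (by positivity) hn']; nlinarith [hv.2]
      have e : 2 / (n : ℝ) = 1 / n + 1 / n := by ring
      have := step (y - 1 / n - v / (n : ℝ) ^ 2) y (2 / n) (by linarith) (by linarith)
      calc _ = B (y - 1 / n - v / (n : ℝ) ^ 2) * Real.exp (-(2 / n)) * Real.exp (2 / n) := by
            rw [mul_assoc, ← Real.exp_add]; simp
        _ ≤ _ := by gcongr
    · exact setIntegral_mono_on (i1 _ _).integrableOn (integrable_fejer.const_mul _).integrableOn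
        measurableSet_Icc.compl fun v _ => mul_le_mul_of_nonneg_right (hBC _) (fejer_nonneg v)
  have h2n : Tendsto (fun n : ℕ => 2 / (n : ℝ)) atTop (𝓝 0) :=
    tendsto_const_div_atTop_nhds_zero_nat 2
  have hexp : Tendsto (fun n : ℕ => Real.exp (2 / (n : ℝ))) atTop (𝓝 1) := by
    have := (Real.continuous_exp.tendsto 0).comp h2n
    rwa [Real.exp_zero] at this
  rw [tendsto_order]
  constructor
  · intro a ha
    have t1 : Tendsto (fun n : ℕ => a * Real.exp (2 / (n : ℝ)) * J + C * (J - JR n)) atTop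
        (𝓝 (a * 1 * J + C * (J - J))) :=
      ((hexp.const_mul a).mul_const J).add ((tendsto_const_nhds.sub hJt).const_mul C)
    have t2 := t1.eventually_lt_const (u := δ * J) (by nlinarith)
    obtain ⟨n, hn, hn0⟩ := (t2.and (eventually_gt_atTop 0)).exists
    have t3 := (h ((n : ℝ) ^ 2) (by positivity)).comp
      (tendsto_atTop_add_const_right atTop (-(1 / (n : ℝ))) tendsto_id)
    filter_upwards [t3.eventually_const_lt hn] with y hy
    have := lower n hn0 y
    simp only [Function.comp_def, id, ← sub_eq_add_neg] at hy
    have h7 := hy.trans_le this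
    have h8 : 0 < Real.exp (2 / (n : ℝ)) * J := by positivity
    by_contra hcon
    push Not at hcon
    have := mul_le_mul_of_nonneg_right hcon h8.le
    nlinarith
  · intro a ha
    have t1 : Tendsto (fun n : ℕ => a * (Real.exp (2 / (n : ℝ)))⁻¹ * JR n) atTop
        (𝓝 (a * 1⁻¹ * J)) :=
      ((hexp.inv₀ one_ne_zero).const_mul a).mul hJt
    have t2 := t1.eventually_const_lt (u := δ * J) (by rw [inv_one, mul_one]; nlinarith)
    obtain ⟨n, hn, hn0, hn1⟩ :=
      (t2.and ((eventually_gt_atTop 0).and (hJt.eventually_const_lt hJ0))).exists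
    have t3 := (h ((n : ℝ) ^ 2) (by positivity)).comp
      (tendsto_atTop_add_const_right atTop (1 / (n : ℝ)) tendsto_id)
    filter_upwards [t3.eventually_lt_const hn] with y hy
    have := upper n hn0 y
    simp only [Function.comp_def, id] at hy
    have h7 := this.trans_lt hy
    rw [Real.exp_neg] at h7
    have h8 : 0 < (Real.exp (2 / (n : ℝ)))⁻¹ * JR n := by positivity
    by_contra hcon
    push Not at hcon
    have := mul_le_mul_of_nonneg_right hcon h8.le
    nlinarith

/-- A Wiener–Ikehara theorem for Dirichlet series with nonnegative coefficients satisfying a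
Chebyshev-type upper bound. -/
theorem wiener_ikehara {a : ℕ → ℝ} (ha : ∀ n, 0 ≤ a n) {C : ℝ}
    (hC : ∀ N : ℕ, ∑ n ∈ Finset.Icc 1 N, a n ≤ C * N) {F : ℂ → ℂ} {δ : ℝ}
    (hF : ContinuousOn F {s | 1 ≤ s.re})
    (hL : ∀ s : ℂ, 1 < s.re → LSeries (fun n => (a n : ℂ)) s = F s + δ / (s - 1)) :
    Tendsto (fun N : ℕ => (∑ n ∈ Finset.Icc 1 N, a n) / N) atTop (𝓝 δ) := by
  set S : ℝ → ℝ := fun t => ∑ n ∈ Finset.Icc 1 ⌊t⌋₊, a n with hS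
  have hS0 : ∀ t, 0 ≤ S t := fun t => Finset.sum_nonneg fun n _ => ha n
  have hSm : Monotone S := fun s t hst => Finset.sum_le_sum_of_subset_of_nonneg
    (Finset.Icc_subset_Icc_right (Nat.floor_le_floor hst)) fun n _ _ => ha n
  have hC0 : 0 ≤ C := by have := hC 1; simp at this; linarith [ha 1]
  have hSC : ∀ t, 0 ≤ t → S t ≤ C * t := fun t ht =>
    (hC _).trans (mul_le_mul_of_nonneg_left (Nat.floor_le ht) hC0)
  set B : ℝ → ℝ := fun u => S (Real.exp u) * Real.exp (-u) with hBdef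
  have hBm : Measurable B := (hSm.measurable.comp Real.measurable_exp).mul (by fun_prop)
  have hB0 : ∀ u, 0 ≤ B u := fun u => mul_nonneg (hS0 _) (Real.exp_nonneg _)
  have hBC : ∀ u, B u ≤ C := fun u => by
    calc B u ≤ C * Real.exp u * Real.exp (-u) := by
          have := hSC _ (Real.exp_nonneg u)
          simp only [hBdef]; gcongr
      _ = C := by rw [mul_assoc, ← Real.exp_add]; simp
  have hBneg : ∀ u < 0, B u = 0 := fun u hu => by
    have : ⌊Real.exp u⌋₊ = 0 := Nat.floor_eq_zero.2 (by simpa using hu)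
    simp [hBdef, hS, this]
  have hBexp : ∀ u, B u * Real.exp u = S (Real.exp u) := fun u => by
    simp only [hBdef]; rw [mul_assoc, ← Real.exp_add]; simp
  have hmono : ∀ u v, u ≤ v → B u * Real.exp u ≤ B v * Real.exp v := fun u v huv => by
    rw [hBexp, hBexp]; exact hSm (Real.exp_le_exp.2 huv)
  have hO : (fun n : ℕ => ∑ k ∈ Finset.Icc 1 n, a k) =O[atTop] fun n => (n : ℝ) ^ (1 : ℝ) := by
    refine Asymptotics.IsBigO.of_bound C (Eventually.of_forall fun n => ?_)
    rw [Real.norm_of_nonneg (Finset.sum_nonneg fun n _ => ha n), Real.rpow_one,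
      Real.norm_of_nonneg (Nat.cast_nonneg n)]
    exact hC n
  have hlap : ∀ s : ℂ, 1 < s.re →
      ∫ u in Ioi (0 : ℝ), ((B u - δ : ℝ) : ℂ) * Complex.exp (-(s - 1) * u) = (F s - δ) / s := by
    intro s hs
    have hs0 : s ≠ 0 := by rintro rfl; simp at hs; linarith
    have hs1 : s - 1 ≠ 0 := by intro h; rw [sub_eq_zero] at h; rw [h] at hs; simp at hs
    have h1 := LSeries_eq_mul_integral_of_nonneg a zero_le_one hs hO ha
    have h2 := integral_comp_exp_Ioi (fun t : ℝ => (S t : ℂ) * (t : ℂ) ^ (-(s + 1))) 0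
    rw [Real.exp_zero] at h2
    have h3 : ∀ u : ℝ, Real.exp u • ((S (Real.exp u) : ℂ) *
        ((Real.exp u : ℝ) : ℂ) ^ (-(s + 1))) = (B u : ℂ) * Complex.exp (-(s - 1) * u) := by
      intro u
      rw [← hBexp, Complex.cpow_def_of_ne_zero (by exact_mod_cast (Real.exp_pos u).ne'),
        ← Complex.ofReal_log (Real.exp_pos u).le, Real.log_exp, Complex.real_smul]
      push_cast
      have : Complex.exp u * (Complex.exp u * Complex.exp (u * -(s + 1))) =
          Complex.exp (-(s - 1) * u) := by
        rw [← Complex.exp_add, ← Complex.exp_add]; congr 1; ring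
      rw [← this]; ring
    simp only [h3] at h2
    have h4 : LSeries (fun n => (a n : ℂ)) s =
        s * ∫ u in Ioi (0 : ℝ), (B u : ℂ) * Complex.exp (-(s - 1) * u) := by
      rw [h1, h2]
      simp [hS]
    have hre : (-(s - 1)).re < 0 := by simp; linarith
    have h5 := integral_exp_mul_complex_Ioi hre 0
    have h6 : IntegrableOn (fun u : ℝ => Complex.exp (-(s - 1) * u)) (Ioi 0) :=
      integrableOn_exp_mul_complex_Ioi hre 0
    have h7 : IntegrableOn (fun u : ℝ => (B u : ℂ) * Complex.exp (-(s - 1) * u)) (Ioi 0) :=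
      h6.bdd_mul (c := C) (Complex.measurable_ofReal.comp hBm).aestronglyMeasurable
        (Eventually.of_forall fun u => by
          rw [Complex.norm_real, Real.norm_of_nonneg (hB0 u)]; exact hBC u)
    have h8 : ∫ u in Ioi (0 : ℝ), ((B u - δ : ℝ) : ℂ) * Complex.exp (-(s - 1) * u) =
        (∫ u in Ioi (0 : ℝ), (B u : ℂ) * Complex.exp (-(s - 1) * u)) -
          δ * ∫ u in Ioi (0 : ℝ), Complex.exp (-(s - 1) * u) := by
      rw [← integral_const_mul, ← integral_sub h7 (h6.const_mul _)]
      congr 1; ext u; push_cast; ring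
    rw [h8, h5]
    have h9 := hL s hs
    rw [h4] at h9
    have h10 : ∫ u in Ioi (0 : ℝ), (B u : ℂ) * Complex.exp (-(s - 1) * u) =
        (F s + δ / (s - 1)) / s := by rw [← h9]; field_simp
    rw [h10]
    simp only [Complex.ofReal_zero, mul_zero, Complex.exp_zero]
    field_simp
    ring
  have hg : ContinuousOn (fun s => (F s - δ) / s) {s : ℂ | 1 ≤ s.re} :=
    (hF.sub continuousOn_const).div continuousOn_id fun s hs h => by
      have h' : (1 : ℝ) ≤ s.re := hs
      rw [show s = 0 from h] at h'
      simp at h'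
      linarith
  have hB : Tendsto B atTop (𝓝 δ) := by
    refine tendsto_of_fejer_average hBm (C := C)
      (fun u => by rw [abs_of_nonneg (hB0 u)]; exact hBC u) hB0 hmono fun l hl => ?_
    refine tendsto_fejer_average hBm (C := C)
      (fun u => by rw [abs_of_nonneg (hB0 u)]; exact hBC u) hBneg hl ?_
    refine tendsto_fejer_convolution (hBm.sub_const δ) (C := C + |δ|) (fun u => ?_) hg hlap l hl
    calc |B u - δ| ≤ |B u| + |δ| := abs_sub _ _
      _ ≤ _ := by rw [abs_of_nonneg (hB0 u)]; gcongr; exact hBC u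
  have hlog : Tendsto (fun N : ℕ => Real.log N) atTop atTop :=
    Real.tendsto_log_atTop.comp tendsto_natCast_atTop_atTop
  refine (hB.comp hlog).congr' ?_
  filter_upwards [eventually_gt_atTop 0] with N hN
  have : (0 : ℝ) < N := by exact_mod_cast hN
  simp [hBdef, hS, Real.exp_log this, Real.exp_neg, div_eq_mul_inv]

lemma partialSum_isBigO {f : ℕ → ℂ} {c : ℂ} {K : ℝ}
    (hA : ∀ N : ℕ, ‖∑ n ∈ Finset.Icc 1 N, f n - c * N‖ ≤ K * Real.sqrt N) :
    (fun n ↦ ∑ k ∈ Finset.Icc 1 n, f k) =O[atTop] fun n : ℕ ↦ (n : ℝ) ^ (1 : ℝ) := by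
  refine Asymptotics.IsBigO.of_bound (|K| + ‖c‖) ?_
  filter_upwards [eventually_ge_atTop 1] with n hn
  have h1 : (1 : ℝ) ≤ n := by exact_mod_cast hn
  have h2 : Real.sqrt n ≤ n := by
    rw [Real.sqrt_le_left (by positivity)]; nlinarith
  have h3 : ‖∑ k ∈ Finset.Icc 1 n, f k‖ ≤ K * Real.sqrt n + ‖c‖ * n := by
    calc _ = ‖(∑ k ∈ Finset.Icc 1 n, f k - c * n) + c * n‖ := by ring_nf
      _ ≤ _ := (norm_add_le _ _).trans (by
        gcongr
        · exact hA n
        · simp)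
  have h4 : K * Real.sqrt n ≤ |K| * n := by
    refine (mul_le_mul_of_nonneg_right (le_abs_self K) (Real.sqrt_nonneg _)).trans ?_
    gcongr
  rw [Real.rpow_one, Real.norm_of_nonneg (by positivity)]
  linarith

lemma exists_LSeries_continuation {f : ℕ → ℂ} {c : ℂ} {K : ℝ}
    (hf : ∀ s : ℂ, 1 < s.re → LSeriesSummable f s)
    (hA : ∀ N : ℕ, ‖∑ n ∈ Finset.Icc 1 N, f n - c * N‖ ≤ K * Real.sqrt N) :
    ∃ J : ℂ → ℂ, DifferentiableOn ℂ J {s | 1 / 2 < s.re} ∧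
      ∀ s : ℂ, 1 < s.re → LSeries f s = c * (s / (s - 1)) + J s := by
  set A : ℝ → ℂ := fun t => ∑ n ∈ Finset.Icc 1 ⌊t⌋₊, f n with hAdef
  set φ : ℝ → ℂ := (Ioi (1 : ℝ)).indicator (fun t => A t - c * t) with hφ
  have hAm : Measurable A := by
    have : Measurable (fun n : ℕ => ∑ k ∈ Finset.Icc 1 n, f k) := measurable_from_top
    exact this.comp Nat.measurable_floor
  have hφm : Measurable φ :=
    (hAm.sub (measurable_const.mul Complex.measurable_ofReal)).indicator measurableSet_Ioi
  have hK : 0 ≤ K := by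
    have := (norm_nonneg _).trans (hA 1)
    simpa using this
  have hbd : ∀ t : ℝ, 1 < t → ‖A t - c * t‖ ≤ (K + ‖c‖) * t ^ (1 / 2 : ℝ) := by
    intro t ht
    have h1 := hA ⌊t⌋₊
    have h2 : (⌊t⌋₊ : ℝ) ≤ t := Nat.floor_le (by linarith)
    have h3 : t < ⌊t⌋₊ + 1 := Nat.lt_floor_add_one t
    have h4 : ‖c * (⌊t⌋₊ : ℂ) - c * t‖ ≤ ‖c‖ := by
      rw [← mul_sub, norm_mul]
      have : ‖((⌊t⌋₊ : ℂ) - t)‖ ≤ 1 := by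
        rw [show ((⌊t⌋₊ : ℂ) - t) = ((⌊t⌋₊ - t : ℝ) : ℂ) by push_cast; rfl, Complex.norm_real,
          Real.norm_eq_abs, abs_le]
        constructor <;> linarith
      simpa using mul_le_mul_of_nonneg_left this (norm_nonneg c)
    have h5 : Real.sqrt ⌊t⌋₊ ≤ t ^ (1 / 2 : ℝ) := by
      rw [← Real.sqrt_eq_rpow]; exact Real.sqrt_le_sqrt h2
    have h6 : 1 ≤ t ^ (1 / 2 : ℝ) := Real.one_le_rpow ht.le (by norm_num)
    calc ‖A t - c * t‖ = ‖(A t - c * (⌊t⌋₊ : ℂ)) + (c * (⌊t⌋₊ : ℂ) - c * t)‖ := by ring_nf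
      _ ≤ K * Real.sqrt ⌊t⌋₊ + ‖c‖ := (norm_add_le _ _).trans (add_le_add h1 h4)
      _ ≤ K * t ^ (1 / 2 : ℝ) + ‖c‖ * t ^ (1 / 2 : ℝ) := by
        gcongr
        exact le_mul_of_one_le_right (norm_nonneg c) h6
      _ = _ := by ring
  have hφbd : ∀ t : ℝ, 0 ≤ t → ‖φ t‖ ≤ (K + ‖c‖) * t ^ (1 / 2 : ℝ) := by
    intro t ht0
    by_cases ht : 1 < t
    · rw [hφ, indicator_of_mem (show t ∈ Ioi (1 : ℝ) from ht)]; exact hbd t ht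
    · rw [hφ, indicator_of_notMem (show t ∉ Ioi (1 : ℝ) from ht), norm_zero]; positivity
  have hloc : LocallyIntegrableOn φ (Ioi 0) := by
    have hg : LocallyIntegrable (fun t : ℝ => (K + ‖c‖) * t ^ (1 / 2 : ℝ)) :=
      (continuous_const.mul (Real.continuous_rpow_const (by norm_num))).locallyIntegrable
    have hg' := hg.locallyIntegrableOn (Ioi 0)
    rw [locallyIntegrableOn_iff (isOpen_Ioi.isLocallyClosed)] at hg' ⊢
    intro k hk hkc
    refine (hg' k hk hkc).mono' hφm.aestronglyMeasurable ?_
    filter_upwards [ae_restrict_mem hkc.measurableSet] with t ht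
    exact hφbd t (le_of_lt (hk ht))
  have htop : φ =O[atTop] (fun t : ℝ => t ^ (-(-(1 / 2) : ℝ))) := by
    refine Asymptotics.IsBigO.of_bound (K + ‖c‖) ?_
    filter_upwards [eventually_gt_atTop 0] with t ht
    rw [neg_neg, Real.norm_of_nonneg (by positivity)]
    exact hφbd t ht.le
  have hbot : ∀ b : ℝ, φ =O[𝓝[>] 0] (fun t : ℝ => t ^ (-b)) := by
    intro b
    refine Asymptotics.IsBigO.of_bound 1 ?_
    filter_upwards [Ioo_mem_nhdsGT (show (0 : ℝ) < 1 by norm_num)] with t ht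
    rw [hφ, indicator_of_notMem (by simpa using ht.2.le), norm_zero]
    positivity
  refine ⟨fun s => s * mellin φ (-s), ?_, ?_⟩
  · intro s hs
    have hs' : 1 / 2 < s.re := hs
    have h1 : DifferentiableAt ℂ (mellin φ) (-s) :=
      mellin_differentiableAt_of_isBigO_rpow hloc htop (by simp; linarith)
        (hbot ((-s).re - 1)) (by linarith)
    have h2 : DifferentiableAt ℂ (fun s : ℂ => mellin φ (-s)) s :=
      DifferentiableAt.comp (f := fun s : ℂ => -s) s h1 differentiableAt_id.neg
    exact (differentiableAt_id.mul h2).differentiableWithinAt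
  · intro s hs
    have hconv : MellinConvergent φ (-s) :=
      mellinConvergent_of_isBigO_rpow hloc htop (by simp; linarith)
        (hbot ((-s).re - 1)) (by linarith)
    have h1 := LSeries_eq_mul_integral f (r := 1) zero_le_one hs (hf s hs) (partialSum_isBigO hA)
    have hs0 : s ≠ 0 := by rintro rfl; simp at hs; linarith
    have hs1 : s - 1 ≠ 0 := by
      intro h; rw [sub_eq_zero] at h; rw [h] at hs; simp at hs
    have hre : (-s).re < -1 := by simpa using hs
    have e1 : ∫ t in Ioi (1 : ℝ), (t : ℂ) ^ (-s) = 1 / (s - 1) := by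
      rw [integral_Ioi_cpow_of_lt hre zero_lt_one]
      have : -s + 1 ≠ 0 := by intro h; apply hs1; linear_combination -h
      simp only [Complex.ofReal_one, Complex.one_cpow]
      field_simp; ring
    have i1 : IntegrableOn (fun t : ℝ => (t : ℂ) ^ (-s)) (Ioi 1) :=
      integrableOn_Ioi_cpow_of_lt hre zero_lt_one
    have e2 : mellin φ (-s) =
        ∫ t in Ioi (1 : ℝ), (t : ℂ) ^ (-(s + 1)) * (A t - c * t) := by
      rw [mellin]
      have : ∀ t : ℝ, (t : ℂ) ^ (-s - 1) • φ t =
          (Ioi (1 : ℝ)).indicator (fun t : ℝ => (t : ℂ) ^ (-(s + 1)) * (A t - c * t)) t := by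
        intro t
        rw [hφ]
        by_cases ht : t ∈ Ioi (1 : ℝ)
        · rw [indicator_of_mem ht, indicator_of_mem ht, smul_eq_mul]; congr 2; ring
        · rw [indicator_of_notMem ht, indicator_of_notMem ht, smul_zero]
      simp_rw [this]
      rw [setIntegral_indicator measurableSet_Ioi]
      congr 2
      ext t; simp
    have i2 : IntegrableOn (fun t : ℝ => (t : ℂ) ^ (-(s + 1)) * (A t - c * t)) (Ioi 1) := by
      refine (hconv.mono_set (Ioi_subset_Ioi zero_le_one)).congr_fun ?_ measurableSet_Ioi
      intro t ht
      simp only [hφ]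
      rw [indicator_of_mem ht, smul_eq_mul]; congr 2; ring
    have e3 : ∫ t in Ioi (1 : ℝ), A t * (t : ℂ) ^ (-(s + 1)) =
        (∫ t in Ioi (1 : ℝ), (t : ℂ) ^ (-(s + 1)) * (A t - c * t)) +
          c * ∫ t in Ioi (1 : ℝ), (t : ℂ) ^ (-s) := by
      rw [← integral_const_mul, ← integral_add i2 (i1.const_mul c)]
      refine setIntegral_congr_fun measurableSet_Ioi fun t ht => ?_
      have ht0 : (t : ℂ) ≠ 0 := by
        have : (0 : ℝ) < t := lt_trans zero_lt_one ht
        exact_mod_cast this.ne'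
      have : (t : ℂ) ^ (-s) = (t : ℂ) ^ (-(s + 1)) * t := by
        rw [show -s = -(s + 1) + 1 by ring, Complex.cpow_add _ _ ht0, Complex.cpow_one]
      simp only [this]; ring
    rw [h1]
    change s * ∫ t in Ioi (1 : ℝ), A t * (t : ℂ) ^ (-(s + 1)) = _
    rw [e3, e1]
    simp only [e2]
    ring

/-- Near a point where an analytic function does not vanish identically, its logarithmic
derivative has residue equal to the order of vanishing. -/
lemma exists_order_tendsto {f : ℂ → ℂ} {z₀ : ℂ} (hf : AnalyticAt ℂ f z₀)
    (h0 : ¬ ∀ᶠ z in 𝓝 z₀, f z = 0) :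
    ∃ n : ℕ, Tendsto (fun z => (z - z₀) * (deriv f z / f z)) (𝓝[≠] z₀) (𝓝 n) ∧
      (n = 0 ↔ f z₀ ≠ 0) := by
  obtain ⟨n, k, hk, hk0, hfk⟩ := (hf.exists_eventuallyEq_pow_smul_nonzero_iff).mpr h0
  refine ⟨n, ?_, ?_⟩
  · have h1 : ∀ᶠ z in 𝓝 z₀, deriv f z = n * (z - z₀) ^ (n - 1) * k z + (z - z₀) ^ n * deriv k z := by
      have h2 := hfk.eventually_nhds
      have h3 := hk.eventually_analyticAt
      filter_upwards [h2, h3] with z hz hkz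
      have h4 : f =ᶠ[𝓝 z] fun z => (z - z₀) ^ n * k z := by
        filter_upwards [hz] with w hw using hw
      rw [h4.deriv_eq]
      have h5 : HasDerivAt (fun z : ℂ => (z - z₀) ^ n) (n * (z - z₀) ^ (n - 1) * 1) z :=
        ((hasDerivAt_id z).sub_const z₀).pow n
      refine (h5.mul hkz.differentiableAt.hasDerivAt).deriv.trans ?_
      ring
    have hkc : ∀ᶠ z in 𝓝 z₀, k z ≠ 0 := hk.continuousAt.eventually_ne hk0
    have h6 : Tendsto (fun z => (n : ℂ) + (z - z₀) * (deriv k z / k z)) (𝓝[≠] z₀) (𝓝 n) := by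
      have : ContinuousAt (fun z => (n : ℂ) + (z - z₀) * (deriv k z / k z)) z₀ :=
        continuousAt_const.add ((continuousAt_id.sub continuousAt_const).mul
          (hk.deriv.continuousAt.div hk.continuousAt hk0))
      have h7 := this.tendsto.mono_left (nhdsWithin_le_nhds (s := {z₀}ᶜ))
      simpa using h7
    refine h6.congr' ?_
    filter_upwards [nhdsWithin_le_nhds h1, nhdsWithin_le_nhds hkc, nhdsWithin_le_nhds hfk,
      self_mem_nhdsWithin] with z hz1 hz2 hz3 hz4
    have hz : z - z₀ ≠ 0 := sub_ne_zero.mpr hz4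
    rw [hz1, hz3, smul_eq_mul]
    rcases Nat.eq_zero_or_pos n with rfl | hn
    · simp
    · obtain ⟨m, rfl⟩ : ∃ m, n = m + 1 := ⟨n - 1, by omega⟩
      simp only [Nat.add_sub_cancel]
      field_simp
      ring
  · have := hfk.self_of_nhds
    rw [this]
    rcases Nat.eq_zero_or_pos n with rfl | hn
    · simpa using hk0
    · simp [hn.ne']

lemma isPreconnected_re_gt (a : ℝ) : IsPreconnected {s : ℂ | a < s.re} :=
  (convex_halfSpace_re_gt a).isPreconnected

lemma isOpen_re_gt (a : ℝ) : IsOpen {s : ℂ | a < s.re} :=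
  isOpen_lt continuous_const Complex.continuous_re

/-- A solution of `L' = -L D` on a half plane which is not identically zero has no zeros. -/
lemma ne_zero_of_deriv_eq {L D : ℂ → ℂ} {a : ℝ} (hL : AnalyticOnNhd ℂ L {s | a < s.re})
    (hD : AnalyticOnNhd ℂ D {s | a < s.re})
    (h : ∀ s : ℂ, a < s.re → deriv L s = -(L s * D s)) {s₁ : ℂ} (hs₁ : a < s₁.re)
    (h1 : L s₁ ≠ 0) : ∀ s : ℂ, a < s.re → L s ≠ 0 := by
  intro s hs h0
  have hne : ¬ ∀ᶠ z in 𝓝 s, L z = 0 := by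
    intro hz
    exact h1 (hL.eqOn_zero_of_preconnected_of_eventuallyEq_zero (isPreconnected_re_gt a) hs hz hs₁)
  obtain ⟨n, hn, hn0⟩ := exists_order_tendsto (hL s hs) hne
  have hev : ∀ᶠ z in 𝓝[≠] s, L z ≠ 0 :=
    (hL s hs).eventually_eq_zero_or_eventually_ne_zero.resolve_left hne
  have h2 : Tendsto (fun z => (z - s) * (-D z)) (𝓝[≠] s) (𝓝 0) := by
    have : ContinuousAt (fun z => (z - s) * (-D z)) s :=
      (continuousAt_id.sub continuousAt_const).mul (hD s hs).continuousAt.neg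
    simpa using this.tendsto.mono_left (nhdsWithin_le_nhds (s := {s}ᶜ))
  have h3 : (fun z => (z - s) * (deriv L z / L z)) =ᶠ[𝓝[≠] s] fun z => (z - s) * (-D z) := by
    filter_upwards [hev, nhdsWithin_le_nhds ((isOpen_re_gt a).mem_nhds hs)] with z hz hza
    rw [h z hza]; field_simp
  have h4 := tendsto_nhds_unique (hn.congr' h3) h2
  have h5 : n = 0 := by exact_mod_cast h4
  exact (hn0.mp h5) h0

/-- The boundary behaviour of `D = ε / (s - 1) - H' / H` along a horizontal ray. -/
lemma exists_boundary_order {H D : ℂ → ℂ} {ε : ℂ}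
    (hH : DifferentiableOn ℂ H {s | 1 / 2 < s.re})
    (hH0 : ∀ s : ℂ, 1 < s.re → H s ≠ 0)
    (hD : ∀ s : ℂ, 1 < s.re → D s = ε / (s - 1) - deriv H s / H s) (t : ℝ) :
    ∃ n : ℕ, Tendsto (fun σ : ℝ => ((σ : ℂ) - 1) * D (σ + t * Complex.I)) (𝓝[>] 1)
        (𝓝 ((if t = 0 then ε else 0) - n)) ∧ (n = 0 ↔ H (1 + t * Complex.I) ≠ 0) := by
  have hmem : (1 + t * Complex.I : ℂ) ∈ {s : ℂ | 1 / 2 < s.re} := by simp; norm_num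
  have hray : Tendsto (fun σ : ℝ => (σ + t * Complex.I : ℂ)) (𝓝[>] 1) (𝓝[≠] (1 + t * Complex.I)) := by
    refine tendsto_nhdsWithin_iff.mpr ⟨?_, ?_⟩
    · have : Continuous (fun σ : ℝ => (σ + t * Complex.I : ℂ)) := by fun_prop
      simpa using (this.tendsto 1).mono_left nhdsWithin_le_nhds
    · filter_upwards [self_mem_nhdsWithin] with σ hσ
      intro h
      have := congrArg Complex.re h
      simp at this
      exact (ne_of_gt hσ) this
  have han := hH.analyticAt ((isOpen_re_gt (1 / 2)).mem_nhds hmem)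
  have hne : ¬ ∀ᶠ z in 𝓝 (1 + t * Complex.I : ℂ), H z = 0 := by
    intro hz
    have h1 := (hray.mono_right nhdsWithin_le_nhds).eventually hz
    obtain ⟨σ, h2, h3⟩ := (h1.and (self_mem_nhdsWithin)).exists
    exact hH0 _ (by simpa using h3) h2
  obtain ⟨n, hn, hn0⟩ := exists_order_tendsto han hne
  refine ⟨n, ?_, hn0⟩
  have h1 := hn.comp hray
  have h2 : Tendsto (fun σ : ℝ => ((σ : ℂ) - 1) * (ε / (σ + t * Complex.I - 1))) (𝓝[>] 1)
      (𝓝 (if t = 0 then ε else 0)) := by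
    by_cases ht : t = 0
    · subst ht
      simp only [if_true]
      refine tendsto_const_nhds.congr' ?_
      filter_upwards [self_mem_nhdsWithin] with σ hσ
      have : (σ : ℂ) - 1 ≠ 0 := by
        rw [sub_ne_zero]; exact_mod_cast (ne_of_gt hσ)
      simp only [Complex.ofReal_zero, zero_mul, add_zero]
      field_simp
    · rw [if_neg ht]
      have : ContinuousAt (fun σ : ℝ => ((σ : ℂ) - 1) * (ε / (σ + t * Complex.I - 1))) 1 := by
        refine ContinuousAt.mul (by fun_prop) (ContinuousAt.div (by fun_prop) (by fun_prop) ?_)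
        simp [ht]
      simpa using this.tendsto.mono_left (nhdsWithin_le_nhds (s := Ioi 1))
  refine (h2.sub h1).congr' ?_
  filter_upwards [self_mem_nhdsWithin] with σ hσ
  rw [hD _ (by simpa using hσ)]
  simp only [Function.comp]
  ring

section characters
variable {A : Type*} [AddCommGroup A] [Fintype A]

lemma addChar_norm (ψ : AddChar A ℂ) (a : A) : ‖ψ a‖ = 1 := by
  have h : ψ a ^ Fintype.card A = 1 := by
    rw [← AddChar.map_nsmul_eq_pow, card_nsmul_eq_zero, AddChar.map_zero_eq_one]
  exact Complex.norm_eq_one_of_pow_eq_one h Fintype.card_ne_zero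

lemma addChar_eq_zero_of_two_nsmul (hodd : Odd (Fintype.card A)) {ψ : AddChar A ℂ}
    (h : 2 • ψ = 0) : ψ = 0 := by
  ext a
  have h1 : ψ a ^ Fintype.card A = 1 := by
    rw [← AddChar.map_nsmul_eq_pow, card_nsmul_eq_zero, AddChar.map_zero_eq_one]
  have h2 : ψ a ^ 2 = 1 := by
    have := DFunLike.congr_fun h a
    rwa [AddChar.nsmul_apply, AddChar.zero_apply] at this
  obtain ⟨k, hk⟩ := hodd
  rw [hk, pow_succ, pow_mul, h2, one_pow, one_mul] at h1
  rw [h1, AddChar.zero_apply]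

/-- The twist of a family of arithmetic functions indexed by a group by a character. -/
noncomputable def twist (r : A → ℕ → ℝ) (ψ : AddChar A ℂ) (n : ℕ) : ℂ := ∑ a, ψ a * (r a n : ℂ)

lemma norm_twist_le {r : A → ℕ → ℝ} (hr : ∀ a n, 0 ≤ r a n) (ψ : AddChar A ℂ) (n : ℕ) :
    ‖twist r ψ n‖ ≤ ∑ a, r a n := by
  refine (norm_sum_le _ _).trans (Finset.sum_le_sum fun a _ => ?_)
  rw [norm_mul, addChar_norm, one_mul, Complex.norm_real, Real.norm_of_nonneg (hr a n)]

lemma LSeriesSummable_twist {r : A → ℕ → ℝ} (hr : ∀ a n, 0 ≤ r a n) {C : ℝ}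
    (hC : ∀ N : ℕ, ∑ n ∈ Finset.Icc 1 N, ∑ a, r a n ≤ C * N) (ψ : AddChar A ℂ) {s : ℂ}
    (hs : 1 < s.re) : LSeriesSummable (twist r ψ) s := by
  refine LSeriesSummable_of_sum_norm_bigO (r := 1) ?_ zero_le_one hs
  refine Asymptotics.IsBigO.of_bound C (Eventually.of_forall fun N => ?_)
  rw [Real.rpow_one, Real.norm_of_nonneg (Finset.sum_nonneg fun _ _ => norm_nonneg _),
    Real.norm_of_nonneg (Nat.cast_nonneg N)]
  exact (Finset.sum_le_sum fun n _ => norm_twist_le hr ψ n).trans (hC N)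

lemma abscissa_twist_lt {r : A → ℕ → ℝ} (hr : ∀ a n, 0 ≤ r a n) {C : ℝ}
    (hC : ∀ N : ℕ, ∑ n ∈ Finset.Icc 1 N, ∑ a, r a n ≤ C * N) (ψ : AddChar A ℂ) :
    LSeries.abscissaOfAbsConv (twist r ψ) ≤ 1 := by
  refine LSeries.abscissaOfAbsConv_le_of_forall_lt_LSeriesSummable' fun y hy => ?_
  exact LSeriesSummable_twist hr hC ψ (by simpa using (by exact_mod_cast hy : (1:ℝ) < y))

lemma twist_sum [DecidableEq A] (r : A → ℕ → ℝ) (n : ℕ) :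
    ∑ ψ : AddChar A ℂ, twist r ψ n = Fintype.card A * r 0 n := by
  simp only [twist]
  rw [Finset.sum_comm]
  simp_rw [← Finset.sum_mul, AddChar.sum_apply_eq_ite]
  simp

lemma twist_convolution {r Λ : A → ℕ → ℝ}
    (hid : ∀ a n, r a n * Real.log n =
      ∑ p ∈ n.divisorsAntidiagonal, ∑ u, r u p.1 * Λ (a - u) p.2) (ψ : AddChar A ℂ) :
    LSeries.logMul (twist r ψ) = LSeries.convolution (twist r ψ) (twist Λ ψ) := by
  rw [LSeries.convolution_def]
  ext n
  have h1 : LSeries.logMul (twist r ψ) n = ∑ a, ψ a * ((r a n * Real.log n : ℝ) : ℂ) := by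
    simp only [LSeries.logMul, twist, Finset.mul_sum]
    refine Finset.sum_congr rfl fun a _ => ?_
    rw [← Complex.ofReal_natCast, ← Complex.ofReal_log (Nat.cast_nonneg n)]
    push_cast; ring
  rw [h1]
  simp_rw [hid]
  push_cast
  simp_rw [Finset.mul_sum]
  rw [Finset.sum_comm]
  refine Finset.sum_congr rfl fun p _ => ?_
  rw [twist, twist, Finset.sum_mul_sum, Finset.sum_comm]
  refine Finset.sum_congr rfl fun u _ => ?_
  rw [← Equiv.sum_comp (Equiv.addRight u)]
  refine Finset.sum_congr rfl fun v _ => ?_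
  simp only [Equiv.coe_addRight, add_sub_cancel_right, AddChar.map_add_eq_mul]
  ring

lemma deriv_LSeries_twist {r Λ : A → ℕ → ℝ} (hr : ∀ a n, 0 ≤ r a n) (hΛ : ∀ a n, 0 ≤ Λ a n)
    (hid : ∀ a n, r a n * Real.log n =
      ∑ p ∈ n.divisorsAntidiagonal, ∑ u, r u p.1 * Λ (a - u) p.2) {C C' : ℝ}
    (hC : ∀ N : ℕ, ∑ n ∈ Finset.Icc 1 N, ∑ a, r a n ≤ C * N)
    (hC' : ∀ N : ℕ, ∑ n ∈ Finset.Icc 1 N, ∑ a, Λ a n ≤ C' * N)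
    (ψ : AddChar A ℂ) {s : ℂ} (hs : 1 < s.re) :
    deriv (LSeries (twist r ψ)) s = -(LSeries (twist r ψ) s * LSeries (twist Λ ψ) s) := by
  have h : LSeries.abscissaOfAbsConv (twist r ψ) < s.re :=
    (abscissa_twist_lt hr hC ψ).trans_lt (by exact_mod_cast hs)
  rw [LSeries_deriv h, twist_convolution hid, LSeries_convolution'
    (LSeriesSummable_twist hr hC ψ hs) (LSeriesSummable_twist hΛ hC' ψ hs)]

lemma LSeries_twist_ne_zero {r Λ : A → ℕ → ℝ} (hr : ∀ a n, 0 ≤ r a n) (hΛ : ∀ a n, 0 ≤ Λ a n)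
    (hid : ∀ a n, r a n * Real.log n =
      ∑ p ∈ n.divisorsAntidiagonal, ∑ u, r u p.1 * Λ (a - u) p.2)
    (h1 : r 0 1 = 1) (h1' : ∀ a ≠ 0, r a 1 = 0) {C C' : ℝ}
    (hC : ∀ N : ℕ, ∑ n ∈ Finset.Icc 1 N, ∑ a, r a n ≤ C * N)
    (hC' : ∀ N : ℕ, ∑ n ∈ Finset.Icc 1 N, ∑ a, Λ a n ≤ C' * N)
    (ψ : AddChar A ℂ) {s : ℂ} (hs : 1 < s.re) : LSeries (twist r ψ) s ≠ 0 := by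
  have hsub : ∀ {ρ : A → ℕ → ℝ} {B : ℝ}, (∀ a n, 0 ≤ ρ a n) →
      (∀ N : ℕ, ∑ n ∈ Finset.Icc 1 N, ∑ a, ρ a n ≤ B * N) →
      AnalyticOnNhd ℂ (LSeries (twist ρ ψ)) {s | 1 < s.re} := by
    intro ρ B h0 hB z hz
    refine LSeries_analyticOnNhd _ z ?_
    have : (1 : EReal) < z.re := by exact_mod_cast hz
    exact (abscissa_twist_lt h0 hB ψ).trans_lt this
  have hlim := LSeries.tendsto_atTop (f := twist r ψ)
    ((abscissa_twist_lt hr hC ψ).trans_lt (by exact_mod_cast EReal.coe_lt_top 1))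
  have hone : twist r ψ 1 = 1 := by
    classical
    rw [twist, Finset.sum_eq_single 0]
    · simp [h1]
    · intro a _ ha; simp [h1' a ha]
    · simp
  rw [hone] at hlim
  obtain ⟨x, hx1, hx2⟩ := ((hlim.eventually_ne one_ne_zero).and (eventually_gt_atTop 1)).exists
  exact ne_zero_of_deriv_eq (hsub hr hC) (hsub hΛ hC')
    (fun z hz => deriv_LSeries_twist hr hΛ hid hC hC' ψ hz) (s₁ := x) (by simpa using hx2) hx1 s hs

/-- The function `(s - 1) ^ ε L(s)`, with `ε = 1` for the trivial character and `ε = 0`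
otherwise, is holomorphic beyond the line `re s = 1`. -/
lemma exists_twist_continuation [DecidableEq A] {r Λ : A → ℕ → ℝ} (hr : ∀ a n, 0 ≤ r a n)
    (hΛ : ∀ a n, 0 ≤ Λ a n)
    (hid : ∀ a n, r a n * Real.log n =
      ∑ p ∈ n.divisorsAntidiagonal, ∑ u, r u p.1 * Λ (a - u) p.2)
    (h1 : r 0 1 = 1) (h1' : ∀ a ≠ 0, r a 1 = 0) {c K : ℝ} (hc : 0 < c)
    (hA : ∀ a (N : ℕ), |∑ n ∈ Finset.Icc 1 N, r a n - c * N| ≤ K * Real.sqrt N) {C C' : ℝ}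
    (hC : ∀ N : ℕ, ∑ n ∈ Finset.Icc 1 N, ∑ a, r a n ≤ C * N)
    (hC' : ∀ N : ℕ, ∑ n ∈ Finset.Icc 1 N, ∑ a, Λ a n ≤ C' * N)
    (ψ : AddChar A ℂ) :
    ∃ H : ℂ → ℂ, DifferentiableOn ℂ H {s | 1 / 2 < s.re} ∧ (ψ = 0 → H 1 ≠ 0) ∧
      (∀ s : ℂ, 1 < s.re → H s ≠ 0) ∧
      ∀ s : ℂ, 1 < s.re →
        LSeries (twist Λ ψ) s = (if ψ = 0 then 1 else 0) / (s - 1) - deriv H s / H s := by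
  have hB : ∀ N : ℕ, ‖∑ n ∈ Finset.Icc 1 N, twist r ψ n - (c * ∑ a, ψ a) * N‖ ≤
      (Fintype.card A * K) * Real.sqrt N := by
    intro N
    have e : ∑ n ∈ Finset.Icc 1 N, twist r ψ n - (c * ∑ a, ψ a) * N =
        ∑ a, ψ a * ((∑ n ∈ Finset.Icc 1 N, r a n - c * N : ℝ) : ℂ) := by
      simp only [twist]
      rw [Finset.sum_comm]
      simp_rw [← Finset.mul_sum]
      rw [Finset.mul_sum, Finset.sum_mul, ← Finset.sum_sub_distrib]
      refine Finset.sum_congr rfl fun a _ => ?_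
      push_cast; ring
    rw [e]
    refine (norm_sum_le _ _).trans ?_
    have : ∀ a ∈ Finset.univ, ‖ψ a * ((∑ n ∈ Finset.Icc 1 N, r a n - c * N : ℝ) : ℂ)‖ ≤
        K * Real.sqrt N := by
      intro a _
      rw [norm_mul, addChar_norm, one_mul, Complex.norm_real]
      exact hA a N
    refine (Finset.sum_le_sum this).trans ?_
    simp [mul_assoc]
  obtain ⟨J, hJ, hJL⟩ := exists_LSeries_continuation
    (fun s hs => LSeriesSummable_twist hr hC ψ hs) hB
  have hL0 := fun (s : ℂ) (hs : 1 < s.re) =>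
    LSeries_twist_ne_zero hr hΛ hid h1 h1' hC hC' ψ hs
  have hder := fun (s : ℂ) (hs : 1 < s.re) =>
    deriv_LSeries_twist hr hΛ hid hC hC' ψ hs
  have hLd : ∀ s : ℂ, 1 < s.re → DifferentiableAt ℂ (LSeries (twist r ψ)) s := by
    intro s hs
    refine (LSeries_hasDerivAt ?_).differentiableAt
    exact (abscissa_twist_lt hr hC ψ).trans_lt (by exact_mod_cast hs)
  by_cases hψ : ψ = 0
  · have hsum : ∑ a, ψ a = (Fintype.card A : ℂ) := by rw [AddChar.sum_eq_ite, if_pos hψ]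
    rw [hsum] at hJL
    have hHL : ∀ s : ℂ, 1 < s.re →
        (c * Fintype.card A) * s + (s - 1) * J s = (s - 1) * LSeries (twist r ψ) s := by
      intro s hs
      have : s - 1 ≠ 0 := by
        intro h; rw [sub_eq_zero] at h; rw [h] at hs; simp at hs
      rw [hJL s hs]; field_simp
    have hs1 : ∀ s : ℂ, 1 < s.re → s - 1 ≠ 0 := by
      intro s hs h; rw [sub_eq_zero] at h; rw [h] at hs; simp at hs
    refine ⟨fun s => (c * Fintype.card A) * s + (s - 1) * J s, ?_, ?_, ?_, ?_⟩
    · exact ((differentiableOn_const _).mul differentiableOn_id).add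
        ((differentiableOn_id.sub (differentiableOn_const _)).mul hJ)
    · intro _
      simp [hc.ne', Fintype.card_ne_zero]
    · intro s hs
      simp only
      rw [hHL s hs]
      exact mul_ne_zero (hs1 s hs) (hL0 s hs)
    · intro s hs
      have hev : (fun s => (c * Fintype.card A) * s + (s - 1) * J s) =ᶠ[𝓝 s]
          fun s => (s - 1) * LSeries (twist r ψ) s := by
        filter_upwards [(isOpen_re_gt 1).mem_nhds hs] with z hz using hHL z hz
      have hd : deriv (fun s => (s - 1) * LSeries (twist r ψ) s) s =
          1 * LSeries (twist r ψ) s + (s - 1) * deriv (LSeries (twist r ψ)) s :=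
        (((hasDerivAt_id s).sub_const 1).mul (hLd s hs).hasDerivAt).deriv
      rw [hev.deriv_eq, hd, hder s hs, if_pos hψ]
      simp only
      rw [hHL s hs]
      have := hs1 s hs
      have := hL0 s hs
      field_simp
      ring
  · have hsum : ∑ a, ψ a = 0 := by rw [AddChar.sum_eq_ite, if_neg hψ]
    have hHL : ∀ s : ℂ, 1 < s.re → J s = LSeries (twist r ψ) s := by
      intro s hs
      rw [hJL s hs, hsum]; ring
    refine ⟨J, hJ, fun h => absurd h hψ, fun s hs => by rw [hHL s hs]; exact hL0 s hs, ?_⟩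
    intro s hs
    have hev : J =ᶠ[𝓝 s] LSeries (twist r ψ) := by
      filter_upwards [(isOpen_re_gt 1).mem_nhds hs] with z hz using hHL z hz
    rw [hev.deriv_eq, hder s hs, if_neg hψ, hHL s hs]
    have := hL0 s hs
    field_simp
    ring

lemma three_four_one_term {Λ : A → ℕ → ℝ} (hΛ : ∀ a n, 0 ≤ Λ a n) (ψ : AddChar A ℂ) (σ t : ℝ)
    (n : ℕ) : 0 ≤ (3 * LSeries.term (twist Λ 0) σ n +
      4 * LSeries.term (twist Λ ψ) (σ + t * Complex.I) n +
      LSeries.term (twist Λ (2 • ψ)) (σ + (2 * t : ℝ) * Complex.I) n).re := by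
  rcases eq_or_ne n 0 with rfl | hn
  · simp
  have hn' : (n : ℂ) ≠ 0 := by exact_mod_cast hn
  have hnpos : (0 : ℝ) < n := by exact_mod_cast Nat.pos_of_ne_zero hn
  simp only [LSeries.term_of_ne_zero hn]
  set w : ℂ := (n : ℂ) ^ (-(t * Complex.I)) with hw
  have hwn : ‖w‖ = 1 := by
    rw [hw, ← Complex.ofReal_natCast, Complex.norm_cpow_eq_rpow_re_of_pos hnpos]; simp
  set q : ℝ := (n : ℝ) ^ (-σ) with hq
  have hq0 : 0 ≤ q := by positivity
  have e0 : 1 / (n : ℂ) ^ (σ : ℂ) = q := by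
    rw [hq, Complex.ofReal_cpow hnpos.le, one_div, ← Complex.cpow_neg]; push_cast; rfl
  have e1 : 1 / (n : ℂ) ^ (σ + t * Complex.I) = q * w := by
    rw [one_div, ← Complex.cpow_neg, neg_add, Complex.cpow_add _ _ hn', ← hw, Complex.cpow_neg,
      ← one_div, e0]
  have e2 : 1 / (n : ℂ) ^ (σ + (2 * t : ℝ) * Complex.I) = q * w ^ 2 := by
    rw [one_div, ← Complex.cpow_neg, neg_add, Complex.cpow_add _ _ hn', Complex.cpow_neg,
      ← one_div, e0, hw, ← Complex.cpow_nat_mul]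
    push_cast; ring_nf
  rw [div_eq_mul_one_div, e0, div_eq_mul_one_div (twist Λ ψ n), e1,
    div_eq_mul_one_div (twist Λ (2 • ψ) n), e2]
  have : (3 * (twist Λ 0 n * q) + 4 * (twist Λ ψ n * (q * w)) + twist Λ (2 • ψ) n * (q * w ^ 2)) =
      ∑ a, ((q * Λ a n : ℝ) : ℂ) * (3 + 4 * (ψ a * w) + (ψ a * w) ^ 2) := by
    simp only [twist, Finset.sum_mul, Finset.mul_sum, ← Finset.sum_add_distrib,
      AddChar.nsmul_apply, AddChar.zero_apply]
    refine Finset.sum_congr rfl fun a _ => ?_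
    push_cast; ring
  rw [this, Complex.re_sum]
  refine Finset.sum_nonneg fun a _ => ?_
  rw [Complex.re_ofReal_mul]
  refine mul_nonneg (mul_nonneg hq0 (hΛ a n)) ?_
  set z := ψ a * w with hz
  have hzn : ‖z‖ = 1 := by rw [hz, norm_mul, addChar_norm, hwn, one_mul]
  have h1 : z.re * z.re + z.im * z.im = 1 := by
    have := Complex.normSq_eq_norm_sq z
    rw [hzn, Complex.normSq_apply] at this
    simpa using this
  have h2 : (3 + 4 * z + z ^ 2).re = 3 + 4 * z.re + (z.re * z.re - z.im * z.im) := by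
    simp [sq]
  rw [h2]
  nlinarith [sq_nonneg (1 + z.re)]

lemma three_four_one {Λ : A → ℕ → ℝ} (hΛ : ∀ a n, 0 ≤ Λ a n) {C : ℝ}
    (hC : ∀ N : ℕ, ∑ n ∈ Finset.Icc 1 N, ∑ a, Λ a n ≤ C * N) (ψ : AddChar A ℂ) {σ : ℝ}
    (hσ : 1 < σ) (t : ℝ) :
    0 ≤ (3 * LSeries (twist Λ 0) σ + 4 * LSeries (twist Λ ψ) (σ + t * Complex.I) +
      LSeries (twist Λ (2 • ψ)) (σ + (2 * t : ℝ) * Complex.I)).re := by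
  have h0 := (LSeriesSummable_twist hΛ hC 0 (s := σ) (by simpa using hσ)).hasSum
  have h1 := (LSeriesSummable_twist hΛ hC ψ (s := σ + t * Complex.I) (by simpa using hσ)).hasSum
  have h2 := (LSeriesSummable_twist hΛ hC (2 • ψ) (s := σ + (2 * t : ℝ) * Complex.I)
    (by simpa using hσ)).hasSum
  have h3 := Complex.hasSum_re (((h0.mul_left 3).add (h1.mul_left 4)).add h2)
  exact h3.nonneg fun n => three_four_one_term hΛ ψ σ t n

/-- Equidistribution of generalised primes in the elements of a finite abelian group of odd
order, under the hypothesis that generalised integers are equidistributed with square root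
error term. -/
theorem equidistribution_of_odd [DecidableEq A] (hodd : Odd (Fintype.card A)) {r Λ : A → ℕ → ℝ}
    (hr : ∀ a n, 0 ≤ r a n) (hΛ : ∀ a n, 0 ≤ Λ a n)
    (hid : ∀ a n, r a n * Real.log n =
      ∑ p ∈ n.divisorsAntidiagonal, ∑ u, r u p.1 * Λ (a - u) p.2)
    (h1 : r 0 1 = 1) (h1' : ∀ a ≠ 0, r a 1 = 0) {c K : ℝ} (hc : 0 < c)
    (hA : ∀ a (N : ℕ), |∑ n ∈ Finset.Icc 1 N, r a n - c * N| ≤ K * Real.sqrt N) {C' : ℝ}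
    (hC' : ∀ N : ℕ, ∑ n ∈ Finset.Icc 1 N, ∑ a, Λ a n ≤ C' * N) :
    Tendsto (fun N : ℕ => (∑ n ∈ Finset.Icc 1 N, Λ 0 n) / N) atTop
      (𝓝 (1 / Fintype.card A)) := by
  have hC : ∀ N : ℕ, ∑ n ∈ Finset.Icc 1 N, ∑ a, r a n ≤ (Fintype.card A * (c + |K|)) * N := by
    intro N
    rw [Finset.sum_comm]
    have : ∀ a ∈ Finset.univ, ∑ n ∈ Finset.Icc 1 N, r a n ≤ (c + |K|) * N := by
      intro a _
      have h2 := (abs_le.mp (hA a N)).2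
      have h3 : Real.sqrt N ≤ N := by
        rw [Real.sqrt_le_left (by positivity)]
        exact_mod_cast Nat.le_self_pow two_ne_zero N
      have h4 : K * Real.sqrt N ≤ |K| * N :=
        (mul_le_mul_of_nonneg_right (le_abs_self K) (Real.sqrt_nonneg _)).trans
          (mul_le_mul_of_nonneg_left h3 (abs_nonneg K))
      linarith
    refine (Finset.sum_le_sum this).trans (le_of_eq ?_)
    simp [mul_assoc]
  choose H hH hH1 hH0 hHD using
    fun ψ : AddChar A ℂ => exists_twist_continuation hr hΛ hid h1 h1' hc hA hC hC' ψ
  have hord := fun (ψ : AddChar A ℂ) (t : ℝ) => exists_boundary_order (hH ψ) (hH0 ψ) (hHD ψ) t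
  have hline : ∀ (ψ : AddChar A ℂ) (t : ℝ), H ψ (1 + t * Complex.I) ≠ 0 := by
    intro ψ t
    by_cases hcase : ψ = 0 ∧ t = 0
    · rw [hcase.2]; simpa using hH1 ψ hcase.1
    have hcase2 : ¬ (2 • ψ = 0 ∧ 2 * t = 0) := by
      rintro ⟨h3, h4⟩
      exact hcase ⟨addChar_eq_zero_of_two_nsmul hodd h3, by linarith⟩
    obtain ⟨m₀, hm₀, hm₀'⟩ := hord 0 0
    obtain ⟨m, hm, hm'⟩ := hord ψ t
    obtain ⟨m₂, hm₂, -⟩ := hord (2 • ψ) (2 * t)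
    have hz0 : m₀ = 0 := hm₀'.mpr (by simpa using hH1 0 rfl)
    have hlim := ((hm₀.const_mul 3).add (hm.const_mul 4)).add hm₂
    have hre := (Complex.continuous_re.tendsto _).comp hlim
    have hnn : ∀ᶠ σ : ℝ in 𝓝[>] 1, 0 ≤ (Complex.re ∘ fun σ : ℝ =>
        3 * (((σ : ℂ) - 1) * LSeries (twist Λ 0) (σ + (0 : ℝ) * Complex.I)) +
        4 * (((σ : ℂ) - 1) * LSeries (twist Λ ψ) (σ + t * Complex.I)) +
        ((σ : ℂ) - 1) * LSeries (twist Λ (2 • ψ)) (σ + (2 * t : ℝ) * Complex.I)) σ := by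
      filter_upwards [self_mem_nhdsWithin] with σ hσ
      have h5 := three_four_one hΛ hC' ψ hσ t
      have h6 : (3 * (((σ : ℂ) - 1) * LSeries (twist Λ 0) (σ + (0 : ℝ) * Complex.I)) +
          4 * (((σ : ℂ) - 1) * LSeries (twist Λ ψ) (σ + t * Complex.I)) +
          ((σ : ℂ) - 1) * LSeries (twist Λ (2 • ψ)) (σ + (2 * t : ℝ) * Complex.I)) =
          ((σ - 1 : ℝ) : ℂ) * (3 * LSeries (twist Λ 0) σ +
            4 * LSeries (twist Λ ψ) (σ + t * Complex.I) +
            LSeries (twist Λ (2 • ψ)) (σ + (2 * t : ℝ) * Complex.I)) := by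
        simp only [Complex.ofReal_zero, zero_mul, add_zero]
        push_cast; ring
      simp only [Function.comp, h6, Complex.re_ofReal_mul]
      exact mul_nonneg (by have : (1 : ℝ) < σ := hσ; linarith) h5
    have h7 := ge_of_tendsto hre hnn
    have h8 : (if t = 0 then (if ψ = 0 then (1 : ℂ) else 0) else 0) = 0 := by
      split_ifs with h9 h10
      · exact absurd ⟨h10, h9⟩ hcase
      · rfl
      · rfl
    have h8' : (if 2 * t = 0 then (if 2 • ψ = 0 then (1 : ℂ) else 0) else 0) = 0 := by
      split_ifs with h9 h10
      · exact absurd ⟨h10, h9⟩ hcase2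
      · rfl
      · rfl
    rw [h8, h8', hz0] at h7
    simp at h7
    have h9 : (4 * m + m₂ : ℝ) ≤ 3 := by linarith
    have h10 : 4 * m + m₂ ≤ 3 := by exact_mod_cast h9
    exact hm'.mp (by omega)
  have hcl : ∀ (ψ : AddChar A ℂ) (s : ℂ), 1 ≤ s.re → H ψ s ≠ 0 := by
    intro ψ s hs
    rcases hs.lt_or_eq with h2 | h2
    · exact hH0 ψ s h2
    · have : s = 1 + (s.im : ℂ) * Complex.I := by
        apply Complex.ext <;> simp [← h2]
      rw [this]; exact hline ψ s.im
  refine wiener_ikehara (a := Λ 0) (C := C') (hΛ 0) ?_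
    (F := fun s => (1 / (Fintype.card A : ℂ)) * ∑ ψ, -(deriv (H ψ) s / H ψ s)) ?_ ?_
  · intro N
    refine (Finset.sum_le_sum fun n _ => ?_).trans (hC' N)
    exact Finset.single_le_sum (f := fun a => Λ a n) (fun a _ => hΛ a n) (Finset.mem_univ 0)
  · refine continuousOn_const.mul (continuousOn_finsetSum _ fun ψ _ => ?_)
    refine ContinuousOn.neg (ContinuousOn.div ?_ ?_ fun s hs => hcl ψ s hs)
    · refine ContinuousOn.mono ((hH ψ).deriv (isOpen_re_gt _)).continuousOn fun s hs => ?_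
      have : 1 ≤ s.re := hs
      change 1 / 2 < s.re
      linarith
    · refine (hH ψ).continuousOn.mono fun s hs => ?_
      have : 1 ≤ s.re := hs
      change 1 / 2 < s.re
      linarith
  · intro s hs
    have hcard : (Fintype.card A : ℂ) ≠ 0 := by exact_mod_cast Fintype.card_ne_zero
    have h2 : LSeries (fun n => ((Λ 0 n : ℝ) : ℂ)) s =
        (1 / (Fintype.card A : ℂ)) * ∑ ψ, LSeries (twist Λ ψ) s := by
      have h3 := hasSum_sum (s := (Finset.univ : Finset (AddChar A ℂ)))
        (fun ψ _ => (LSeriesSummable_twist hΛ hC' ψ hs).hasSum)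
      have h4 := h3.mul_left (1 / (Fintype.card A : ℂ))
      refine HasSum.tsum_eq (h4.congr_fun ?_) |>.trans ?_
      · intro n
        rcases eq_or_ne n 0 with rfl | hn
        · simp
        simp only [LSeries.term_of_ne_zero hn]
        rw [← Finset.sum_div, twist_sum]
        field_simp
      · rfl
    rw [h2]
    have h5 : ∑ ψ, LSeries (twist Λ ψ) s =
        1 / (s - 1) + ∑ ψ, -(deriv (H ψ) s / H ψ s) := by
      simp_rw [hHD _ s hs, sub_eq_add_neg]
      rw [Finset.sum_add_distrib]
      congr 1
      rw [← Finset.sum_div]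
      simp
    rw [h5]
    push_cast
    ring

end characters
end SophieGermain

namespace SophieGermain
open Filter Topology

/-- A system of generalised primes over the rational primes: every prime `p` lies over the
rational prime `under p`, has norm `under p` or `under p ^ 2`, and at most two primes lie
over each rational prime. -/
structure PrimeSystem (P : Type*) where
  /-- the norm of a prime -/
  norm : P → ℕ
  /-- the rational prime below a prime -/
  under : P → ℕ
  under_prime : ∀ p, (under p).Prime
  norm_eq : ∀ p, norm p = under p ∨ norm p = under p ^ 2
  /-- the primes above a rational prime -/
  above : ℕ → Finset P
  card_above : ∀ q, (above q).card ≤ 2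
  mem_above : ∀ p, p ∈ above (under p)

namespace PrimeSystem
variable {P : Type*} (S : PrimeSystem P)

lemma under_le_norm (p : P) : S.under p ≤ S.norm p := by
  rcases S.norm_eq p with h | h <;> rw [h]
  exact Nat.le_self_pow two_ne_zero _

lemma two_le_norm (p : P) : 2 ≤ S.norm p := (S.under_prime p).two_le.trans (S.under_le_norm p)

lemma finite_norm_le (n : ℕ) : {p | S.norm p ≤ n}.Finite := by
  refine ((Finset.range (n + 1)).finite_toSet.biUnion fun q _ => (S.above q).finite_toSet).subset ?_
  intro p hp
  simp only [Set.mem_iUnion]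
  refine ⟨S.under p, ?_, S.mem_above p⟩
  have := (S.under_le_norm p).trans hp
  simpa using Nat.lt_succ_of_le this

/-- The norm of a generalised integer. -/
def normMul (s : Multiset P) : ℕ := (s.map S.norm).prod

lemma normMul_add (s t : Multiset P) : S.normMul (s + t) = S.normMul s * S.normMul t := by
  simp [normMul]

lemma normMul_replicate (k : ℕ) (p : P) : S.normMul (Multiset.replicate k p) = S.norm p ^ k := by
  simp [normMul]

lemma normMul_pos (s : Multiset P) : 0 < S.normMul s := by
  refine Nat.pos_of_ne_zero fun h => ?_
  rw [normMul, Multiset.prod_eq_zero_iff, Multiset.mem_map] at h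
  obtain ⟨p, -, hp⟩ := h
  have := S.two_le_norm p
  omega

lemma finite_normMul_eq (n : ℕ) : {s | S.normMul s = n}.Finite := by
  induction n using Nat.strong_induction_on with
  | _ n ih =>
    have h1 : (⋃ m ∈ Finset.range n, {s | S.normMul s = m}).Finite :=
      (Finset.range n).finite_toSet.biUnion fun m hm => ih m (by simpa using hm)
    refine (((S.finite_norm_le n).image2 (fun p t => p ::ₘ t) h1).insert 0).subset ?_
    intro s hs
    rcases s.empty_or_exists_mem with rfl | ⟨p, hp⟩
    · exact Set.mem_insert _ _
    · right
      obtain ⟨t, rfl⟩ := Multiset.exists_cons_of_mem hp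
      have h2 : S.norm p * S.normMul t = n := by
        rw [← hs]; simp [normMul]
      have h3 := S.normMul_pos t
      have h4 := S.two_le_norm p
      refine ⟨p, ?_, t, ?_, rfl⟩
      · change S.norm p ≤ n
        rw [← h2]; exact Nat.le_mul_of_pos_right _ h3
      · simp only [Set.mem_iUnion, Finset.mem_range]
        exact ⟨S.normMul t, by nlinarith, rfl⟩

/-- The generalised integers of norm `n`. -/
noncomputable def integers (n : ℕ) : Finset (Multiset P) := (S.finite_normMul_eq n).toFinset

@[simp] lemma mem_integers {n : ℕ} {s : Multiset P} : s ∈ S.integers n ↔ S.normMul s = n := by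
  simp [integers]

lemma finite_primePowers (n : ℕ) : {x : P × ℕ | 1 ≤ x.2 ∧ S.norm x.1 ^ x.2 = n}.Finite := by
  refine ((S.finite_norm_le n).prod (Finset.range (n + 1)).finite_toSet).subset ?_
  rintro ⟨p, k⟩ ⟨h1, h2⟩
  simp only at h1 h2
  have h3 := S.two_le_norm p
  constructor
  · change S.norm p ≤ n
    rw [← h2]; exact Nat.le_self_pow (by omega) _
  · simp only [Finset.coe_range, Set.mem_Iio]
    rw [← h2]
    exact Nat.lt_succ_of_lt (Nat.lt_pow_self (by omega))

/-- The prime powers of norm `n`, encoded as pairs of a prime and an exponent. -/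
noncomputable def primePowers (n : ℕ) : Finset (P × ℕ) := (S.finite_primePowers n).toFinset

@[simp] lemma mem_primePowers {n : ℕ} {x : P × ℕ} :
    x ∈ S.primePowers n ↔ 1 ≤ x.2 ∧ S.norm x.1 ^ x.2 = n := by
  simp [primePowers]

variable {A : Type*} [AddCommGroup A] [DecidableEq A] (φ : P → A)

/-- The number of generalised integers of norm `n` in the class `a`. -/
noncomputable def count (a : A) (n : ℕ) : ℝ :=
  ∑ s ∈ S.integers n, if (s.map φ).sum = a then 1 else 0

/-- The von Mangoldt function of a class `a`. -/
noncomputable def mangoldt (a : A) (n : ℕ) : ℝ :=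
  ∑ x ∈ S.primePowers n, if x.2 • φ x.1 = a then Real.log (S.norm x.1) else 0

lemma count_nonneg (a : A) (n : ℕ) : 0 ≤ S.count φ a n :=
  Finset.sum_nonneg fun _ _ => by split_ifs <;> norm_num

lemma mangoldt_nonneg (a : A) (n : ℕ) : 0 ≤ S.mangoldt φ a n :=
  Finset.sum_nonneg fun _ _ => by split_ifs; exacts [Real.log_natCast_nonneg _, le_rfl]

lemma integers_one : S.integers 1 = {0} := by
  ext s
  rw [mem_integers, Finset.mem_singleton]
  constructor
  · intro h
    refine Multiset.eq_zero_of_forall_notMem fun p hp => ?_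
    obtain ⟨t, rfl⟩ := Multiset.exists_cons_of_mem hp
    have h2 : S.norm p * S.normMul t = 1 := by rw [← h]; simp [normMul]
    have := S.two_le_norm p
    have := Nat.eq_one_of_mul_eq_one_right h2
    omega
  · rintro rfl; simp [normMul]

lemma count_zero_one : S.count φ 0 1 = 1 := by
  simp [count, integers_one, -Finset.sum_boole]

lemma count_one_of_ne {a : A} (ha : a ≠ 0) : S.count φ a 1 = 0 := by
  simp [count, integers_one, ha.symm]

lemma log_normMul [DecidableEq P] (s : Multiset P) :
    Real.log (S.normMul s) =
      ∑ x ∈ s.toFinset.sigma fun p => Finset.Icc 1 (s.count p), Real.log (S.norm x.1) := by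
  rw [Finset.sum_sigma]
  simp only [Finset.sum_const, Nat.card_Icc, Nat.add_sub_cancel, nsmul_eq_mul]
  rw [normMul, Finset.prod_multiset_map_count]
  push_cast
  rw [Real.log_prod]
  · simp [Real.log_pow]
  · intro p _
    have := S.two_le_norm p
    positivity

lemma count_mul_log [Fintype A] (a : A) (n : ℕ) :
    S.count φ a n * Real.log n =
      ∑ p ∈ n.divisorsAntidiagonal, ∑ u, S.count φ u p.1 * S.mangoldt φ (a - u) p.2 := by
  classical
  have hL : S.count φ a n * Real.log n =
      ∑ y ∈ ((S.integers n).filter fun s => (s.map φ).sum = a).sigma fun s =>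
        s.toFinset.sigma fun p => Finset.Icc 1 (s.count p), Real.log (S.norm y.2.1) := by
    rw [Finset.sum_sigma, count, Finset.sum_mul, Finset.sum_filter]
    refine Finset.sum_congr rfl fun s hs => ?_
    rw [mem_integers] at hs
    split_ifs
    · rw [one_mul, ← hs, log_normMul]
    · simp
  have hR : ∑ p ∈ n.divisorsAntidiagonal, ∑ u, S.count φ u p.1 * S.mangoldt φ (a - u) p.2 =
      ∑ y ∈ n.divisorsAntidiagonal.sigma fun d =>
        ((S.integers d.1) ×ˢ (S.primePowers d.2)).filter
          fun z => (z.1.map φ).sum + z.2.2 • φ z.2.1 = a, Real.log (S.norm y.2.2.1) := by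
    rw [Finset.sum_sigma]
    refine Finset.sum_congr rfl fun d _ => ?_
    simp only [count, mangoldt, Finset.sum_mul_sum]
    rw [Finset.sum_comm, Finset.sum_filter, Finset.sum_product]
    refine Finset.sum_congr rfl fun s _ => ?_
    rw [Finset.sum_comm]
    refine Finset.sum_congr rfl fun x _ => ?_
    rw [Finset.sum_eq_single (s.map φ).sum]
    · simp [eq_sub_iff_add_eq, add_comm]
    · intro u _ hu; simp [hu.symm]
    · simp
  rw [hL, hR]
  refine Finset.sum_bij'
    (i := fun y _ => ⟨(S.normMul (y.1 - Multiset.replicate y.2.2 y.2.1), S.norm y.2.1 ^ y.2.2),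
      (y.1 - Multiset.replicate y.2.2 y.2.1, (y.2.1, y.2.2))⟩)
    (j := fun y _ => ⟨y.2.1 + Multiset.replicate y.2.2.2 y.2.2.1, ⟨y.2.2.1, y.2.2.2⟩⟩) ?_ ?_ ?_ ?_ ?_
  · rintro ⟨s, p, k⟩ hy
    simp only [Finset.mem_sigma, Finset.mem_filter, mem_integers, Finset.mem_Icc,
      Multiset.mem_toFinset] at hy
    obtain ⟨⟨h1, h2⟩, h3, h4, h5⟩ := hy
    have hle : Multiset.replicate k p ≤ s := Multiset.le_count_iff_replicate_le.mp h5
    have hs : s - Multiset.replicate k p + Multiset.replicate k p = s :=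
      Multiset.sub_add_cancel hle
    simp only [Finset.mem_sigma, Finset.mem_filter, Finset.mem_product, mem_integers,
      mem_primePowers, Nat.mem_divisorsAntidiagonal]
    refine ⟨⟨?_, ?_⟩, ⟨trivial, h4, trivial⟩, ?_⟩
    · rw [← normMul_replicate, ← normMul_add, hs, h1]
    · rw [← h1]; exact (S.normMul_pos s).ne'
    · have := congrArg (fun t => (Multiset.map φ t).sum) hs
      simp only [Multiset.map_add, Multiset.sum_add, Multiset.map_replicate,
        Multiset.sum_replicate] at this
      rw [this, h2]
  · rintro ⟨⟨d, e⟩, s, p, k⟩ hy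
    simp only [Finset.mem_sigma, Finset.mem_filter, Finset.mem_product, mem_integers,
      mem_primePowers, Nat.mem_divisorsAntidiagonal] at hy
    obtain ⟨⟨h1, h2⟩, ⟨h3, h4, h5⟩, h6⟩ := hy
    simp only [Finset.mem_sigma, Finset.mem_filter, mem_integers, Finset.mem_Icc,
      Multiset.mem_toFinset]
    refine ⟨⟨?_, ?_⟩, ?_, h4, ?_⟩
    · rw [normMul_add, normMul_replicate, h3, h5, h1]
    · simpa using h6
    · simp [Multiset.mem_replicate]; right; omega
    · simp
  · rintro ⟨s, p, k⟩ hy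
    simp only [Finset.mem_sigma, Finset.mem_filter, mem_integers, Finset.mem_Icc,
      Multiset.mem_toFinset] at hy
    have hle : Multiset.replicate k p ≤ s := Multiset.le_count_iff_replicate_le.mp hy.2.2.2
    simp [Multiset.sub_add_cancel hle]
  · rintro ⟨⟨d, e⟩, s, p, k⟩ hy
    simp only [Finset.mem_sigma, Finset.mem_filter, Finset.mem_product, mem_integers,
      mem_primePowers, Nat.mem_divisorsAntidiagonal] at hy
    obtain ⟨⟨h1, h2⟩, ⟨h3, h4, h5⟩, h6⟩ := hy
    simp [h3, h5]
  · rintro ⟨s, p, k⟩ _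
    rfl

end PrimeSystem

lemma sum_vonMangoldt_le (N : ℕ) :
    ∑ n ∈ Finset.Icc 1 N, ArithmeticFunction.vonMangoldt n ≤ (Real.log 4 + 4) * N := by
  have h := Chebyshev.psi_le_const_mul_self (Nat.cast_nonneg N)
  rw [Chebyshev.psi, Nat.floor_natCast] at h
  exact h

lemma tendsto_sqrt_mul_log_div : Tendsto (fun N : ℕ => Real.sqrt N * Real.log N / N) atTop
    (𝓝 0) := by
  have h := (isLittleO_log_rpow_atTop (r := 1 / 2) (by norm_num)).tendsto_div_nhds_zero
  refine (h.comp tendsto_natCast_atTop_atTop).congr' ?_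
  filter_upwards [eventually_gt_atTop 0] with N hN
  have hN' : (0 : ℝ) < N := by exact_mod_cast hN
  simp only [Function.comp]
  rw [← Real.sqrt_eq_rpow]
  have h2 : Real.sqrt N ≠ 0 := by positivity
  have h3 : (N : ℝ) = Real.sqrt N * Real.sqrt N := (Real.mul_self_sqrt hN'.le).symm
  rw [div_eq_div_iff h2 hN'.ne']
  linear_combination Real.log N * h3

lemma tendsto_sum_not_prime_vonMangoldt : Tendsto (fun N : ℕ =>
    (∑ n ∈ Finset.Icc 1 N with ¬ n.Prime, ArithmeticFunction.vonMangoldt n) / N) atTop (𝓝 0) := by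
  refine squeeze_zero' (Eventually.of_forall fun N => ?_) ?_
    (by simpa using tendsto_sqrt_mul_log_div.const_mul 2)
  · exact div_nonneg (Finset.sum_nonneg fun _ _ => ArithmeticFunction.vonMangoldt_nonneg)
      (Nat.cast_nonneg N)
  · filter_upwards [eventually_ge_atTop 1] with N hN
    have h1 := Chebyshev.abs_psi_sub_theta_le_sqrt_mul_log (x := N) (by exact_mod_cast hN)
    have h2 := Chebyshev.psi_sub_theta_eq_sum_not_prime N
    rw [Nat.floor_natCast] at h2
    have h3 := (le_abs_self _).trans h1
    rw [h2] at h3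
    rw [← mul_div_assoc, ← mul_assoc]
    gcongr
    exact h3

namespace PrimeSystem
variable {P : Type*} (S : PrimeSystem P)

lemma under_eq_of_norm_pow {p : P} {k n : ℕ} (hk : 1 ≤ k) (h : S.norm p ^ k = n) :
    S.under p = n.minFac := by
  have hp := S.under_prime p
  rcases S.norm_eq p with h2 | h2 <;> rw [← h, h2]
  · rw [Nat.pow_minFac (by omega), hp.minFac_eq]
  · rw [← pow_mul, Nat.pow_minFac (by omega), hp.minFac_eq]

lemma isPrimePow_of_norm_pow {p : P} {k n : ℕ} (hk : 1 ≤ k) (h : S.norm p ^ k = n) :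
    IsPrimePow n := by
  have hp := (S.under_prime p).prime.isPrimePow
  rcases S.norm_eq p with h2 | h2 <;> rw [← h, h2]
  · exact hp.pow (by omega)
  · exact (hp.pow two_ne_zero).pow (by omega)

lemma sum_log_primePowers_le (n : ℕ) :
    ∑ x ∈ S.primePowers n, Real.log (S.norm x.1) ≤ 4 * ArithmeticFunction.vonMangoldt n := by
  classical
  rcases (S.primePowers n).eq_empty_or_nonempty with h | ⟨⟨p₀, k₀⟩, h⟩
  · rw [h]; simp [ArithmeticFunction.vonMangoldt_nonneg]
  rw [mem_primePowers] at h
  rw [ArithmeticFunction.vonMangoldt_apply, if_pos (S.isPrimePow_of_norm_pow h.1 h.2)]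
  have hcard : (S.primePowers n).card ≤ 2 := by
    refine le_trans ?_ (S.card_above n.minFac)
    refine Finset.card_le_card_of_injOn Prod.fst ?_ ?_
    · rintro ⟨p, k⟩ hx
      have hx' := S.mem_primePowers.mp (Finset.mem_coe.mp hx)
      rw [← S.under_eq_of_norm_pow hx'.1 hx'.2]
      exact S.mem_above p
    · rintro ⟨p, k⟩ hx ⟨p', k'⟩ hx' (rfl : p = p')
      have h1 := (S.mem_primePowers.mp (Finset.mem_coe.mp hx)).2
      have h2 := (S.mem_primePowers.mp (Finset.mem_coe.mp hx')).2
      have h3 := Nat.pow_right_injective (S.two_le_norm p) (h1.trans h2.symm)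
      simp only at h3
      rw [h3]
  have hterm : ∀ x ∈ S.primePowers n, Real.log (S.norm x.1) ≤ 2 * Real.log n.minFac := by
    intro x hx
    rw [mem_primePowers] at hx
    rw [← S.under_eq_of_norm_pow hx.1 hx.2]
    have hl : 0 ≤ Real.log (S.under x.1) := Real.log_natCast_nonneg _
    rcases S.norm_eq x.1 with h2 | h2 <;> rw [h2]
    · linarith
    · push_cast; rw [Real.log_pow]; push_cast; exact le_rfl
  have h2 := Finset.sum_le_card_nsmul _ _ _ hterm
  refine h2.trans ?_
  rw [nsmul_eq_mul]
  have h3 : ((S.primePowers n).card : ℝ) ≤ 2 := by exact_mod_cast hcard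
  have h4 : 0 ≤ Real.log n.minFac := Real.log_natCast_nonneg _
  nlinarith

variable {A : Type*} [AddCommGroup A] [DecidableEq A] (φ : P → A)

lemma sum_mangoldt [Fintype A] (n : ℕ) :
    ∑ a, S.mangoldt φ a n = ∑ x ∈ S.primePowers n, Real.log (S.norm x.1) := by
  simp only [mangoldt]
  rw [Finset.sum_comm]
  simp

lemma mangoldt_le (a : A) (n : ℕ) :
    S.mangoldt φ a n ≤ 4 * ArithmeticFunction.vonMangoldt n := by
  refine le_trans ?_ (S.sum_log_primePowers_le n)
  refine Finset.sum_le_sum fun x _ => ?_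
  split_ifs
  exacts [le_rfl, Real.log_natCast_nonneg _]

lemma mangoldt_prime (a : A) {q : ℕ} (hq : q.Prime) :
    S.mangoldt φ a q = {p | S.norm p = q ∧ φ p = a}.ncard * Real.log q := by
  have h1 : S.mangoldt φ a q =
      ∑ x ∈ (S.primePowers q).filter (fun x => x.2 • φ x.1 = a), Real.log q := by
    rw [mangoldt, Finset.sum_filter]
    refine Finset.sum_congr rfl fun x hx => ?_
    rw [mem_primePowers] at hx
    have hk : x.2 = 1 := (Nat.Prime.eq_one_of_pow (n := x.2) (x := S.norm x.1) (by rwa [hx.2]))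
    rw [hk, pow_one] at hx
    rw [hx.2]
  rw [h1, Finset.sum_const, nsmul_eq_mul]
  congr 2
  rw [← Set.ncard_coe_finset]
  refine Set.ncard_congr (fun x _ => x.1) ?_ ?_ ?_
  · rintro ⟨p, k⟩ hx
    simp only [Finset.coe_filter, mem_primePowers, Set.mem_ofPred_eq] at hx
    have hk : k = 1 := Nat.Prime.eq_one_of_pow (n := k) (x := S.norm p) (by rw [hx.1.2]; exact hq)
    subst hk
    simpa using hx
  · rintro ⟨p, k⟩ ⟨p', k'⟩ hx hx' (rfl : p = p')
    simp only [Finset.coe_filter, mem_primePowers, Set.mem_ofPred_eq] at hx hx'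
    have hk : k = 1 := Nat.Prime.eq_one_of_pow (n := k) (x := S.norm p) (by rw [hx.1.2]; exact hq)
    have hk' : k' = 1 :=
      Nat.Prime.eq_one_of_pow (n := k') (x := S.norm p) (by rw [hx'.1.2]; exact hq)
    rw [hk, hk']
  · intro p hp
    refine ⟨(p, 1), ?_, rfl⟩
    simpa using hp

/-- If the generalised integers are equidistributed among the classes of a finite abelian group
of odd order, so are the primes of prime norm. -/
theorem tendsto_primes [Fintype A] (hodd : Odd (Fintype.card A)) {c K : ℝ} (hc : 0 < c)
    (hA : ∀ a (N : ℕ), |∑ n ∈ Finset.Icc 1 N, S.count φ a n - c * N| ≤ K * Real.sqrt N) :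
    Tendsto (fun N : ℕ => (∑ q ∈ Finset.Icc 1 N with q.Prime,
      {p | S.norm p = q ∧ φ p = 0}.ncard * Real.log q) / N) atTop (𝓝 (1 / Fintype.card A)) := by
  have h1 := equidistribution_of_odd hodd (S.count_nonneg φ) (S.mangoldt_nonneg φ)
    (S.count_mul_log φ) (S.count_zero_one φ) (fun a ha => S.count_one_of_ne φ ha) hc hA
    (C' := 4 * (Real.log 4 + 4)) (by
      intro N
      simp_rw [sum_mangoldt]
      refine (Finset.sum_le_sum fun n _ => S.sum_log_primePowers_le n).trans ?_
      rw [← Finset.mul_sum, mul_assoc]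
      exact mul_le_mul_of_nonneg_left (sum_vonMangoldt_le N) (by norm_num))
  have h2 : Tendsto (fun N : ℕ => (∑ n ∈ Finset.Icc 1 N with ¬ n.Prime, S.mangoldt φ 0 n) / N)
      atTop (𝓝 0) := by
    refine squeeze_zero (fun N => ?_) (fun N => ?_)
      (by simpa using tendsto_sum_not_prime_vonMangoldt.const_mul 4)
    · exact div_nonneg (Finset.sum_nonneg fun _ _ => S.mangoldt_nonneg φ _ _) (Nat.cast_nonneg N)
    · rw [← mul_div_assoc, Finset.mul_sum]
      gcongr with n _
      exact S.mangoldt_le φ 0 n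
  have h3 := h1.sub h2
  rw [sub_zero] at h3
  refine h3.congr fun N => ?_
  rw [← sub_div, ← Finset.sum_filter_add_sum_filter_not _ Nat.Prime, add_sub_cancel_right]
  congr 1
  refine Finset.sum_congr rfl fun q hq => ?_
  rw [S.mangoldt_prime φ 0 (Finset.mem_filter.mp hq).2]

end PrimeSystem

lemma tendsto_sum_vonMangoldt_div : Tendsto (fun N : ℕ =>
    (∑ n ∈ Finset.Icc 1 N, ArithmeticFunction.vonMangoldt n) / N) atTop (𝓝 1) := by
  have h := equidistribution_of_odd (A := Unit) (by simp)
    (r := fun _ _ => 1) (Λ := fun _ n => ArithmeticFunction.vonMangoldt n)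
    (fun _ _ => zero_le_one) (fun _ _ => ArithmeticFunction.vonMangoldt_nonneg)
    (fun _ n => by
      rw [one_mul, ← ArithmeticFunction.vonMangoldt_sum,
        ← Nat.sum_divisorsAntidiagonal' (fun _ e => ArithmeticFunction.vonMangoldt e)]
      simp)
    rfl (fun a ha => absurd (Subsingleton.elim a 0) ha) (c := 1) (K := 0) one_pos (by simp)
    (C' := Real.log 4 + 4) (fun N => by simpa using sum_vonMangoldt_le N)
  simpa using h

lemma tendsto_sum_log_prime_div : Tendsto (fun N : ℕ =>
    (∑ q ∈ Finset.Icc 1 N with q.Prime, Real.log q) / N) atTop (𝓝 1) := by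
  have h := tendsto_sum_vonMangoldt_div.sub tendsto_sum_not_prime_vonMangoldt
  rw [sub_zero] at h
  refine h.congr fun N => ?_
  rw [← sub_div, ← Finset.sum_filter_add_sum_filter_not _ Nat.Prime, add_sub_cancel_right]
  congr 1
  refine Finset.sum_congr rfl fun q hq => ?_
  rw [ArithmeticFunction.vonMangoldt_apply_prime (Finset.mem_filter.mp hq).2]

lemma tendsto_primeCounting_mul_log_sub : Tendsto (fun N : ℕ =>
    ((Finset.card {q ∈ Finset.Icc 1 N | q.Prime} : ℝ) * Real.log N -
      ∑ q ∈ Finset.Icc 1 N with q.Prime, Real.log q) / N) atTop (𝓝 0) := by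
  have h1 := Chebyshev.primeCounting_sub_theta_div_log_isBigO.comp_tendsto
    (tendsto_natCast_atTop_atTop (R := ℝ))
  obtain ⟨C, hC⟩ := h1.bound
  have h2 : Tendsto (fun N : ℕ => C / Real.log N) atTop (𝓝 0) :=
    (Real.tendsto_log_atTop.comp tendsto_natCast_atTop_atTop).const_div_atTop C
  refine squeeze_zero_norm' ?_ h2
  filter_upwards [hC, eventually_ge_atTop 2] with N hN hN2
  have hNpos : (0 : ℝ) < N := by positivity
  have hlog : 0 < Real.log N := Real.log_pos (by exact_mod_cast hN2)
  have e1 : ((Nat.primeCounting N : ℕ) : ℝ) = Finset.card {q ∈ Finset.Icc 1 N | q.Prime} := by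
    congr 1
    rw [← Nat.primesLE_card_eq_primeCounting, Nat.primesLE_eq_filter_Icc_zero]
    refine congrArg Finset.card ?_
    ext q
    simp only [Finset.mem_filter, Finset.mem_Icc]
    constructor
    · rintro ⟨⟨_, h⟩, hq⟩; exact ⟨⟨hq.one_lt.le, h⟩, hq⟩
    · rintro ⟨⟨_, h⟩, hq⟩; exact ⟨⟨Nat.zero_le _, h⟩, hq⟩
  have e2 : Chebyshev.theta N = ∑ q ∈ Finset.Icc 1 N with q.Prime, Real.log q := by
    rw [Chebyshev.theta, Nat.floor_natCast]; rfl
  simp only [Function.comp, Nat.floor_natCast] at hN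
  rw [e1, e2] at hN
  set π := (Finset.card {q ∈ Finset.Icc 1 N | q.Prime} : ℝ)
  set θ := ∑ q ∈ Finset.Icc 1 N with q.Prime, Real.log q
  have e3 : (π * Real.log N - θ) / N = (π - θ / Real.log N) * (Real.log N / N) := by
    field_simp
  rw [e3, norm_mul]
  have e4 : ‖(N : ℝ) / Real.log N ^ 2‖ = N / Real.log N ^ 2 :=
    Real.norm_of_nonneg (by positivity)
  have e5 : ‖Real.log N / (N : ℝ)‖ = Real.log N / N := Real.norm_of_nonneg (by positivity)
  rw [e4] at hN
  rw [e5]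
  calc _ ≤ (C * (N / Real.log N ^ 2)) * (Real.log N / N) := by gcongr
    _ = C / Real.log N := by field_simp

/-- The weighted and unweighted counts of a set of primes have the same relative density. -/
lemma tendsto_card_mul_log_div (p : ℕ → Prop) [DecidablePred p] {δ : ℝ}
    (h : Tendsto (fun N : ℕ => (∑ q ∈ Finset.Icc 1 N with q.Prime ∧ p q, Real.log q) / N) atTop
      (𝓝 δ)) :
    Tendsto (fun N : ℕ => (Finset.card {q ∈ Finset.Icc 1 N | q.Prime ∧ p q} : ℝ) *
      Real.log N / N) atTop (𝓝 δ) := by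
  have h0 : Tendsto (fun N : ℕ => ((Finset.card {q ∈ Finset.Icc 1 N | q.Prime ∧ p q} : ℝ) *
      Real.log N - ∑ q ∈ Finset.Icc 1 N with q.Prime ∧ p q, Real.log q) / N) atTop (𝓝 0) := by
    have hkey : ∀ (N : ℕ) (r : ℕ → Prop) [DecidablePred r],
        (Finset.card {q ∈ Finset.Icc 1 N | r q} : ℝ) * Real.log N -
          ∑ q ∈ Finset.Icc 1 N with r q, Real.log q =
          ∑ q ∈ Finset.Icc 1 N with r q, (Real.log N - Real.log q) := by
      intro N r _
      rw [Finset.sum_sub_distrib, Finset.sum_const, nsmul_eq_mul]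
    have hnn : ∀ (N : ℕ), ∀ q ∈ Finset.Icc 1 N, 0 ≤ Real.log N - Real.log q := by
      intro N q hq
      rw [Finset.mem_Icc] at hq
      rw [sub_nonneg]
      exact Real.log_le_log (by exact_mod_cast hq.1) (by exact_mod_cast hq.2)
    refine squeeze_zero (fun N => ?_) (fun N => ?_) tendsto_primeCounting_mul_log_sub
    · rw [hkey]
      exact div_nonneg (Finset.sum_nonneg fun q hq => hnn N q (Finset.mem_filter.mp hq).1)
        (Nat.cast_nonneg N)
    · rw [hkey, hkey]
      refine div_le_div_of_nonneg_right ?_ (Nat.cast_nonneg N)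
      refine Finset.sum_le_sum_of_subset_of_nonneg ?_ ?_
      · intro q hq
        rw [Finset.mem_filter] at hq ⊢
        exact ⟨hq.1, hq.2.1⟩
      · intro q hq _
        exact hnn N q (Finset.mem_filter.mp hq).1
  have h2 := h.add h0
  rw [add_zero] at h2
  refine h2.congr fun N => ?_
  rw [← add_div, add_sub_cancel]

lemma tendsto_card_div_card (p : ℕ → Prop) [DecidablePred p] {δ : ℝ}
    (h : Tendsto (fun N : ℕ => (∑ q ∈ Finset.Icc 1 N with q.Prime ∧ p q, Real.log q) / N) atTop
      (𝓝 δ)) :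
    Tendsto (fun N : ℕ => (Finset.card {q ∈ Finset.Icc 1 N | q.Prime ∧ p q} : ℝ) /
      Finset.card {q ∈ Finset.Icc 1 N | q.Prime}) atTop (𝓝 δ) := by
  have h1 := tendsto_card_mul_log_div p h
  have h2 := tendsto_card_mul_log_div (fun _ => True) (δ := 1)
    (by simpa using tendsto_sum_log_prime_div)
  have h3 := h1.div h2 one_ne_zero
  rw [div_one] at h3
  refine h3.congr' ?_
  filter_upwards [eventually_ge_atTop 2] with N hN
  have hNpos : (0 : ℝ) < N := by positivity
  have hlog : 0 < Real.log N := Real.log_pos (by exact_mod_cast hN)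
  simp only [and_true, Pi.div_apply]
  rw [div_div_div_cancel_right₀ hNpos.ne', mul_div_mul_right _ _ hlog.ne']

end SophieGermain

namespace SophieGermain
open Zsqrtd

/-- The imaginary quadratic order `ℤ[√-q]`. -/
abbrev Order (q : ℕ) := ℤ√(-(q : ℤ))

section
variable {q : ℕ}

lemma order_norm (z : Order q) : z.norm = z.re ^ 2 + q * z.im ^ 2 := by
  rw [Zsqrtd.norm_def]; ring

variable [Fact q.Prime]

lemma neg_prime_lt_zero : -(q : ℤ) < 0 := by
  have := (Fact.out : q.Prime).pos
  omega

lemma order_norm_eq_zero {z : Order q} : z.norm = 0 ↔ z = 0 :=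
  Zsqrtd.norm_eq_zero_iff neg_prime_lt_zero z

lemma order_norm_nonneg (z : Order q) : 0 ≤ z.norm := Zsqrtd.norm_nonneg neg_prime_lt_zero.le z

instance : NoZeroDivisors (Order q) where
  eq_zero_or_eq_zero_of_mul_eq_zero {a b} h := by
    rw [← order_norm_eq_zero, Zsqrtd.norm_mul, mul_eq_zero] at h
    simpa only [order_norm_eq_zero] using h

instance : IsDomain (Order q) := NoZeroDivisors.to_isDomain _

lemma order_isUnit {u : Order q} (hu : IsUnit u) : u = 1 ∨ u = -1 := by
  have h2 := (Fact.out : q.Prime).two_le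
  rw [← Zsqrtd.norm_eq_one_iff' neg_prime_lt_zero.le, order_norm] at hu
  have him : u.im = 0 := by
    by_contra h
    have : 0 < u.im ^ 2 := by positivity
    have h3 : (2 : ℤ) ≤ q := by exact_mod_cast h2
    nlinarith [sq_nonneg u.re]
  rw [him] at hu
  have hre : u.re = 1 ∨ u.re = -1 := sq_eq_one_iff.mp (by simpa using hu)
  rcases hre with h | h
  · left; ext <;> simp [h, him]
  · right; ext <;> simp [h, him]

lemma order_span_eq {a b : Order q} : Ideal.span {a} = Ideal.span {b} ↔ a = b ∨ a = -b := by
  rw [Ideal.span_singleton_eq_span_singleton]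
  constructor
  · rintro ⟨u, hu⟩
    rcases order_isUnit u.isUnit with h | h <;> rw [h] at hu <;> [left; right] <;> simp [← hu]
  · rintro (rfl | rfl)
    · rfl
    · exact (Associated.refl b).neg_left

lemma order_span_natCast {m n : ℕ} (h : Ideal.span {(m : Order q)} = Ideal.span {(n : Order q)}) :
    m = n := by
  rcases order_span_eq.mp h with h | h
  · exact_mod_cast h
  · have := congrArg Zsqrtd.re h
    simp at this
    omega

end

section
variable {q : ℕ}

/-- The conjugate ideal. -/
def conj (I : Ideal (Order q)) : Ideal (Order q) := I.map (starRingAut (R := Order q))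

lemma mem_conj {I : Ideal (Order q)} {z : Order q} : z ∈ conj I ↔ star z ∈ I := by
  rw [conj, Ideal.mem_map_of_equiv]
  constructor
  · rintro ⟨x, hx, rfl⟩
    simpa using hx
  · intro h
    exact ⟨star z, h, by simp⟩

lemma conj_mul (I J : Ideal (Order q)) : conj (I * J) = conj I * conj J := Ideal.map_mul _ _ _

lemma conj_span (z : Order q) : conj (Ideal.span {z}) = Ideal.span {star z} := by
  rw [conj, Ideal.map_span, Set.image_singleton]; simp

/-- Ideals of `ℤ[√-q]` coprime to `2q`. -/
def Cop (I : Ideal (Order q)) : Prop := ∃ k : ℤ, IsCoprime k (2 * q) ∧ (k : Order q) ∈ I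

lemma Cop.mono {I J : Ideal (Order q)} (hI : Cop I) (h : I ≤ J) : Cop J := by
  obtain ⟨k, h1, h2⟩ := hI
  exact ⟨k, h1, h h2⟩

lemma Cop.mul {I J : Ideal (Order q)} (hI : Cop I) (hJ : Cop J) : Cop (I * J) := by
  obtain ⟨k, h1, h2⟩ := hI
  obtain ⟨l, h3, h4⟩ := hJ
  exact ⟨k * l, h1.mul_left h3, by push_cast; exact Ideal.mul_mem_mul h2 h4⟩

lemma Cop.conj {I : Ideal (Order q)} (hI : Cop I) : Cop (conj I) := by
  obtain ⟨k, h1, h2⟩ := hI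
  exact ⟨k, h1, by rw [mem_conj]; simpa using h2⟩

lemma cop_top : Cop (⊤ : Ideal (Order q)) := ⟨1, isCoprime_one_left, trivial⟩

lemma cop_span {z : Order q} (h : IsCoprime z.norm (2 * q)) : Cop (Ideal.span {z}) :=
  ⟨z.norm, h, by
    rw [Ideal.mem_span_singleton, Zsqrtd.norm_eq_mul_conj]; exact dvd_mul_right _ _⟩

/-- Every ideal of `ℤ[√-q]` with a nonzero element is `m (a, b + √-q)` as a lattice. -/
lemma exists_basis {I : Ideal (Order q)} {k : ℤ} (hk0 : k ≠ 0) (hk : (k : Order q) ∈ I) :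
    ∃ (m a : ℕ) (b : ℤ), 0 < m ∧ 0 < a ∧ ((m * a : ℕ) : ℤ) ∣ k ∧ (a : ℤ) ∣ b ^ 2 + q ∧
      ∀ z : Order q, z ∈ I ↔ (m : ℤ) ∣ z.im ∧ ((m * a : ℕ) : ℤ) ∣ z.re - b * z.im := by
  let J : Ideal ℤ := I.comap (Int.castRingHom _)
  let L : Ideal ℤ := Submodule.map (AddMonoidHom.toIntLinearMap
    ⟨⟨Zsqrtd.im, by simp⟩, by simp⟩ : Order q →ₗ[ℤ] ℤ) (I.restrictScalars ℤ)
  have hJ : ∀ x : ℤ, x ∈ J ↔ (x : Order q) ∈ I := fun x => by simp [J]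
  have hL : ∀ y : ℤ, y ∈ L ↔ ∃ z ∈ I, z.im = y := fun y => Iff.rfl
  obtain ⟨A, hA0, hA⟩ : ∃ A : ℕ, 0 < A ∧ ∀ x : ℤ, (x : Order q) ∈ I ↔ (A : ℤ) ∣ x := by
    obtain ⟨A, hA⟩ := (IsPrincipalIdealRing.principal J).principal
    refine ⟨A.natAbs, ?_, fun x => ?_⟩
    · rw [Int.natAbs_pos]
      rintro rfl
      have := (hJ k).mpr hk
      rw [hA] at this
      simp [hk0] at this
    · rw [← hJ, hA, Int.natAbs_dvd]; exact Ideal.mem_span_singleton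
  obtain ⟨m, hm⟩ : ∃ m : ℕ, ∀ y : ℤ, (∃ z ∈ I, z.im = y) ↔ (m : ℤ) ∣ y := by
    obtain ⟨A, hA⟩ := (IsPrincipalIdealRing.principal L).principal
    refine ⟨A.natAbs, fun x => ?_⟩
    rw [← hL, hA, Int.natAbs_dvd]; exact Ideal.mem_span_singleton
  have hs : ∀ z ∈ I, (⟨-(q : ℤ) * z.im, z.re⟩ : Order q) ∈ I := fun z hz => by
    have := I.mul_mem_left sqrtd hz
    convert this using 1
    ext <;> simp
  obtain ⟨w, hwI, hw⟩ := (hm m).mpr dvd_rfl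
  obtain ⟨a, ha⟩ : (m : ℤ) ∣ A := (hm A).mp ⟨_, hs _ ((hA A).mpr dvd_rfl), by simp⟩
  obtain ⟨b, hb⟩ : (m : ℤ) ∣ w.re := (hm w.re).mp ⟨_, hs _ hwI, rfl⟩
  have ha' : 0 < (m : ℤ) * a := by rw [← ha]; exact_mod_cast hA0
  have hm0 : 0 < m := Nat.pos_of_ne_zero (by rintro rfl; simp at ha')
  have ha0 : 0 < a := pos_of_mul_pos_right ha' (by positivity)
  lift a to ℕ using ha0.le
  have key : ∀ z : Order q, z ∈ I ↔ (m : ℤ) ∣ z.im ∧ ((m * a : ℕ) : ℤ) ∣ z.re - b * z.im := by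
    intro z
    have h3 : ∀ v : ℤ, z.im = m * v → (z ∈ I ↔ ((m * a : ℕ) : ℤ) ∣ z.re - b * z.im) := by
      intro v hv
      rw [Nat.cast_mul, ← ha, ← hA]
      have h4 : ((z.re - b * z.im : ℤ) : Order q) = z - (v : ℤ) * w := by
        ext
        · simp [hb, hv]; ring
        · simp [hw, hv]; ring
      rw [h4, iff_comm]
      exact ⟨fun h => by simpa using I.add_mem h (I.mul_mem_left (v : Order q) hwI),
        fun h => I.sub_mem h (I.mul_mem_left _ hwI)⟩
    constructor
    · intro hz
      obtain ⟨v, hv⟩ := (hm _).mp ⟨z, hz, rfl⟩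
      exact ⟨⟨v, hv⟩, (h3 v hv).mp hz⟩
    · rintro ⟨⟨v, hv⟩, h⟩
      exact (h3 v hv).mpr h
  refine ⟨m, a, b, hm0, by exact_mod_cast ha0, ?_, ?_, key⟩
  · rw [Nat.cast_mul, ← ha, ← hA]; exact hk
  · have h5 := ((key _).mp (hs w hwI)).2
    simp only [hw, hb] at h5
    rw [Nat.cast_mul, show -(q : ℤ) * m - b * (m * b) = m * (-(b ^ 2 + q)) by ring] at h5
    exact (dvd_neg.mp ((mul_dvd_mul_iff_left (by positivity)).mp h5))

end

section
variable {q : ℕ} [Fact q.Prime]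

omit [Fact q.Prime] in
lemma mul_conj_of_basis {I : Ideal (Order q)} {m a : ℕ} {b : ℤ}
    (hc : IsCoprime ((m * a : ℕ) : ℤ) (2 * q)) (hab : (a : ℤ) ∣ b ^ 2 + q)
    (h : ∀ z : Order q, z ∈ I ↔ (m : ℤ) ∣ z.im ∧ ((m * a : ℕ) : ℤ) ∣ z.re - b * z.im) :
    I * conj I = Ideal.span {((m ^ 2 * a : ℕ) : Order q)} := by
  have hac : IsCoprime (a : ℤ) (2 * q) := by
    rw [Nat.cast_mul] at hc; exact hc.of_mul_left_right
  have ha2b : IsCoprime (a : ℤ) (2 * b) := by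
    refine IsCoprime.mul_right hac.of_mul_right_left ?_
    have h1 : IsCoprime (a : ℤ) (b ^ 2) := by
      obtain ⟨c, hc⟩ := hab
      have h2 : b ^ 2 = -q + a * c := by linarith
      rw [h2]
      exact (hac.of_mul_right_right.neg_right).add_mul_left_right c
    exact (IsCoprime.pow_right_iff two_pos).mp h1
  apply _root_.le_antisymm
  · rw [Ideal.mul_le]
    intro z hz w hw
    rw [mem_conj, h] at hw
    rw [h] at hz
    obtain ⟨⟨v, hv⟩, ⟨u, hu⟩⟩ := hz
    obtain ⟨⟨v', hv'⟩, ⟨u', hu'⟩⟩ := hw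
    obtain ⟨c, hc⟩ := hab
    rw [re_star, im_star] at hu'
    rw [im_star] at hv'
    push_cast at hu hu'
    have e1 : z.re = m * a * u + b * (m * v) := by rw [← hv]; linarith
    have e2 : w.re = m * a * u' + b * (m * v') := by rw [← hv']; linarith
    have e3 : w.im = -(m * v') := by linarith
    rw [Ideal.mem_span_singleton, ← Int.cast_natCast (R := Order q), Zsqrtd.intCast_dvd]
    constructor
    · rw [re_mul, hv, e1, e2, e3]
      refine ⟨a * u * u' + b * u * v' + b * v * u' + v * v' * c, ?_⟩
      push_cast
      linear_combination (m : ℤ) ^ 2 * v * v' * hc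
    · rw [im_mul, hv, e1, e2, e3]
      refine ⟨v * u' - u * v', ?_⟩
      push_cast
      ring
  · rw [Ideal.span_singleton_le_iff_mem]
    obtain ⟨u, v, huv⟩ := ha2b
    have m1 : (((m * a : ℕ) : ℤ) : Order q) ∈ I := by rw [h]; simp
    have m2 : (⟨m * b, m⟩ : Order q) ∈ I := by rw [h]; simp [mul_comm]
    have m1' : (((m * a : ℕ) : ℤ) : Order q) ∈ conj I := by rw [mem_conj]; simpa using m1
    have m2' : (⟨m * b, -m⟩ : Order q) ∈ conj I := by rw [mem_conj]; simpa using m2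
    have := add_mem ((I * conj I).mul_mem_left (u : Order q) (Ideal.mul_mem_mul m1 m1'))
      ((I * conj I).mul_mem_left (v : Order q) (add_mem (Ideal.mul_mem_mul m1 m2')
        (Ideal.mul_mem_mul m2 m1')))
    convert this using 1
    ext
    · rw [re_natCast]
      simp
      linear_combination -(m : ℤ) ^ 2 * a * huv
    · rw [im_natCast]
      simp
      right; ring

omit [Fact q.Prime] in
lemma Cop.ne_zero {k : ℤ} (h : IsCoprime k (2 * q)) : k ≠ 0 := by
  rintro rfl
  rw [isCoprime_zero_left, Int.isUnit_iff] at h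
  omega

omit [Fact q.Prime] in
lemma Cop.exists_basis {I : Ideal (Order q)} (hI : Cop I) :
    ∃ (m a : ℕ) (b : ℤ), 0 < m ∧ 0 < a ∧ IsCoprime ((m * a : ℕ) : ℤ) (2 * q) ∧
      I * SophieGermain.conj I = Ideal.span {((m ^ 2 * a : ℕ) : Order q)} ∧
      ∀ z : Order q, z ∈ I ↔ (m : ℤ) ∣ z.im ∧ ((m * a : ℕ) : ℤ) ∣ z.re - b * z.im := by
  obtain ⟨k, hk, hkI⟩ := hI
  obtain ⟨m, a, b, hm, ha, h1, h2, h3⟩ := SophieGermain.exists_basis (Cop.ne_zero hk) hkI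
  have hc := hk.of_isCoprime_of_dvd_left h1
  exact ⟨m, a, b, hm, ha, hc, mul_conj_of_basis hc h2 h3, h3⟩

end

section
variable {q : ℕ}

open Classical in
/-- The natural number `n` with `I * conj I = (n)`, if it exists. -/
noncomputable def idealNorm (I : Ideal (Order q)) : ℕ :=
  if h : ∃ n : ℕ, I * conj I = Ideal.span {(n : Order q)} then h.choose else 0

variable [Fact q.Prime]

lemma idealNorm_eq {I : Ideal (Order q)} {n : ℕ} (h : I * conj I = Ideal.span {(n : Order q)}) :
    idealNorm I = n := by
  have h' : ∃ n : ℕ, I * conj I = Ideal.span {(n : Order q)} := ⟨n, h⟩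
  rw [idealNorm, dif_pos h']
  exact order_span_natCast (h'.choose_spec.symm.trans h)

lemma Cop.exists_basis_idealNorm {I : Ideal (Order q)} (hI : Cop I) :
    ∃ (m a : ℕ) (b : ℤ), 0 < m ∧ 0 < a ∧ IsCoprime ((m * a : ℕ) : ℤ) (2 * q) ∧
      idealNorm I = m ^ 2 * a ∧
      ∀ z : Order q, z ∈ I ↔ (m : ℤ) ∣ z.im ∧ ((m * a : ℕ) : ℤ) ∣ z.re - b * z.im := by
  obtain ⟨m, a, b, hm, ha, h1, h2, h3⟩ := hI.exists_basis
  exact ⟨m, a, b, hm, ha, h1, idealNorm_eq h2, h3⟩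

lemma Cop.mul_conj {I : Ideal (Order q)} (hI : Cop I) :
    I * SophieGermain.conj I = Ideal.span {(idealNorm I : Order q)} := by
  obtain ⟨m, a, b, hm, ha, h1, h2, h3⟩ := hI.exists_basis
  rw [h2, idealNorm_eq h2]

lemma Cop.idealNorm_pos {I : Ideal (Order q)} (hI : Cop I) : 0 < idealNorm I := by
  obtain ⟨m, a, b, hm, ha, h1, h2, h3⟩ := hI.exists_basis_idealNorm
  rw [h2]; positivity

lemma Cop.idealNorm_ne_zero {I : Ideal (Order q)} (hI : Cop I) : (idealNorm I : Order q) ≠ 0 := by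
  exact_mod_cast hI.idealNorm_pos.ne'

lemma Cop.isCoprime_idealNorm {I : Ideal (Order q)} (hI : Cop I) :
    IsCoprime (idealNorm I : ℤ) (2 * q) := by
  obtain ⟨m, a, b, hm, ha, h1, h2, h3⟩ := hI.exists_basis_idealNorm
  rw [h2]
  push_cast at h1 ⊢
  exact h1.of_mul_left_left.pow_left.mul_left h1.of_mul_left_right

lemma Cop.idealNorm_mem {I : Ideal (Order q)} (hI : Cop I) : (idealNorm I : Order q) ∈ I :=
  Ideal.mul_le_left (J := SophieGermain.conj I) (by
    rw [hI.mul_conj]; exact Ideal.mem_span_singleton_self _)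

lemma idealNorm_mul {I J : Ideal (Order q)} (hI : Cop I) (hJ : Cop J) :
    idealNorm (I * J) = idealNorm I * idealNorm J := by
  apply idealNorm_eq
  rw [conj_mul, mul_mul_mul_comm, hI.mul_conj, hJ.mul_conj, Ideal.span_singleton_mul_span_singleton]
  push_cast; rfl

lemma idealNorm_span (z : Order q) : (idealNorm (Ideal.span {z}) : ℤ) = z.norm := by
  have h : idealNorm (Ideal.span {z}) = z.norm.natAbs := by
    apply idealNorm_eq
    rw [conj_span, Ideal.span_singleton_mul_span_singleton, ← Zsqrtd.norm_eq_mul_conj,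
      ← Int.cast_natCast (R := Order q), Int.natAbs_of_nonneg (order_norm_nonneg z)]
  rw [h, Int.natAbs_of_nonneg (order_norm_nonneg z)]

lemma idealNorm_top : idealNorm (⊤ : Ideal (Order q)) = 1 := by
  apply idealNorm_eq
  rw [Nat.cast_one, Ideal.span_singleton_one, eq_top_iff, conj, Ideal.map_top, Ideal.top_mul]

lemma Cop.eq_top {I : Ideal (Order q)} (hI : Cop I) (h : idealNorm I = 1) : I = ⊤ := by
  have h1 := hI.idealNorm_mem
  rw [h, Nat.cast_one] at h1
  exact (Ideal.eq_top_iff_one I).mpr h1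

lemma Cop.mul_left_cancel {I J K : Ideal (Order q)} (hI : Cop I) (h : I * J = I * K) : J = K := by
  have h1 : SophieGermain.conj I * I * J = SophieGermain.conj I * I * K := by
    rw [mul_assoc, h, mul_assoc]
  rw [mul_comm (SophieGermain.conj I), hI.mul_conj] at h1
  exact (Ideal.span_singleton_mul_right_inj hI.idealNorm_ne_zero).mp h1

omit [Fact q.Prime] in
lemma exists_eq_span_mul {I : Ideal (Order q)} {d : Order q} (h : I ≤ Ideal.span {d}) :
    ∃ K, I = Ideal.span {d} * K := by
  refine ⟨Submodule.comap (LinearMap.mulLeft (Order q) d) I, _root_.le_antisymm ?_ ?_⟩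
  · rw [Ideal.le_span_singleton_mul_iff]
    intro z hz
    obtain ⟨w, rfl⟩ := Ideal.mem_span_singleton.mp (h hz)
    exact ⟨w, hz, rfl⟩
  · intro z hz
    obtain ⟨w, hw, rfl⟩ := Ideal.mem_span_singleton_mul.mp hz
    exact hw

/-- For ideals coprime to `2q`, to contain is to divide. -/
lemma Cop.exists_eq_mul {I J : Ideal (Order q)} (hI : Cop I) (h : I ≤ J) :
    ∃ K, Cop K ∧ I = J * K := by
  have hJ := hI.mono h
  obtain ⟨K, hK⟩ := exists_eq_span_mul (I := I * SophieGermain.conj J) (d := idealNorm J)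
    (by rw [← hJ.mul_conj]; exact Ideal.mul_mono_left h)
  have hIJ : I = J * K := by
    apply (Ideal.span_singleton_mul_right_inj hJ.idealNorm_ne_zero).mp
    rw [mul_left_comm, ← hK, ← hJ.mul_conj]
    ring
  exact ⟨K, hI.mono (hIJ.trans_le Ideal.mul_le_right), hIJ⟩

lemma Cop.isMaximal {I : Ideal (Order q)} (hI : Cop I) (hp : (idealNorm I).Prime) :
    I.IsMaximal := by
  have hne : I ≠ ⊤ := by
    rintro rfl
    rw [idealNorm_top] at hp
    exact hp.ne_one rfl
  obtain ⟨M, hM, hIM⟩ := Ideal.exists_le_maximal I hne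
  obtain ⟨K, hK, hIK⟩ := hI.exists_eq_mul hIM
  have hMc := hI.mono hIM
  rw [hIK, idealNorm_mul hMc hK] at hp
  rcases Nat.prime_mul_iff.mp hp with ⟨_, h⟩ | ⟨_, h⟩
  · rw [hK.eq_top h, Ideal.mul_top] at hIK
    rwa [hIK]
  · exact absurd (hMc.eq_top h) hM.ne_top

end

/-- The maximal ideals of `ℤ[√-q]` coprime to `2q`. -/
abbrev CopPrime (q : ℕ) := {I : Ideal (Order q) // I.IsMaximal ∧ Cop I}

section
variable {q : ℕ}

/-- The ideal attached to a multiset of primes. -/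
def toIdeal (s : Multiset (CopPrime q)) : Ideal (Order q) := (s.map Subtype.val).prod

lemma toIdeal_cons (P : CopPrime q) (s : Multiset (CopPrime q)) :
    toIdeal (P ::ₘ s) = P.1 * toIdeal s := by simp [toIdeal]

lemma cop_toIdeal (s : Multiset (CopPrime q)) : Cop (toIdeal s) := by
  induction s using Multiset.induction with
  | empty => simpa [toIdeal] using cop_top
  | cons P s ih => rw [toIdeal_cons]; exact P.2.2.mul ih

variable [Fact q.Prime]

lemma idealNorm_toIdeal (s : Multiset (CopPrime q)) :
    idealNorm (toIdeal s) = (s.map fun P => idealNorm P.1).prod := by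
  induction s using Multiset.induction with
  | empty => simpa [toIdeal] using idealNorm_top
  | cons P s ih => rw [toIdeal_cons, idealNorm_mul P.2.2 (cop_toIdeal s), ih]; simp

omit [Fact q.Prime] in
lemma exists_le_of_toIdeal_le {s : Multiset (CopPrime q)} {P : CopPrime q}
    (h : toIdeal s ≤ P.1) : P ∈ s := by
  obtain ⟨Q, hQ, hQP⟩ := (P.2.1.isPrime.multiset_prod_map_le Subtype.val).mp h
  rwa [← Subtype.ext (Q.2.1.eq_of_le P.2.1.ne_top hQP)]

lemma toIdeal_injective : Function.Injective (toIdeal (q := q)) := by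
  intro s
  induction s using Multiset.induction with
  | empty =>
    intro t h
    rcases t.empty_or_exists_mem with rfl | ⟨P, hP⟩
    · rfl
    · obtain ⟨t, rfl⟩ := Multiset.exists_cons_of_mem hP
      rw [toIdeal_cons] at h
      have h1 : (⊤ : Ideal (Order q)) ≤ P.1 := by
        have : toIdeal (0 : Multiset (CopPrime q)) = ⊤ := by simp [toIdeal]
        rw [← this, h]; exact Ideal.mul_le_left
      exact absurd (top_le_iff.mp h1) P.2.1.ne_top
  | cons P s ih =>
    intro t h
    have h1 : P ∈ t := by
      apply exists_le_of_toIdeal_le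
      rw [← h, toIdeal_cons]; exact Ideal.mul_le_left
    obtain ⟨t, rfl⟩ := Multiset.exists_cons_of_mem h1
    rw [toIdeal_cons, toIdeal_cons] at h
    rw [ih (P.2.2.mul_left_cancel h)]

/-- Ideals coprime to `2q` factor into maximal ideals. -/
lemma Cop.exists_toIdeal {I : Ideal (Order q)} (hI : Cop I) : ∃ s, toIdeal s = I := by
  induction hn : idealNorm I using Nat.strong_induction_on generalizing I with
  | _ n ih =>
    by_cases hne : I = ⊤
    · exact ⟨0, by simp [toIdeal, hne]⟩
    obtain ⟨M, hM, hIM⟩ := Ideal.exists_le_maximal I hne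
    obtain ⟨K, hK, hIK⟩ := hI.exists_eq_mul hIM
    have hMc := hI.mono hIM
    have hM1 : idealNorm M ≠ 1 := fun h => hM.ne_top (hMc.eq_top h)
    have hlt : idealNorm K < n := by
      rw [← hn, hIK, idealNorm_mul hMc hK]
      have := hMc.idealNorm_pos
      exact lt_mul_of_one_lt_left hK.idealNorm_pos (by omega)
    obtain ⟨s, hs⟩ := ih _ hlt hK rfl
    exact ⟨⟨M, hM, hMc⟩ ::ₘ s, by rw [toIdeal_cons, hs, hIK]⟩

lemma CopPrime.exists_under (P : CopPrime q) : ∃ p : ℕ, p.Prime ∧ (p : Order q) ∈ P.1 := by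
  classical
  have hex : ∃ n : ℕ, 0 < n ∧ (n : Order q) ∈ P.1 :=
    ⟨_, P.2.2.idealNorm_pos, P.2.2.idealNorm_mem⟩
  obtain ⟨h1, h2⟩ := Nat.find_spec hex
  set n := Nat.find hex with hn
  have hn1 : n ≠ 1 := by
    intro h
    rw [h, Nat.cast_one] at h2
    exact P.2.1.ne_top ((Ideal.eq_top_iff_one _).mpr h2)
  refine ⟨n, ?_, h2⟩
  by_contra hnp
  obtain ⟨a, b, ha, hb, hab⟩ := (Nat.not_prime_iff_exists_mul_eq (by omega)).mp hnp
  rw [← hab, Nat.cast_mul] at h2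
  rcases P.2.1.isPrime.mem_or_mem h2 with h | h
  · exact Nat.find_min hex ha ⟨Nat.pos_of_ne_zero (by rintro rfl; omega), h⟩
  · exact Nat.find_min hex hb ⟨Nat.pos_of_ne_zero (by rintro rfl; omega), h⟩

omit [Fact q.Prime] in
lemma CopPrime.isCoprime (P : CopPrime q) {p : ℕ} (hp : p.Prime) (h : (p : Order q) ∈ P.1) :
    IsCoprime (p : ℤ) (2 * q) := by
  rw [(Nat.prime_iff_prime_int.mp hp).coprime_iff_not_dvd]
  rintro ⟨c, hc⟩
  obtain ⟨k, ⟨u, v, huv⟩, hk⟩ := P.2.2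
  apply P.2.1.ne_top
  rw [Ideal.eq_top_iff_one]
  have := add_mem (P.1.mul_mem_left (u : Order q) hk) (P.1.mul_mem_left ((v * c : ℤ) : Order q) h)
  convert this using 1
  have h2 : u * k + v * c * p = 1 := by rw [← huv, hc]; ring
  exact_mod_cast h2.symm

lemma CopPrime.norm_eq_of_mem (P : CopPrime q) {p : ℕ} (hp : p.Prime) (h : (p : Order q) ∈ P.1) :
    ∃ K, Cop K ∧ Ideal.span {(p : Order q)} = P.1 * K ∧ idealNorm P.1 * idealNorm K = p ^ 2 := by
  have hc : IsCoprime (p : Order q).norm (2 * q) := by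
    rw [Zsqrtd.norm_natCast]
    exact (P.isCoprime hp h).mul_left (P.isCoprime hp h)
  obtain ⟨K, hK, hPK⟩ := (cop_span hc).exists_eq_mul
    ((Ideal.span_singleton_le_iff_mem _).mpr h)
  refine ⟨K, hK, hPK, ?_⟩
  rw [← idealNorm_mul P.2.2 hK, ← hPK]
  zify
  rw [idealNorm_span, Zsqrtd.norm_natCast, sq]

lemma CopPrime.norm_ne_one (P : CopPrime q) : idealNorm P.1 ≠ 1 :=
  fun h => P.2.1.ne_top (P.2.2.eq_top h)

lemma CopPrime.norm_eq (P : CopPrime q) {p : ℕ} (hp : p.Prime) (h : (p : Order q) ∈ P.1) :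
    idealNorm P.1 = p ∨ idealNorm P.1 = p ^ 2 := by
  obtain ⟨K, hK, -, h2⟩ := P.norm_eq_of_mem hp h
  obtain ⟨k, hk, hk'⟩ := (Nat.dvd_prime_pow hp).mp (Dvd.intro _ h2)
  have := P.norm_ne_one
  interval_cases k
  · simp at hk'; omega
  · simpa using Or.inl hk'
  · exact Or.inr hk'

/-- The conjugate prime. -/
def CopPrime.conj (P : CopPrime q) : CopPrime q :=
  ⟨SophieGermain.conj P.1, by
    have := P.2.1
    exact Ideal.map_isMaximal_of_equiv _, P.2.2.conj⟩

lemma CopPrime.eq_or_eq_conj (P Q : CopPrime q) {p : ℕ} (hp : p.Prime) (hP : (p : Order q) ∈ P.1)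
    (hQ : (p : Order q) ∈ Q.1) : Q = P ∨ Q = P.conj := by
  rcases P.norm_eq hp hP with h | h
  · have h1 : P.1 * P.conj.1 ≤ Q.1 := by
      change P.1 * SophieGermain.conj P.1 ≤ Q.1
      rw [P.2.2.mul_conj, h]
      exact (Ideal.span_singleton_le_iff_mem _).mpr hQ
    rcases Q.2.1.isPrime.mul_le.mp h1 with h2 | h2
    · exact Or.inl (Subtype.ext (P.2.1.eq_of_le Q.2.1.ne_top h2).symm)
    · exact Or.inr (Subtype.ext (P.conj.2.1.eq_of_le Q.2.1.ne_top h2).symm)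
  · obtain ⟨K, hK, h1, h2⟩ := P.norm_eq_of_mem hp hP
    have hK1 : idealNorm K = 1 := by
      rw [h] at h2
      exact Nat.eq_of_mul_eq_mul_left (pow_pos hp.pos 2) (h2.trans (mul_one _).symm)
    rw [hK.eq_top hK1, Ideal.mul_top] at h1
    left
    apply Subtype.ext
    refine (P.2.1.eq_of_le Q.2.1.ne_top ?_).symm
    rw [← h1]
    exact (Ideal.span_singleton_le_iff_mem _).mpr hQ

open Classical in
/-- The primes of `ℤ[√-q]` coprime to `2q`, as a system of generalised primes. -/
noncomputable def copPrimeSystem (q : ℕ) [Fact q.Prime] : PrimeSystem (CopPrime q) where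
  norm P := idealNorm P.1
  under P := P.exists_under.choose
  under_prime P := P.exists_under.choose_spec.1
  norm_eq P := P.norm_eq P.exists_under.choose_spec.1 P.exists_under.choose_spec.2
  above p := if h : ∃ P : CopPrime q, P.exists_under.choose = p then {h.choose, h.choose.conj} else ∅
  card_above p := by
    split_ifs
    · exact Finset.card_le_two
    · simp
  mem_above P := by
    have h : ∃ Q : CopPrime q, Q.exists_under.choose = P.exists_under.choose := ⟨P, rfl⟩
    rw [dif_pos h, Finset.mem_insert, Finset.mem_singleton]
    refine h.choose.eq_or_eq_conj P P.exists_under.choose_spec.1 ?_ P.exists_under.choose_spec.2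
    have := h.choose.exists_under.choose_spec.2
    rwa [h.choose_spec] at this

lemma copPrimeSystem_normMul (s : Multiset (CopPrime q)) :
    (copPrimeSystem q).normMul s = idealNorm (toIdeal s) := (idealNorm_toIdeal s).symm

end
end SophieGermain

namespace SophieGermain
open Zsqrtd
open scoped nonZeroDivisors

section
variable {q : ℕ}

/-- An ideal is invertible if it is a unit as a fractional ideal. -/
def Inv (I : Ideal (Order q)) : Prop :=
  IsUnit (I : FractionalIdeal (Order q)⁰ (FractionRing (Order q)))

lemma Inv.mul {I J : Ideal (Order q)} (hI : Inv I) (hJ : Inv J) : Inv (I * J) := by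
  rw [Inv, FractionalIdeal.coeIdeal_mul]; exact IsUnit.mul hI hJ

lemma Inv.of_mul {I J : Ideal (Order q)} (h : Inv (I * J)) : Inv I := by
  rw [Inv, FractionalIdeal.coeIdeal_mul] at h; exact isUnit_of_mul_isUnit_left h

variable [Fact q.Prime]

lemma inv_span {x : Order q} (hx : x ≠ 0) : Inv (Ideal.span {x}) := by
  have hx' : algebraMap (Order q) (FractionRing (Order q)) x ≠ 0 := by simpa using hx
  rw [Inv, FractionalIdeal.coeIdeal_span_singleton]
  exact ⟨toPrincipalIdeal (Order q) _ (Units.mk0 _ hx'), by simp⟩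

lemma Cop.inv {I : Ideal (Order q)} (hI : Cop I) : Inv I := by
  apply Inv.of_mul (J := SophieGermain.conj I)
  rw [hI.mul_conj]
  exact inv_span hI.idealNorm_ne_zero

open Classical in
/-- The ideal class of an invertible ideal. -/
noncomputable def cls (I : Ideal (Order q)) : ClassGroup (Order q) :=
  if h : Inv I then ClassGroup.mk (FractionRing (Order q)) (IsUnit.unit h) else 1

lemma cls_of {I : Ideal (Order q)} (h : Inv I) :
    cls I = ClassGroup.mk (FractionRing (Order q)) (IsUnit.unit h) := dif_pos h

lemma cls_mul {I J : Ideal (Order q)} (hI : Inv I) (hJ : Inv J) : cls (I * J) = cls I * cls J := by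
  rw [cls_of hI, cls_of hJ, cls_of (hI.mul hJ), ← map_mul]
  congr 1
  exact Units.ext (FractionalIdeal.coeIdeal_mul I J)

lemma cls_eq_one {I : Ideal (Order q)} (hI : Inv I) :
    cls I = 1 ↔ ∃ x : Order q, x ≠ 0 ∧ I = Ideal.span {x} := by
  rw [cls_of hI]
  exact ClassGroup.mk_eq_one_of_coe_ideal (IsUnit.unit_spec hI)

lemma cls_span {x : Order q} (hx : x ≠ 0) : cls (Ideal.span {x}) = 1 :=
  (cls_eq_one (inv_span hx)).mpr ⟨x, hx, rfl⟩

lemma cls_eq_of_span_mul {I J : Ideal (Order q)} (hI : Inv I) (hJ : Inv J) {x y : Order q}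
    (hx : x ≠ 0) (hy : y ≠ 0) (h : Ideal.span {x} * I = Ideal.span {y} * J) : cls I = cls J := by
  have := congrArg cls h
  rwa [cls_mul (inv_span hx) hI, cls_mul (inv_span hy) hJ, cls_span hx, cls_span hy, one_mul,
    one_mul] at this

lemma cls_conj {I : Ideal (Order q)} (hI : Cop I) : cls (conj I) = (cls I)⁻¹ := by
  rw [eq_inv_iff_mul_eq_one, mul_comm, ← cls_mul hI.inv hI.conj.inv, hI.mul_conj]
  exact cls_span hI.idealNorm_ne_zero

lemma cls_toIdeal (s : Multiset (CopPrime q)) :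
    cls (toIdeal s) = (s.map fun P => cls P.1).prod := by
  induction s using Multiset.induction with
  | empty => simpa [toIdeal] using cls_span (q := q) one_ne_zero
  | cons P s ih => rw [toIdeal_cons, cls_mul P.2.2.inv (cop_toIdeal s).inv, ih]; simp

/-- Every class contains an integral ideal with an integral inverse up to a scalar. -/
lemma exists_integral (c : ClassGroup (Order q)) : ∃ (I I' : Ideal (Order q)) (d : Order q),
    Inv I ∧ d ≠ 0 ∧ I * I' = Ideal.span {d} ∧ cls I' = c := by
  have hrep : ∀ u : (FractionalIdeal (Order q)⁰ (FractionRing (Order q)))ˣ, 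
      ∃ (I : Ideal (Order q)) (d : Order q), d ≠ 0 ∧
        (I : FractionalIdeal (Order q)⁰ (FractionRing (Order q))) =
          FractionalIdeal.spanSingleton (Order q)⁰
            (algebraMap (Order q) (FractionRing (Order q)) d) *
              (u : FractionalIdeal (Order q)⁰ (FractionRing (Order q))) := fun u =>
    ⟨u.1.num, u.1.den, nonZeroDivisors.ne_zero u.1.den.2,
      (FractionalIdeal.den_mul_self_eq_num' (Order q)⁰ (FractionRing (Order q)) u.1).symm⟩
  have hrep' : ∀ {u : (FractionalIdeal (Order q)⁰ (FractionRing (Order q)))ˣ}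
      {I : Ideal (Order q)} {d : Order q}, d ≠ 0 →
        (I : FractionalIdeal (Order q)⁰ (FractionRing (Order q))) =
          FractionalIdeal.spanSingleton (Order q)⁰
            (algebraMap (Order q) (FractionRing (Order q)) d) *
              (u : FractionalIdeal (Order q)⁰ (FractionRing (Order q))) → Inv I := by
    intro u I d hd h
    have := inv_span hd
    rw [Inv, FractionalIdeal.coeIdeal_span_singleton] at this
    rw [Inv, h]
    exact this.mul u.isUnit
  refine ClassGroup.induction (FractionRing (Order q)) (fun u => ?_) c
  obtain ⟨I, d, hd, hI⟩ := hrep u⁻¹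
  obtain ⟨I', d', hd', hI'⟩ := hrep u
  refine ⟨I, I', d * d', hrep' hd hI, mul_ne_zero hd hd', ?_, ?_⟩
  · apply FractionalIdeal.coeIdeal_injective (K := FractionRing (Order q))
    change ((I * I' : Ideal (Order q)) : FractionalIdeal (Order q)⁰ (FractionRing (Order q))) = 
      (Ideal.span {d * d'} : Ideal (Order q))
    rw [FractionalIdeal.coeIdeal_mul, hI, hI', mul_mul_mul_comm, Units.inv_mul, mul_one,
      FractionalIdeal.spanSingleton_mul_spanSingleton, FractionalIdeal.coeIdeal_span_singleton,
      map_mul]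
  · have hd'' : algebraMap (Order q) (FractionRing (Order q)) d' ≠ 0 := by simpa using hd'
    rw [cls_of (hrep' hd' hI'), eq_comm, ClassGroup.mk_eq_mk]
    refine ⟨Units.mk0 _ hd'', ?_⟩
    ext1
    simp [hI', mul_comm]

end

section
variable {q : ℕ}

/-- Reduction of `ℤ[√-q]` at the prime above `2`. -/
def redTwo (hq : q % 2 = 1) : Order q →+* ZMod 2 := Zsqrtd.lift ⟨1, by
  have : (q : ZMod 2) = 1 := by
    rw [← ZMod.natCast_mod, hq, Nat.cast_one]
  push_cast
  rw [this]; decide⟩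

/-- Reduction of `ℤ[√-q]` at the prime above `q`. -/
def redSelf (q : ℕ) : Order q →+* ZMod q := Zsqrtd.lift ⟨0, by simp⟩

lemma redTwo_norm (hq : q % 2 = 1) (z : Order q) : ((z.norm : ℤ) : ZMod 2) = redTwo hq z ^ 2 := by
  have : (q : ZMod 2) = 1 := by rw [← ZMod.natCast_mod, hq, Nat.cast_one]
  have h2 : (2 : ZMod 2) = 0 := rfl
  simp [order_norm, redTwo, this]

lemma redSelf_norm (z : Order q) : ((z.norm : ℤ) : ZMod q) = redSelf q z ^ 2 := by
  simp [order_norm, redSelf]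

variable [Fact q.Prime]

lemma cop_of_red (hq : q % 2 = 1) {J : Ideal (Order q)} {z w : Order q} (hz : z ∈ J) (hw : w ∈ J)
    (hz2 : redTwo hq z ≠ 0) (hwq : redSelf q w ≠ 0) : Cop J := by
  have hn : ∀ z ∈ J, ((z.norm : ℤ) : Order q) ∈ J := fun z hz => by
    rw [Zsqrtd.norm_eq_mul_conj]; exact J.mul_mem_right _ hz
  refine ⟨q * z.norm + 2 * w.norm, IsCoprime.mul_right ?_ ?_, ?_⟩
  · rw [isCoprime_comm, Int.prime_two.coprime_iff_not_dvd]
    have := (ZMod.intCast_zmod_eq_zero_iff_dvd (q * z.norm + 2 * w.norm) 2).not.mp (by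
      push_cast
      rw [redTwo_norm hq]
      have h2 : (2 : ZMod 2) = 0 := rfl
      have hq1 : (q : ZMod 2) = 1 := by rw [← ZMod.natCast_mod, hq, Nat.cast_one]
      simpa [h2, hq1] using hz2)
    exact_mod_cast this
  · rw [isCoprime_comm, (Nat.prime_iff_prime_int.mp (Fact.out : q.Prime)).coprime_iff_not_dvd]
    refine (ZMod.intCast_zmod_eq_zero_iff_dvd (q * z.norm + 2 * w.norm) q).not.mp ?_
    push_cast
    rw [redSelf_norm w]
    have h2 : (2 : ZMod q) ≠ 0 := by
      intro h
      have h' : ((2 : ℕ) : ZMod q) = 0 := by exact_mod_cast h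
      rw [ZMod.natCast_eq_zero_iff] at h'
      rw [(Nat.prime_dvd_prime_iff_eq Fact.out Nat.prime_two).mp h'] at hq
      omega
    simpa [h2] using hwq
  · push_cast
    exact add_mem (J.mul_mem_left _ (hn z hz)) (J.mul_mem_left _ (hn w hw))

lemma exists_mul_eq_of_ringHom {I I' : Ideal (Order q)} {d : Order q} (hd : d ≠ 0)
    (h : I * I' = Ideal.span {d}) {F : Type*} [Field F] (f : Order q →+* F) :
    ∃ α ∈ I, ∃ w ∈ I', ∃ j, α * w = d * j ∧ f j ≠ 0 := by
  by_contra! H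
  have h1 : I * I' ≤ Ideal.span {d} * RingHom.ker f := by
    rw [Ideal.mul_le]
    intro α hα w hw
    have h2 : α * w ∈ Ideal.span {d} := by rw [← h]; exact Ideal.mul_mem_mul hα hw
    obtain ⟨j, hj⟩ := Ideal.mem_span_singleton.mp h2
    rw [Ideal.mem_span_singleton_mul]
    exact ⟨j, H α hα w hw j hj, hj.symm⟩
  rw [h, Ideal.span_singleton_le_iff_mem, Ideal.mem_span_singleton_mul] at h1
  obtain ⟨z, hz, hz'⟩ := h1
  have : z = 1 := mul_left_cancel₀ hd (hz'.trans (mul_one d).symm)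
  rw [this, RingHom.mem_ker, map_one] at hz
  exact one_ne_zero hz

/-- Every ideal class contains an integral ideal coprime to `2q`. -/
lemma exists_cop_cls (hq : q % 2 = 1) (c : ClassGroup (Order q)) : ∃ I, Cop I ∧ cls I = c := by
  obtain ⟨I, I', d, hI, hd, hII, hc⟩ := exists_integral c
  have hI' : Inv I' := by
    apply Inv.of_mul (J := I)
    rw [mul_comm, hII]; exact inv_span hd
  have : Fact (Nat.Prime 2) := ⟨Nat.prime_two⟩
  obtain ⟨α, hα, w, hw, j, hj, hj2⟩ := exists_mul_eq_of_ringHom hd hII (redTwo hq)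
  obtain ⟨β, hβ, v, hv, i, hi, hiq⟩ := exists_mul_eq_of_ringHom hd hII (redSelf q)
  have hmem : (q : Order q) * α + 2 * β ∈ I := add_mem (I.mul_mem_left _ hα) (I.mul_mem_left _ hβ)
  have hdvd : ∀ α ∈ I, ∀ w ∈ I', ∃ j, α * w = d * j := fun α hα w hw =>
    Ideal.mem_span_singleton.mp (by rw [← hII]; exact Ideal.mul_mem_mul hα hw)
  obtain ⟨J, hJ⟩ := exists_eq_span_mul
    (I := Ideal.span {(q : Order q) * α + 2 * β} * I') (d := d) (by
      rw [← hII]; exact Ideal.mul_mono_left ((Ideal.span_singleton_le_iff_mem _).mpr hmem))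
  have hmemJ : ∀ w ∈ I', ∀ j, ((q : Order q) * α + 2 * β) * w = d * j → j ∈ J := by
    intro w hw j hj
    have h1 : ((q : Order q) * α + 2 * β) * w ∈ Ideal.span {d} * J := by
      rw [← hJ]; exact Ideal.mul_mem_mul (Ideal.mem_span_singleton_self _) hw
    obtain ⟨z, hz, hz'⟩ := Ideal.mem_span_singleton_mul.mp h1
    rwa [← mul_left_cancel₀ hd (hz'.trans hj)]
  obtain ⟨j', hj'⟩ := hdvd β hβ w hw
  obtain ⟨i', hi'⟩ := hdvd α hα v hv
  have h1 : (q : Order q) * j + 2 * j' ∈ J := hmemJ w hw _ (by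
    linear_combination (q : Order q) * hj + 2 * hj')
  have h2 : (q : Order q) * i' + 2 * i ∈ J := hmemJ v hv _ (by
    linear_combination (q : Order q) * hi' + 2 * hi)
  have hJc : Cop J := by
    refine cop_of_red hq h1 h2 ?_ ?_
    · have e2 : (2 : ZMod 2) = 0 := rfl
      have hq1 : (q : ZMod 2) = 1 := by rw [← ZMod.natCast_mod, hq, Nat.cast_one]
      rw [map_add, map_mul, map_mul, map_natCast, map_ofNat]
      simpa [e2, hq1] using hj2
    · have e2 : (2 : ZMod q) ≠ 0 := by
        intro h
        have h' : ((2 : ℕ) : ZMod q) = 0 := by exact_mod_cast h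
        rw [ZMod.natCast_eq_zero_iff] at h'
        rw [(Nat.prime_dvd_prime_iff_eq Fact.out Nat.prime_two).mp h'] at hq
        omega
      rw [map_add, map_mul, map_mul, map_natCast, map_ofNat]
      simpa [e2] using hiq
  refine ⟨J, hJc, ?_⟩
  rw [← hc]
  refine cls_eq_of_span_mul hJc.inv hI' hd ?_ hJ.symm
  intro h0
  rw [h0, Ideal.span_singleton_zero, ← Ideal.zero_eq_bot, zero_mul] at hJ
  have h3 := Ideal.mul_mem_mul (Ideal.mem_span_singleton_self d) hJc.idealNorm_mem
  rw [← hJ, Ideal.zero_eq_bot, Ideal.mem_bot] at h3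
  exact mul_ne_zero hd hJc.idealNorm_ne_zero h3

end

section
variable {q : ℕ} [Fact q.Prime]

lemma principal_of_conj_eq {J : Ideal (Order q)} (hJ : conj J = J) {k : ℤ} (hk : k % 2 = 1)
    (hkJ : (k : Order q) ∈ J) : ∃ x : Order q, x ≠ 0 ∧ J = Ideal.span {x} := by
  obtain ⟨m, a, b, hm, ha, hdvd, hab, h⟩ := exists_basis (by rintro rfl; simp at hk) hkJ
  have hm' : (m : ℤ) ≠ 0 := by exact_mod_cast hm.ne'
  have h1 : (⟨m * b, m⟩ : Order q) ∈ J := by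
    rw [h]; exact ⟨dvd_rfl, ⟨0, by ring⟩⟩
  rw [← hJ, mem_conj, h] at h1
  have h2 : (m : ℤ) * a ∣ m * (2 * b) := by
    have := h1.2
    push_cast at this
    simp only [Zsqrtd.re_star, Zsqrtd.im_star] at this
    convert this using 1; ring
  have h3 : (a : ℤ) ∣ 2 * b := (mul_dvd_mul_iff_left hm').mp h2
  have haodd : IsCoprime (a : ℤ) 2 := by
    rw [isCoprime_comm, Int.prime_two.coprime_iff_not_dvd]
    intro h4
    have : (2 : ℤ) ∣ k := h4.trans ((dvd_mul_left (a : ℤ) m).trans (by exact_mod_cast hdvd))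
    omega
  have h4 : (a : ℤ) ∣ b := haodd.dvd_of_dvd_mul_left h3
  have h5 : a ∣ q := by
    have : (a : ℤ) ∣ q := (Int.dvd_iff_dvd_of_dvd_add hab).mp (h4.trans (dvd_pow_self b two_ne_zero))
    exact_mod_cast this
  rcases (Nat.dvd_prime Fact.out).mp h5 with rfl | rfl
  · refine ⟨(m : ℤ), by exact_mod_cast hm', ?_⟩
    ext z
    rw [h, Ideal.mem_span_singleton, Zsqrtd.intCast_dvd, and_comm, mul_one]
    refine and_congr_left fun h6 => ?_
    exact dvd_sub_left (h6.mul_left b)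
  · obtain ⟨c, rfl⟩ := h4
    refine ⟨⟨0, m⟩, fun h6 => hm' (congrArg Zsqrtd.im h6), ?_⟩
    ext z
    rw [h, Ideal.mem_span_singleton]
    push_cast
    constructor
    · rintro ⟨⟨u, hu⟩, h7⟩
      obtain ⟨v, hv⟩ : (m : ℤ) * a ∣ z.re := by
        refine (dvd_sub_left ?_).mp h7
        exact ⟨c * u, by rw [hu]; ring⟩
      refine ⟨⟨u, -v⟩, Zsqrtd.ext ?_ ?_⟩
      · rw [hv, Zsqrtd.re_mul]; ring
      · rw [hu, Zsqrtd.im_mul]; ring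
    · rintro ⟨w, rfl⟩
      simp only [Zsqrtd.re_mul, Zsqrtd.im_mul]
      exact ⟨⟨w.re, by ring⟩, ⟨-w.im - c * w.re, by ring⟩⟩

lemma cls_eq_one_of_sq_aux {I : Ideal (Order q)} (hI : Cop I) {x y : ℤ}
    (h : I * I = Ideal.span {⟨x, y⟩}) (hxy : x ^ 2 + q * y ^ 2 = (idealNorm I : ℤ) ^ 2)
    (hn : (idealNorm I : ℤ) % 2 = 1) (hy : y % 4 = 0) (hx : (idealNorm I + x) % 4 = 2) :
    cls I = 1 := by
  set n : ℤ := (idealNorm I : ℤ) with hn'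
  obtain ⟨u, hu⟩ : ∃ u, n + x = 2 * u := ⟨(n + x) / 2, by omega⟩
  obtain ⟨v, hv⟩ : ∃ v, y = 2 * v := ⟨y / 2, by omega⟩
  obtain ⟨w, hw⟩ : ∃ w, v = 2 * w := ⟨v / 2, by omega⟩
  have huodd : u % 2 = 1 := by omega
  obtain rfl : x = 2 * u - n := by omega
  have hδ : u ^ 2 + q * v ^ 2 = u * n := by
    rw [hv] at hxy
    linarith
  have hnormδ : (⟨u, v⟩ : Order q).norm = u * n := by rw [order_norm, ← hδ]
  have hodd : (u * n) % 2 = 1 := by rw [Int.mul_emod, huodd, hn]; rfl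
  have hδ0 : (⟨u, v⟩ : Order q) ≠ 0 := by
    intro h0
    have : u = 0 := congrArg Zsqrtd.re h0
    omega
  have hmul : (⟨2 * u - n, y⟩ : Order q) * star ⟨u, v⟩ = (idealNorm I : Order q) * ⟨u, v⟩ := by
    rw [Zsqrtd.star_mk]
    apply Zsqrtd.ext
    · simp [← hn', hv]; linear_combination 2 * hδ
    · simp [← hn', hv]; ring
  have hJ : I * Ideal.span {star ⟨u, v⟩} = Ideal.span {⟨u, v⟩} * conj I := by
    rw [← Ideal.span_singleton_mul_right_inj hI.idealNorm_ne_zero, ← mul_assoc _ (Ideal.span {_}),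
      Ideal.span_singleton_mul_span_singleton, ← hmul, ← Ideal.span_singleton_mul_span_singleton,
      ← h, ← hI.mul_conj]
    ring
  obtain ⟨z, hz, hz'⟩ := principal_of_conj_eq (J := I * Ideal.span {star ⟨u, v⟩}) (k := n * (u * n))
    (by rw [conj_mul, conj_span, star_star, hJ, mul_comm])
    (by rw [Int.mul_emod, hodd, hn]; rfl)
    (by
      push_cast
      refine Ideal.mul_mem_mul (by simpa [hn'] using hI.idealNorm_mem) ?_
      rw [Ideal.mem_span_singleton]
      refine ⟨⟨u, v⟩, ?_⟩
      have := Zsqrtd.norm_eq_mul_conj (⟨u, v⟩ : Order q)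
      rw [hnormδ] at this
      push_cast at this
      rw [this, mul_comm])
  have hs : (star ⟨u, v⟩ : Order q) ≠ 0 := star_ne_zero.mpr hδ0
  have h1 := cls_mul hI.inv (inv_span hs)
  rw [cls_span hs, mul_one] at h1
  rw [← h1, hz', cls_span hz]

lemma cls_eq_one_of_sq (hq : q % 4 = 3) {I : Ideal (Order q)} (hI : Cop I) (h : cls I ^ 2 = 1) :
    cls I = 1 := by
  rw [sq, ← cls_mul hI.inv hI.inv, cls_eq_one (hI.inv.mul hI.inv)] at h
  obtain ⟨⟨x, y⟩, -, h⟩ := h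
  have hxy : x ^ 2 + q * y ^ 2 = (idealNorm I : ℤ) ^ 2 := by
    have := idealNorm_span (⟨x, y⟩ : Order q)
    rw [← h, idealNorm_mul hI hI, order_norm] at this
    push_cast at this
    rw [sq (idealNorm I : ℤ), this]
  have hn : (idealNorm I : ℤ) % 2 = 1 := by
    have := (hI.isCoprime_idealNorm.of_isCoprime_of_dvd_right (dvd_mul_right (2 : ℤ) q)).symm
    rw [Int.prime_two.coprime_iff_not_dvd] at this
    omega
  obtain ⟨k, hk⟩ : ∃ k : ℤ, (q : ℤ) = 4 * k + 3 := ⟨q / 4, by omega⟩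
  have hyx : x % 2 = 1 ∧ y % 4 = 0 := by
    generalize (idealNorm I : ℤ) = n at *
    rw [hk] at hxy
    obtain ⟨t, rfl⟩ : ∃ t, n = 2 * t + 1 := ⟨n / 2, by omega⟩
    obtain ⟨v, rfl | rfl⟩ := Int.even_or_odd' y <;> obtain ⟨w, rfl | rfl⟩ := Int.even_or_odd' x
    · have : 2 * (2 * w ^ 2 + 2 * (4 * k + 3) * v ^ 2 - 2 * t ^ 2 - 2 * t) = 1 := by
        linear_combination hxy
      omega
    · obtain ⟨e, he⟩ := Int.even_mul_succ_self w
      obtain ⟨f, hf⟩ := Int.even_mul_succ_self t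
      obtain ⟨j, rfl | rfl⟩ := Int.even_or_odd' v
      · omega
      · have : 8 * (e + 2 * k + (4 * k + 3) * (2 * j ^ 2 + 2 * j) + 1 - f) = -4 := by
          linear_combination hxy - 4 * he + 4 * hf
        omega
    · have : 4 * (w ^ 2 + (4 * k + 3) * (v ^ 2 + v) + k - t ^ 2 - t) = -2 := by
        linear_combination hxy
      omega
    · have : 4 * (w ^ 2 + w + (4 * k + 3) * (v ^ 2 + v) + k - t ^ 2 - t) = -3 := by
        linear_combination hxy
      omega
  have hx : (idealNorm I + x) % 4 = 2 ∨ (idealNorm I + -x) % 4 = 2 := by omega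
  rcases hx with hx | hx
  · exact cls_eq_one_of_sq_aux hI h hxy hn hyx.2 hx
  · refine cls_eq_one_of_sq_aux (x := -x) (y := -y) hI ?_ ?_ hn (by omega) hx
    · rw [h, order_span_eq]
      right; apply Zsqrtd.ext <;> simp
    · rw [neg_sq, neg_sq, hxy]

/-- Every ideal coprime to `2q` contains an element of small norm. -/
lemma Cop.exists_small {I : Ideal (Order q)} (hI : Cop I) :
    ∃ α ∈ I, α ≠ 0 ∧ α.norm ≤ idealNorm I * (1 + q) := by
  obtain ⟨m, a, b, hm, ha, -, hn, h⟩ := hI.exists_basis_idealNorm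
  have hs : 0 < Nat.sqrt a := Nat.sqrt_pos.mpr ha
  obtain ⟨j, k, hk0, hk, hjk⟩ := Real.exists_int_int_abs_mul_sub_le (b / a : ℝ) hs
  refine ⟨⟨m * (b * k - a * j), m * k⟩, ?_, ?_, ?_⟩
  · rw [h]
    refine ⟨dvd_mul_right _ _, ⟨-j, ?_⟩⟩
    push_cast; ring
  · intro h0
    have : (m : ℤ) * k = 0 := congrArg Zsqrtd.im h0
    have := mul_pos (Int.natCast_pos.mpr hm) hk0
    omega
  · rw [order_norm, hn]
    have ha' : (0 : ℝ) < a := by exact_mod_cast ha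
    have h1 : ((b * k - a * j : ℤ) : ℝ) ^ 2 ≤ a := by
      have h2 : (k * (b / a : ℝ) - j) ^ 2 ≤ (1 / ((Nat.sqrt a : ℝ) + 1)) ^ 2 := by
        rw [← sq_abs]
        gcongr
      have h3 : (a : ℝ) ≤ ((Nat.sqrt a : ℝ) + 1) ^ 2 := by
        have := (Nat.lt_succ_sqrt a).le
        rw [sq]
        exact_mod_cast this
      have h4 : (1 / ((Nat.sqrt a : ℝ) + 1)) ^ 2 ≤ 1 / a := by
        rw [div_pow, one_pow]
        gcongr
      have h5 : ((b * k - a * j : ℤ) : ℝ) ^ 2 = a ^ 2 * (k * (b / a : ℝ) - j) ^ 2 := by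
        push_cast; field_simp
      rw [h5]
      calc (a : ℝ) ^ 2 * (k * (b / a : ℝ) - j) ^ 2 ≤ (a : ℝ) ^ 2 * (1 / a) := by gcongr; exact h2.trans h4
        _ = (a : ℝ) := by field_simp
    have h1' : (b * k - a * j) ^ 2 ≤ (a : ℤ) := by exact_mod_cast h1
    have h6 : k ^ 2 ≤ (a : ℤ) := by
      have h7 : ((Nat.sqrt a : ℕ) : ℤ) ^ 2 ≤ a := by exact_mod_cast Nat.sqrt_le' a
      nlinarith
    push_cast
    have h8 : (b * k - a * j) ^ 2 + q * k ^ 2 ≤ a * (1 + q) := by nlinarith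
    calc ((m : ℤ) * (b * k - a * j)) ^ 2 + q * (m * k) ^ 2
        = (m : ℤ) ^ 2 * ((b * k - a * j) ^ 2 + q * k ^ 2) := by ring
      _ ≤ (m : ℤ) ^ 2 * (a * (1 + q)) := by gcongr
      _ = (m : ℤ) ^ 2 * a * (1 + q) := by ring

lemma exists_factorial_mem_cls (hq : q % 2 = 1) (c : ClassGroup (Order q)) :
    ∃ K : Ideal (Order q), ((1 + q).factorial : Order q) ∈ K ∧ Inv K ∧ cls K = c := by
  obtain ⟨I, hI, hc⟩ := exists_cop_cls hq c⁻¹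
  obtain ⟨α, hα, hα0, hle⟩ := hI.exists_small
  have hspan : Ideal.span {α} ≤ I := (Ideal.span_singleton_le_iff_mem _).mpr hα
  obtain ⟨K, hK⟩ := exists_eq_span_mul (I := Ideal.span {α} * conj I) (d := idealNorm I) (by
    rw [← hI.mul_conj]; exact Ideal.mul_mono_left hspan)
  have hKinv : Inv K := by
    apply Inv.of_mul (J := Ideal.span {(idealNorm I : Order q)})
    rw [mul_comm, ← hK]
    exact (inv_span hα0).mul hI.conj.inv
  refine ⟨K, ?_, hKinv, ?_⟩
  · have h1 : ((α.norm : ℤ) : Order q) ∈ Ideal.span {(idealNorm I : Order q)} * K := by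
      rw [← hK, Zsqrtd.norm_eq_mul_conj]
      exact Ideal.mul_mem_mul (Ideal.mem_span_singleton_self _) (by rw [mem_conj, star_star]; exact hα)
    obtain ⟨z, hz, hz'⟩ := Ideal.mem_span_singleton_mul.mp h1
    have hn := Int.natCast_pos.mpr hI.idealNorm_pos
    have hre : (idealNorm I : ℤ) * z.re = α.norm := by simpa using congrArg Zsqrtd.re hz'
    have him : z.im = 0 := by
      have := congrArg Zsqrtd.im hz'
      simp at this
      omega
    have hpos : 0 < α.norm :=
      lt_of_le_of_ne (order_norm_nonneg α) (Ne.symm (order_norm_eq_zero.not.mpr hα0))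
    have hz0 : 0 < z.re := pos_of_mul_pos_right (hre ▸ hpos) hn.le
    have hz1 : z.re ≤ 1 + q := by
      rw [← hre] at hle
      exact le_of_mul_le_mul_left hle hn
    obtain ⟨r, hr⟩ := Int.eq_ofNat_of_zero_le hz0.le
    have hzr : z = (r : Order q) := Zsqrtd.ext (by simpa using hr) (by simpa using him)
    obtain ⟨t, ht⟩ := Nat.dvd_factorial (m := r) (n := 1 + q) (by omega) (by omega)
    rw [ht, Nat.cast_mul, ← hzr]
    exact K.mul_mem_right _ hz
  · have := cls_eq_of_span_mul hI.conj.inv hKinv hα0 hI.idealNorm_ne_zero hK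
    rw [← this, cls_conj hI, hc, inv_inv]

omit [Fact q.Prime] in
lemma finite_ideals_of_natCast_mem {M : ℕ} (hM : M ≠ 0) :
    {K : Ideal (Order q) | (M : Order q) ∈ K}.Finite := by
  have : NeZero M := ⟨hM⟩
  let f : Ideal (Order q) → Set (ZMod M × ZMod M) := fun K =>
    (fun z : Order q => ((z.re : ZMod M), (z.im : ZMod M))) '' K
  have key : ∀ K : Ideal (Order q), (M : Order q) ∈ K → ∀ z : Order q,
      ((z.re : ZMod M), (z.im : ZMod M)) ∈ f K → z ∈ K := by
    rintro K hK z ⟨w, hw, hwz⟩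
    obtain ⟨h1, h2⟩ := Prod.ext_iff.mp hwz
    rw [ZMod.intCast_eq_intCast_iff_dvd_sub] at h1 h2
    have h3 : (M : Order q) ∣ z - w := by
      have := (Zsqrtd.intCast_dvd (M : ℤ) (z - w)).mpr ⟨by simpa using h1, by simpa using h2⟩
      simpa using this
    have h4 := K.mem_of_dvd h3 hK
    simpa using add_mem h4 hw
  refine Set.Finite.of_finite_image (f := f) (Set.toFinite _) ?_
  intro K hK L hL hKL
  ext z
  exact ⟨fun hz => key L hL z (hKL ▸ ⟨z, hz, rfl⟩), fun hz => key K hK z (hKL ▸ ⟨z, hz, rfl⟩)⟩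

lemma finite_classGroup (hq : q % 2 = 1) : Finite (ClassGroup (Order q)) := by
  choose K hK hinv hcls using exists_factorial_mem_cls (q := q) hq
  have := (finite_ideals_of_natCast_mem (q := q) (Nat.factorial_ne_zero (1 + q))).to_subtype
  refine Finite.of_injective (β := {K : Ideal (Order q) | ((1 + q).factorial : Order q) ∈ K})
    (fun c => ⟨K c, hK c⟩) fun c d h => ?_
  have hcd : K c = K d := congrArg Subtype.val h
  rw [← hcls c, ← hcls d, hcd]

lemma odd_card_classGroup (hq : q % 4 = 3) : Odd (Nat.card (ClassGroup (Order q))) := by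
  by_contra hodd
  have := finite_classGroup (q := q) (by omega)
  rw [Nat.not_odd_iff_even, even_iff_two_dvd] at hodd
  have : Fact (Nat.Prime 2) := ⟨Nat.prime_two⟩
  obtain ⟨c, hc⟩ := exists_prime_orderOf_dvd_card' 2 hodd
  obtain ⟨I, hI, rfl⟩ := exists_cop_cls (by omega) c
  have := cls_eq_one_of_sq hq hI (hc ▸ pow_orderOf_eq_one (cls I))
  rw [this, orderOf_one] at hc
  omega

end
end SophieGermain

namespace SophieGermain
open Zsqrtd

/-- The group `(ℤ/2q)ˣ / ±1`. -/
abbrev NormGroup (q : ℕ) := (ZMod (2 * q))ˣ ⧸ Subgroup.zpowers (-1 : (ZMod (2 * q))ˣ)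

open Classical in
/-- The class in `(ℤ/2q)ˣ / ±1` of an integer coprime to `2q`. -/
noncomputable def normCls (q n : ℕ) : NormGroup q :=
  if h : n.Coprime (2 * q) then QuotientGroup.mk (ZMod.unitOfCoprime n h) else 1

section
variable {q : ℕ}

lemma normCls_of {n : ℕ} (h : n.Coprime (2 * q)) :
    normCls q n = QuotientGroup.mk (ZMod.unitOfCoprime n h) := dif_pos h

lemma normCls_mul {m n : ℕ} (hm : m.Coprime (2 * q)) (hn : n.Coprime (2 * q)) :
    normCls q (m * n) = normCls q m * normCls q n := by
  rw [normCls_of hm, normCls_of hn, normCls_of (hm.mul_left hn), ← QuotientGroup.mk_mul]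
  congr 1
  ext
  simp

lemma normCls_one : normCls q 1 = 1 := by
  rw [normCls_of (Nat.coprime_one_left _)]
  have : ZMod.unitOfCoprime 1 (Nat.coprime_one_left (2 * q)) = 1 := by ext; simp
  rw [this, QuotientGroup.mk_one]

lemma mem_zpowers_neg_one {G : Type*} [Group G] [HasDistribNeg G] {x : G} :
    x ∈ Subgroup.zpowers (-1 : G) ↔ x = 1 ∨ x = -1 := by
  constructor
  · rintro ⟨k, rfl⟩
    rcases Int.even_or_odd k with h | h
    · left; simpa using h.neg_one_zpow
    · right; simpa using h.neg_one_zpow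
  · rintro (rfl | rfl)
    · exact one_mem _
    · exact Subgroup.mem_zpowers _

lemma normCls_eq_one {n : ℕ} (h : n.Coprime (2 * q)) :
    normCls q n = 1 ↔ (n : ZMod (2 * q)) = 1 ∨ (n : ZMod (2 * q)) = -1 := by
  rw [normCls_of h, QuotientGroup.eq_one_iff, mem_zpowers_neg_one, Units.ext_iff, Units.ext_iff]
  simp

lemma card_normGroup (hq : q.Prime) (hq2 : q ≠ 2) : 2 * Nat.card (NormGroup q) = q - 1 := by
  have : NeZero (2 * q) := ⟨mul_ne_zero two_ne_zero hq.ne_zero⟩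
  have h3 := hq.two_le
  have h1 := Subgroup.card_eq_card_quotient_mul_card_subgroup
    (Subgroup.zpowers (-1 : (ZMod (2 * q))ˣ))
  have : Fact (2 < 2 * q) := ⟨by omega⟩
  rw [Nat.card_zpowers, orderOf_eq_prime (p := 2) (by simp) (fun h => ZMod.neg_one_ne_one
    (n := 2 * q) (by simpa using congrArg Units.val h)), Nat.card_eq_fintype_card (α := (ZMod _)ˣ),
    ZMod.card_units_eq_totient, Nat.totient_mul ((Nat.coprime_primes Nat.prime_two hq).mpr
    (Ne.symm hq2)), Nat.totient_two, one_mul, Nat.totient_prime hq] at h1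
  rw [h1, mul_comm]

variable [Fact q.Prime]

lemma Cop.coprime_idealNorm {I : Ideal (Order q)} (hI : Cop I) :
    (idealNorm I).Coprime (2 * q) := by
  have := hI.isCoprime_idealNorm
  exact Nat.isCoprime_iff_coprime.mp (by exact_mod_cast this)

/-- The ideal class together with the class of the norm. -/
noncomputable def bigCls (I : Ideal (Order q)) : Additive (ClassGroup (Order q) × NormGroup q) :=
  Additive.ofMul (cls I, normCls q (idealNorm I))

lemma bigCls_mul {I J : Ideal (Order q)} (hI : Cop I) (hJ : Cop J) :
    bigCls (I * J) = bigCls I + bigCls J := by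
  rw [bigCls, cls_mul hI.inv hJ.inv, idealNorm_mul hI hJ,
    normCls_mul hI.coprime_idealNorm hJ.coprime_idealNorm]
  rfl

lemma bigCls_eq_zero {I : Ideal (Order q)} :
    bigCls I = 0 ↔ cls I = 1 ∧ normCls q (idealNorm I) = 1 := by
  rw [bigCls, ofMul_eq_zero, Prod.mk_eq_one]

lemma bigCls_toIdeal (s : Multiset (CopPrime q)) :
    bigCls (toIdeal s) = (s.map fun P => bigCls P.1).sum := by
  induction s using Multiset.induction with
  | empty =>
    rw [Multiset.map_zero, Multiset.sum_zero, bigCls_eq_zero, cls_toIdeal, idealNorm_toIdeal]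
    simp [normCls_one]
  | cons P s ih => rw [toIdeal_cons, bigCls_mul P.2.2 (cop_toIdeal s), ih]; simp

/-- The primes counted by the theorem. -/
def Good (q p : ℕ) : Prop := p ≠ q ∧ (∃ x y : ℤ, (p : ℤ) = x ^ 2 + q * y ^ 2) ∧ p % q = 1

lemma good_of_bigCls_eq_zero (hq : q % 4 = 3) {P : CopPrime q} (h : bigCls P.1 = 0) :
    Good q (idealNorm P.1) := by
  rw [bigCls_eq_zero, cls_eq_one P.2.2.inv] at h
  obtain ⟨⟨⟨x, y⟩, -, h1⟩, h2⟩ := h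
  have hN := idealNorm_span (⟨x, y⟩ : Order q)
  rw [← h1, order_norm] at hN
  have hc := P.2.2.coprime_idealNorm
  rw [normCls_eq_one hc] at h2
  have hq0 : q.Prime := Fact.out
  have hcast : ∀ z : ℤ, ((idealNorm P.1 : ℤ) : ZMod (2 * q)) = (z : ZMod (2 * q)) →
      ((idealNorm P.1 : ℤ) : ZMod q) = (z : ZMod q) := by
    intro z hz
    rw [ZMod.intCast_eq_intCast_iff_dvd_sub] at hz ⊢
    exact dvd_trans ⟨2, by push_cast; ring⟩ hz
  have h3 : ((idealNorm P.1 : ℤ) : ZMod q) = 1 := by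
    rcases h2 with h2 | h2
    · simpa using hcast 1 (by simpa using h2)
    · exfalso
      have h4 : ((idealNorm P.1 : ℤ) : ZMod q) = -1 := by simpa using hcast (-1) (by simpa using h2)
      rw [hN] at h4
      push_cast at h4
      rw [ZMod.natCast_self, zero_mul, add_zero] at h4
      exact (ZMod.exists_sq_eq_neg_one_iff (p := q)).mp ⟨x, by rw [← h4, sq]⟩ hq
  refine ⟨?_, ⟨x, y, hN⟩, ?_⟩
  · intro h5
    rw [h5] at hc
    have h6 := hc.coprime_mul_left_right
    rw [Nat.coprime_self] at h6
    exact hq0.one_lt.ne' h6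
  · have : ((idealNorm P.1 : ℕ) : ZMod q) = (1 : ℕ) := by simpa using h3
    rw [ZMod.natCast_eq_natCast_iff] at this
    rw [this, Nat.mod_eq_of_lt hq0.one_lt]

lemma ncard_of_good (hq : q % 4 = 3) {p : ℕ} (hp : p.Prime) (h : Good q p) :
    {P : CopPrime q | idealNorm P.1 = p ∧ bigCls P.1 = 0}.ncard = 2 := by
  obtain ⟨hpq, ⟨x, y, hxy⟩, hmod⟩ := h
  have hq0 : q.Prime := Fact.out
  have hp2 : p ≠ 2 := by
    rintro rfl
    rw [Nat.mod_eq_of_lt (by omega)] at hmod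
    omega
  have hc : p.Coprime (2 * q) := Nat.Coprime.mul_right ((Nat.coprime_primes hp Nat.prime_two).mpr hp2)
    ((Nat.coprime_primes hp hq0).mpr hpq)
  have hnorm : (⟨x, y⟩ : Order q).norm = p := by rw [order_norm, hxy]
  have hI : ∀ z : Order q, z.norm = p → Cop (Ideal.span {z}) ∧ idealNorm (Ideal.span {z}) = p ∧
      bigCls (Ideal.span {z}) = 0 := by
    intro z hz
    have hz0 : z ≠ 0 := by
      rintro rfl
      rw [Zsqrtd.norm_zero] at hz
      exact hp.ne_zero (by exact_mod_cast hz.symm)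
    have h1 : idealNorm (Ideal.span {z}) = p := by
      have := idealNorm_span z
      rw [hz] at this
      exact_mod_cast this
    refine ⟨cop_span (by rw [hz]; exact_mod_cast Nat.isCoprime_iff_coprime.mpr hc), h1, ?_⟩
    rw [bigCls_eq_zero, cls_span hz0, h1, normCls_eq_one hc]
    refine ⟨rfl, Or.inl ?_⟩
    have : p ≡ 1 [MOD 2 * q] := by
      refine (Nat.modEq_and_modEq_iff_modEq_mul ((Nat.coprime_primes Nat.prime_two hq0).mpr
        (by omega))).mp ⟨?_, ?_⟩
      · exact (hp.eq_two_or_odd.resolve_left hp2)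
      · rw [Nat.ModEq, hmod, Nat.mod_eq_of_lt hq0.one_lt]
    simpa using (ZMod.natCast_eq_natCast_iff _ _ _).mpr this
  obtain ⟨h1, h2, h3⟩ := hI _ hnorm
  let P : CopPrime q := ⟨Ideal.span {⟨x, y⟩}, h1.isMaximal (h2 ▸ hp), h1⟩
  obtain ⟨-, h5, h6⟩ := hI (star ⟨x, y⟩) (by rw [Zsqrtd.norm_conj, hnorm])
  have hne : P ≠ P.conj := by
    intro h
    have h7 : Ideal.span {(⟨x, y⟩ : Order q)} = Ideal.span {star ⟨x, y⟩} := by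
      rw [← conj_span]; exact congrArg Subtype.val h
    rw [order_span_eq] at h7
    have h8 : ¬ IsSquare (p : ℤ) := fun h => (Nat.prime_iff_prime_int.mp hp).not_isSquare h
    rcases h7 with h7 | h7
    · have : y = -y := congrArg Zsqrtd.im h7
      obtain rfl : y = 0 := by omega
      exact h8 ⟨x, by rw [hxy]; ring⟩
    · have : x = -x := congrArg Zsqrtd.re h7
      obtain rfl : x = 0 := by omega
      have h9 : (q : ℤ) ∣ p := ⟨y ^ 2, by rw [hxy]; ring⟩
      have := (Nat.prime_dvd_prime_iff_eq hq0 hp).mp (by exact_mod_cast h9)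
      exact hpq this.symm
  refine Eq.trans (congrArg Set.ncard (Set.ext fun Q => ?_)) (Set.ncard_pair hne)
  simp only [Set.mem_ofPred_eq, Set.mem_insert_iff, Set.mem_singleton_iff]
  constructor
  · rintro ⟨h7, -⟩
    refine P.eq_or_eq_conj Q hp ?_ ?_
    · rw [← h2]; exact h1.idealNorm_mem
    · rw [← h7]; exact Q.2.2.idealNorm_mem
  · rintro (rfl | rfl)
    · exact ⟨h2, h3⟩
    · have : P.conj.1 = Ideal.span {star ⟨x, y⟩} := conj_span _
      rw [this]
      exact ⟨h5, h6⟩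

open Classical in
lemma ncard_bigCls_eq_zero (hq : q % 4 = 3) {p : ℕ} (hp : p.Prime) :
    {P : CopPrime q | idealNorm P.1 = p ∧ bigCls P.1 = 0}.ncard = if Good q p then 2 else 0 := by
  split_ifs with h
  · exact ncard_of_good hq hp h
  · refine Eq.trans (congrArg Set.ncard ?_) (Set.ncard_empty _)
    rw [Set.eq_empty_iff_forall_notMem]
    rintro P ⟨rfl, h2⟩
    exact h (good_of_bigCls_eq_zero hq h2)

lemma odd_card_group (hq : q % 4 = 3) :
    Odd (Nat.card (Additive (ClassGroup (Order q) × NormGroup q))) := by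
  have h1 := card_normGroup (q := q) Fact.out (by omega)
  change Odd (Nat.card (ClassGroup (Order q) × NormGroup q))
  rw [Nat.card_prod]
  refine (odd_card_classGroup hq).mul ?_
  rw [Nat.odd_iff]
  omega

end
end SophieGermain

namespace SophieGermain
open Finset

/-- Height of the ellipse `x² + q t² ≤ Y`. -/
noncomputable def halfChord (q : ℕ) (Y t : ℝ) : ℝ := √(Y - q * t ^ 2)

/-- A quarter of the area of the ellipse `x² + q y² ≤ 1`. -/
noncomputable def quarterArea (q : ℕ) : ℝ := ∫ t in (0 : ℝ)..1, halfChord q 1 t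

section
variable {q : ℕ}

lemma halfChord_antitoneOn (Y : ℝ) : AntitoneOn (halfChord q Y) (Set.Ici 0) := by
  intro s hs t _ hst
  have : 0 ≤ s := hs
  unfold halfChord
  gcongr

lemma continuous_halfChord (Y : ℝ) : Continuous (halfChord q Y) := by
  unfold halfChord; fun_prop

lemma halfChord_zero (Y : ℝ) : halfChord q Y 0 = √Y := by simp [halfChord]

lemma halfChord_neg (Y t : ℝ) : halfChord q Y (-t) = halfChord q Y t := by simp [halfChord]

lemma halfChord_nonneg (Y t : ℝ) : 0 ≤ halfChord q Y t := Real.sqrt_nonneg _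

lemma halfChord_eq_zero (hq : 0 < q) {Y t : ℝ} (h : Y ≤ t ^ 2) : halfChord q Y t = 0 := by
  apply Real.sqrt_eq_zero_of_nonpos
  have : (1 : ℝ) ≤ q := by exact_mod_cast hq
  nlinarith [sq_nonneg t]

lemma quarterArea_pos : 0 < quarterArea q :=
  intervalIntegral.integral_pos one_pos (continuous_halfChord 1).continuousOn
    (fun _ _ => halfChord_nonneg _ _) ⟨0, by simp, by simp [halfChord_zero]⟩

lemma integral_halfChord (hq : 0 < q) {Y M L : ℝ} (hY : 0 < Y) (hM : 0 < M)
    (hL : √Y ≤ M * L) : ∫ t in (0 : ℝ)..L, halfChord q Y (M * t) = quarterArea q * Y / M := by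
  have hs : 0 < √Y := Real.sqrt_pos.mpr hY
  have h1 : ∀ t, halfChord q Y (M * t) = √Y * halfChord q 1 (M / √Y * t) := by
    intro t
    rw [halfChord, halfChord, ← Real.sqrt_mul hY.le]
    congr 1
    rw [mul_pow (M / √Y), div_pow, Real.sq_sqrt hY.le]
    field_simp
  simp_rw [h1]
  rw [intervalIntegral.integral_const_mul,
    intervalIntegral.integral_comp_mul_left _ (div_pos hM hs).ne', mul_zero]
  have hInt : ∀ a b, IntervalIntegrable (halfChord q 1) MeasureTheory.volume a b :=
    (continuous_halfChord 1).intervalIntegrable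
  have h1L : 1 ≤ M / √Y * L := by
    rw [div_mul_eq_mul_div, le_div_iff₀ hs]; linarith
  have h2 : ∫ t in (1 : ℝ)..(M / √Y * L), halfChord q 1 t = 0 := by
    apply intervalIntegral.integral_zero_ae
    refine Filter.Eventually.of_forall fun t ht => halfChord_eq_zero hq ?_
    rw [Set.uIoc_of_le h1L] at ht
    have := ht.1
    nlinarith
  rw [← intervalIntegral.integral_add_adjacent_intervals (hInt 0 1) (hInt 1 _), h2, add_zero,
    ← quarterArea, smul_eq_mul]
  field_simp
  rw [Real.sq_sqrt hY.le, mul_comm]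

lemma abs_sum_halfChord_sub_le (hq : 0 < q) {Y : ℝ} {M L : ℕ} (hY : 0 < Y) (hM : 0 < M)
    (hL : √Y ≤ L) {r : ℝ} (hr : 0 ≤ r) (hrM : r ≤ M) :
    |∑ k ∈ range L, halfChord q Y (r + M * k) - quarterArea q * Y / M| ≤ √Y := by
  have hM' : (1 : ℝ) ≤ M := by exact_mod_cast hM
  have hL' : √Y ≤ M * L := hL.trans (by nlinarith [Real.sqrt_nonneg Y])
  have hanti : AntitoneOn (fun t => halfChord q Y (M * t)) (Set.Icc (0 : ℝ) (0 + L)) := by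
    intro s hs t ht hst
    exact halfChord_antitoneOn Y (Set.mem_Ici.mpr (by have := hs.1; positivity))
      (Set.mem_Ici.mpr (by have := ht.1; positivity)) (by gcongr)
  have h1 := hanti.sum_le_integral
  have h2 := hanti.integral_le_sum
  simp only [zero_add] at h1 h2
  rw [integral_halfChord hq hY (by linarith) hL'] at h1 h2
  have h3 : halfChord q Y (M * L) = 0 :=
    halfChord_eq_zero hq (by rw [← Real.sq_sqrt hY.le]; gcongr)
  have h4 := sum_range_succ (fun k : ℕ => halfChord q Y (M * k)) L
  rw [sum_range_succ', h3, Nat.cast_zero, mul_zero, halfChord_zero] at h4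
  have h5 : ∑ k ∈ range L, halfChord q Y (r + M * k) ≤ ∑ k ∈ range L, halfChord q Y (M * k) := by
    gcongr with k
    exact halfChord_antitoneOn Y (Set.mem_Ici.mpr (by positivity))
      (Set.mem_Ici.mpr (by positivity)) (by linarith)
  have h6 : ∑ k ∈ range L, halfChord q Y (M * (k + 1 : ℕ)) ≤
      ∑ k ∈ range L, halfChord q Y (r + M * k) := by
    gcongr with k
    exact halfChord_antitoneOn Y (Set.mem_Ici.mpr (by positivity))
      (Set.mem_Ici.mpr (by positivity)) (by push_cast; linarith)
  rw [abs_le]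
  constructor <;> linarith

lemma sum_Ico_neg_eq (F : ℤ → ℝ) (L : ℕ) :
    ∑ k ∈ Ico (-(L : ℤ)) L, F k = ∑ k ∈ range L, F k + ∑ k ∈ range L, F (-((k : ℤ) + 1)) := by
  induction L with
  | zero => simp
  | succ L ih =>
    have : Ico (-((L + 1 : ℕ) : ℤ)) ((L + 1 : ℕ) : ℤ) =
        insert (-((L : ℤ) + 1)) (insert (L : ℤ) (Ico (-(L : ℤ)) L)) := by
      ext k; simp; omega
    rw [this, sum_insert (by simp), sum_insert (by simp), ih, sum_range_succ, sum_range_succ]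
    ring

/-- The integers `x ≡ c` modulo `M` with `x² ≤ D`. -/
lemma abs_card_sq_le_sub (B D : ℤ) (hB : D ≤ B) {M : ℕ} (hM : 0 < M) (c : ℤ) :
    |(#{x ∈ Icc (-B) B | x ^ 2 ≤ D ∧ (M : ℤ) ∣ x - c} : ℝ) - 2 / M * √D| ≤
      if 0 ≤ D then 2 else 0 := by
  split_ifs with hD
  · obtain ⟨d, rfl⟩ := Int.eq_ofNat_of_zero_le hD
    set S := Nat.sqrt d with hS
    have hS1 : (S : ℤ) ^ 2 ≤ d := by exact_mod_cast Nat.sqrt_le' d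
    have hS2 : (d : ℤ) < ((S : ℤ) + 1) ^ 2 := by exact_mod_cast Nat.lt_succ_sqrt' d
    have hset : {x ∈ Icc (-B) B | x ^ 2 ≤ (d : ℤ) ∧ (M : ℤ) ∣ x - c} =
        {x ∈ Ioc (-(S : ℤ) - 1) S | x ≡ c [ZMOD M]} := by
      ext x
      rw [mem_filter, mem_filter, mem_Icc, mem_Ioc, Int.modEq_comm, Int.modEq_iff_dvd]
      constructor
      · rintro ⟨-, h1, h2⟩
        have := abs_lt_of_sq_lt_sq (h1.trans_lt hS2) (by positivity)
        rw [abs_lt] at this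
        exact ⟨by omega, h2⟩
      · rintro ⟨⟨h1, h2⟩, h3⟩
        have h4 : x ^ 2 ≤ (S : ℤ) ^ 2 := sq_le_sq' (by omega) h2
        exact ⟨⟨by nlinarith, by nlinarith⟩, h4.trans hS1, h3⟩
    have hM' : (1 : ℝ) ≤ M := by exact_mod_cast hM
    have hcard := Int.Ioc_filter_modEq_card (-(S : ℤ) - 1) S (r := M) (by exact_mod_cast hM) c
    rw [hset]
    set n := #{x ∈ Ioc (-(S : ℤ) - 1) S | x ≡ c [ZMOD M]} with hn
    set u : ℚ := ((S : ℤ) - c) / (M : ℤ) with hu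
    set v : ℚ := ((-(S : ℤ) - 1 : ℤ) - c) / (M : ℤ) with hv
    have hMQ : (0 : ℚ) < (M : ℤ) := by exact_mod_cast hM
    have huv : u - v = (2 * S + 1) / M := by
      rw [hu, hv]; push_cast; field_simp; ring
    have huv0 : v ≤ u := by
      have : (0 : ℚ) ≤ (2 * S + 1) / M := by positivity
      linarith
    rw [max_eq_left (by have := Int.floor_le_floor huv0; omega)] at hcard
    have hcard' : (n : ℚ) = ⌊u⌋ - ⌊v⌋ := by exact_mod_cast hcard
    have h1 : |(n : ℚ) - (2 * S + 1) / M| ≤ 1 := by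
      rw [abs_le, hcard', ← huv]
      have := Int.floor_le u
      have := Int.lt_floor_add_one u
      have := Int.floor_le v
      have := Int.lt_floor_add_one v
      constructor <;> linarith
    have h1' : |(n : ℝ) - (2 * S + 1) / M| ≤ 1 := by
      have := (Rat.cast_le (K := ℝ)).mpr h1
      push_cast at this
      exact this
    have h2 : |(2 * S + 1) / M - 2 / M * √(d : ℝ)| ≤ 1 := by
      have h3 : (S : ℝ) ≤ √(d : ℝ) := Real.le_sqrt_of_sq_le (by exact_mod_cast hS1)
      have h4 : √(d : ℝ) ≤ S + 1 := Real.sqrt_le_iff.mpr ⟨by positivity, by exact_mod_cast hS2.le⟩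
      rw [div_mul_eq_mul_div, ← sub_div, abs_div, abs_of_pos (by linarith : (0 : ℝ) < M),
        div_le_one (by linarith)]
      refine le_trans ?_ hM'
      rw [abs_le]
      constructor <;> linarith
    have := abs_sub_le (n : ℝ) ((2 * S + 1) / M) (2 / M * √(d : ℝ))
    rw [Int.cast_natCast]
    linarith
  · rw [Real.sqrt_eq_zero_of_nonpos (by push Not at hD; exact_mod_cast hD.le),
      filter_false_of_mem]
    · simp
    · rintro x - ⟨hx, -⟩
      nlinarith [sq_nonneg x]

lemma sum_indicator_le {Y : ℕ} {L : ℕ} (F : ℕ → ℤ) (hF : ∀ k, 0 ≤ F k → (k : ℤ) ^ 2 ≤ Y) :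
    ∑ k ∈ range L, (if 0 ≤ F k then (2 : ℝ) else 0) ≤ 2 * (√Y + 1) := by
  rw [← sum_filter, sum_const, nsmul_eq_mul, mul_comm]
  have h1 : {k ∈ range L | 0 ≤ F k} ⊆ range (Nat.sqrt Y + 1) := by
    intro k hk
    rw [mem_filter] at hk
    have := hF k hk.2
    rw [mem_range, Nat.lt_succ_iff, Nat.le_sqrt']
    exact_mod_cast this
  have h2 := card_le_card h1
  rw [card_range] at h2
  have h3 : (Nat.sqrt Y : ℝ) ≤ √Y := Real.nat_sqrt_le_real_sqrt
  have h4 : (#{k ∈ range L | 0 ≤ F k} : ℝ) ≤ Nat.sqrt Y + 1 := by exact_mod_cast h2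
  linarith

/-- Points of a lattice translate in an ellipse. -/
lemma abs_card_ellipse_sub_le (hq : 0 < q) {M M' Y : ℕ} (hM : 0 < M) (hM' : 0 < M') (hY : 0 < Y)
    {r : ℤ} (hr : 0 ≤ r) (hrM : r < M) (c : ℤ → ℤ) :
    |(#{z ∈ Icc (-Y : ℤ) Y ×ˢ Icc (-Y : ℤ) Y | z.1 ^ 2 + q * z.2 ^ 2 ≤ (Y : ℤ) ∧
      (M : ℤ) ∣ z.2 - r ∧ (M' : ℤ) ∣ z.1 - c z.2} : ℝ) - 4 * quarterArea q * Y / (M * M')| ≤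
      12 * √Y := by
  have hq' : (1 : ℤ) ≤ q := by exact_mod_cast hq
  have hM1 : (1 : ℤ) ≤ M := by exact_mod_cast hM
  set y : ℤ → ℤ := fun k => r + M * k with hy
  let T : ℤ → Finset ℤ := fun k =>
    {x ∈ Icc (-Y : ℤ) Y | x ^ 2 ≤ Y - q * y k ^ 2 ∧ (M' : ℤ) ∣ x - c (y k)}
  have hcard : #{z ∈ Icc (-Y : ℤ) Y ×ˢ Icc (-Y : ℤ) Y | z.1 ^ 2 + q * z.2 ^ 2 ≤ (Y : ℤ) ∧
      (M : ℤ) ∣ z.2 - r ∧ (M' : ℤ) ∣ z.1 - c z.2} =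
      ∑ k ∈ Ico (-((Y + 1 : ℕ) : ℤ)) ((Y + 1 : ℕ) : ℤ), #(T k) := by
    rw [← card_sigma, eq_comm]
    refine card_bij (fun p _ => (p.2, y p.1)) ?_ ?_ ?_
    · rintro ⟨k, x⟩ hp
      simp only [mem_sigma, T, mem_filter, mem_Icc] at hp
      obtain ⟨-, h1, h2, h3⟩ := hp
      have h4 : y k ^ 2 ≤ Y := by nlinarith [sq_nonneg x, sq_nonneg (y k)]
      simp only [mem_filter, mem_product, mem_Icc]
      refine ⟨⟨h1, ?_, ?_⟩, by linarith, ⟨k, by simp [hy]⟩, h3⟩ <;> nlinarith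
    · rintro ⟨k, x⟩ - ⟨l, x'⟩ - h
      obtain ⟨rfl, h⟩ := Prod.ext_iff.mp h
      have : (M : ℤ) * k = M * l := by simpa [hy] using h
      obtain rfl := mul_left_cancel₀ (by omega) this
      rfl
    · rintro ⟨x, w⟩ hz
      simp only [mem_filter, mem_product, mem_Icc] at hz
      obtain ⟨⟨h1, h2, h3⟩, h4, ⟨k, hk⟩, h5⟩ := hz
      obtain rfl : w = y k := by simp only [hy]; linarith
      refine ⟨⟨k, x⟩, ?_, rfl⟩
      simp only [mem_sigma, T, mem_filter, mem_Icc, mem_Ico]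
      refine ⟨⟨?_, ?_⟩, h1, by linarith, h5⟩ <;> push_cast <;> nlinarith
  have hT : ∀ k, |(#(T k) : ℝ) - 2 / M' * halfChord q Y (y k)| ≤
      if 0 ≤ (Y : ℤ) - q * y k ^ 2 then 2 else 0 := by
    intro k
    have := abs_card_sq_le_sub Y (Y - q * y k ^ 2) (by nlinarith [sq_nonneg (y k)]) hM' (c (y k))
    rw [halfChord]
    push_cast at this ⊢
    exact this
  have hMr : (1 : ℝ) ≤ M := by exact_mod_cast hM
  have hMr' : (1 : ℝ) ≤ M' := by exact_mod_cast hM'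
  have hYr : (1 : ℝ) ≤ Y := by exact_mod_cast hY
  have hsq : 1 ≤ √(Y : ℝ) := Real.one_le_sqrt.mpr hYr
  have hle : √(Y : ℝ) ≤ ((Y + 1 : ℕ) : ℝ) := by
    rw [Real.sqrt_le_iff]; push_cast; constructor <;> nlinarith
  have hrr : (0 : ℝ) ≤ r := by exact_mod_cast hr
  have hrMr : (r : ℝ) ≤ M := by exact_mod_cast hrM.le
  have e1 := abs_sum_halfChord_sub_le hq (Y := Y) (by linarith) hM hle hrr hrMr
  have e2 := abs_sum_halfChord_sub_le hq (Y := Y) (r := M - r) (by linarith) hM hle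
    (by linarith) (by linarith)
  have e3 : |∑ k ∈ Ico (-((Y + 1 : ℕ) : ℤ)) ((Y + 1 : ℕ) : ℤ), halfChord q Y (y k) -
      2 * (quarterArea q * Y / M)| ≤ 2 * √Y := by
    rw [sum_Ico_neg_eq]
    have e4 : ∀ k : ℕ, halfChord q Y (y (-((k : ℤ) + 1))) = halfChord q Y ((M - r) + M * k) := by
      intro k
      rw [← halfChord_neg]; congr 1; simp only [hy]; push_cast; ring
    have e5 : ∀ k : ℕ, halfChord q Y (y (k : ℤ)) = halfChord q Y (r + M * k) := by
      intro k; congr 1; simp only [hy]; push_cast; ring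
    simp only [e4, e5]
    rw [abs_le] at e1 e2 ⊢
    constructor <;> linarith
  have e6 : ∑ k ∈ Ico (-((Y + 1 : ℕ) : ℤ)) ((Y + 1 : ℕ) : ℤ),
      (if 0 ≤ (Y : ℤ) - q * y k ^ 2 then (2 : ℝ) else 0) ≤ 8 * √Y := by
    rw [sum_Ico_neg_eq]
    have h1 := sum_indicator_le (Y := Y) (L := Y + 1) (fun k => (Y : ℤ) - q * y k ^ 2) (by
      intro k hk
      have h2 : (k : ℤ) ≤ y k := by simp only [hy]; nlinarith
      nlinarith [sq_nonneg (y k)])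
    have h2 := sum_indicator_le (Y := Y) (L := Y + 1)
      (fun k => (Y : ℤ) - q * y (-((k : ℤ) + 1)) ^ 2) (by
      intro k hk
      have h2 : (k : ℤ) ≤ -y (-((k : ℤ) + 1)) := by simp only [hy]; nlinarith
      nlinarith [sq_nonneg (y (-((k : ℤ) + 1)))])
    linarith
  rw [hcard, Nat.cast_sum]
  set R := Ico (-((Y + 1 : ℕ) : ℤ)) ((Y + 1 : ℕ) : ℤ) with hR
  have e7 : |∑ k ∈ R, (#(T k) : ℝ) - 2 / M' * ∑ k ∈ R, halfChord q Y (y k)| ≤ 8 * √Y := by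
    rw [mul_sum, ← sum_sub_distrib]
    exact (abs_sum_le_sum_abs _ _).trans ((sum_le_sum fun k _ => hT k).trans e6)
  have e8 : |2 / M' * ∑ k ∈ R, halfChord q Y (y k) - 4 * quarterArea q * Y / (M * M')| ≤
      4 * √Y := by
    have : 2 / M' * ∑ k ∈ R, halfChord q Y (y k) - 4 * quarterArea q * Y / (M * M') =
        2 / M' * (∑ k ∈ R, halfChord q Y (y k) - 2 * (quarterArea q * Y / M)) := by
      field_simp; ring
    rw [this, abs_mul, abs_of_pos (by positivity)]
    calc 2 / (M' : ℝ) * _ ≤ 2 / 1 * (2 * √Y) := by gcongr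
      _ = 4 * √Y := by ring
  have := abs_sub_le (∑ k ∈ R, (#(T k) : ℝ)) (2 / M' * ∑ k ∈ R, halfChord q Y (y k))
    (4 * quarterArea q * Y / (M * M'))
  linarith

end

lemma exists_crt {A B : ℤ} (h : IsCoprime A B) (u v : ℤ) :
    ∃ c, ∀ x, (A ∣ x - u ∧ B ∣ x - v) ↔ A * B ∣ x - c := by
  obtain ⟨s, t, hst⟩ := h
  refine ⟨u * (t * B) + v * (s * A), fun x => ?_⟩
  have hA : A ∣ u * (t * B) + v * (s * A) - u := ⟨v * s - u * s, by linear_combination u * hst⟩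
  have hB : B ∣ u * (t * B) + v * (s * A) - v := ⟨u * t - v * t, by linear_combination v * hst⟩
  constructor
  · rintro ⟨h1, h2⟩
    refine IsCoprime.mul_dvd ⟨s, t, hst⟩ ?_ ?_
    · simpa using dvd_sub h1 hA
    · simpa using dvd_sub h2 hB
  · intro h
    exact ⟨by simpa using dvd_add ((dvd_mul_right A B).trans h) hA,
      by simpa using dvd_add ((dvd_mul_left B A).trans h) hB⟩

section
variable {q : ℕ}

/-- The residue of a pair of coordinates modulo `2q`. -/
def resid (q : ℕ) (z : ℤ × ℤ) : ZMod (2 * q) × ZMod (2 * q) := (z.1, z.2)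

/-- The norm form modulo `2q`. -/
def normRes (ρ : ZMod (2 * q) × ZMod (2 * q)) : ZMod (2 * q) := ρ.1 ^ 2 + q * ρ.2 ^ 2

lemma normRes_resid (z : ℤ × ℤ) :
    normRes (resid q z) = (((⟨z.1, z.2⟩ : Order q).norm : ℤ) : ZMod (2 * q)) := by
  simp [normRes, resid, order_norm]

open Classical in
/-- Residues whose norm is a unit in a given class modulo `±1`. -/
noncomputable def normFiber [NeZero (2 * q)] (u : NormGroup q) :
    Finset (ZMod (2 * q) × ZMod (2 * q)) :=
  {ρ | ∃ w : (ZMod (2 * q))ˣ, (w : ZMod (2 * q)) = normRes ρ ∧ QuotientGroup.mk w = u}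

variable [NeZero (2 * q)]

lemma mem_normFiber {u : NormGroup q} {ρ : ZMod (2 * q) × ZMod (2 * q)} : ρ ∈ normFiber u ↔
    ∃ w : (ZMod (2 * q))ˣ, (w : ZMod (2 * q)) = normRes ρ ∧ QuotientGroup.mk w = u := by
  simp [normFiber]

lemma card_normFiber_le (u : NormGroup q) (w : (ZMod (2 * q))ˣ) :
    #(normFiber u) ≤ #(normFiber (u * QuotientGroup.mk w ^ 2)) := by
  refine card_le_card_of_injOn (fun ρ => (w * ρ.1, w * ρ.2)) ?_ ?_
  · intro ρ hρ
    rw [mem_coe, mem_normFiber] at hρ ⊢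
    obtain ⟨v, hv, rfl⟩ := hρ
    refine ⟨v * w ^ 2, ?_, rfl⟩
    push_cast
    rw [hv, normRes, normRes]; ring
  · intro ρ _ σ _ h
    simpa [Prod.ext_iff] using h

lemma card_normFiber (hodd : Odd (Nat.card (NormGroup q))) (u : NormGroup q) :
    #(normFiber u) = #(normFiber (1 : NormGroup q)) := by
  obtain ⟨v, rfl⟩ : ∃ v, v ^ 2 = u :=
    ⟨(powCoprime (Nat.coprime_two_right.mpr hodd)).symm u,
      (powCoprime (Nat.coprime_two_right.mpr hodd)).apply_symm_apply u⟩
  obtain ⟨w, rfl⟩ := QuotientGroup.mk_surjective v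
  refine _root_.le_antisymm ?_ ?_
  · have := card_normFiber_le (QuotientGroup.mk w ^ 2 : NormGroup q) w⁻¹
    rwa [QuotientGroup.mk_inv, inv_pow, mul_inv_cancel] at this
  · exact (card_normFiber_le (1 : NormGroup q) w).trans_eq
      (congrArg (fun v => #(normFiber v)) (_root_.one_mul (QuotientGroup.mk w ^ 2 : NormGroup q)))

lemma card_normFiber_pos : 0 < #(normFiber (1 : NormGroup q)) :=
  card_pos.mpr ⟨(1, 0), mem_normFiber.mpr ⟨1, by simp [normRes], rfl⟩⟩

variable [Fact q.Prime]

open Classical in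
/-- Elements of an ideal of bounded norm in a residue class modulo `2q`. -/
lemma abs_card_resid_sub_le {I : Ideal (Order q)} (hI : Cop I) {Y : ℕ} (hY : 0 < Y)
    (ρ : ZMod (2 * q) × ZMod (2 * q)) :
    |(#{z ∈ Icc (-Y : ℤ) Y ×ˢ Icc (-Y : ℤ) Y | z.1 ^ 2 + q * z.2 ^ 2 ≤ (Y : ℤ) ∧
      (⟨z.1, z.2⟩ : Order q) ∈ I ∧ resid q z = ρ} : ℝ) -
      quarterArea q / (q ^ 2 * idealNorm I) * Y| ≤ 12 * √Y := by
  have hq0 : 0 < q := (Fact.out : q.Prime).pos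
  obtain ⟨m, a, b, hm, ha, hc, hn, h⟩ := hI.exists_basis_idealNorm
  have hc1 : IsCoprime (m : ℤ) (2 * q) := by
    push_cast at hc
    exact hc.of_mul_left_left
  obtain ⟨r₀, hr₀⟩ := exists_crt hc1 0 (ρ.2.val : ℤ)
  choose c hc' using fun y : ℤ => exists_crt hc (b * y) (ρ.1.val : ℤ)
  have hM : 0 < m * (2 * q) := by positivity
  have hM' : 0 < m * a * (2 * q) := by positivity
  have hMz : (0 : ℤ) < ((m * (2 * q) : ℕ) : ℤ) := by exact_mod_cast hM
  have key := abs_card_ellipse_sub_le hq0 hM hM' hY (Int.emod_nonneg r₀ hMz.ne')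
    (Int.emod_lt_of_pos r₀ hMz) c
  have hres : ∀ (x : ℤ) (s : ZMod (2 * q)), (x : ZMod (2 * q)) = s ↔
      (2 * q : ℤ) ∣ x - (s.val : ℤ) := by
    intro x s
    have : s = ((s.val : ℤ) : ZMod (2 * q)) := by simp
    conv_lhs => rw [this, eq_comm, ZMod.intCast_eq_intCast_iff_dvd_sub]
    push_cast; rfl
  convert key using 3
  · congr 2
    ext z
    simp only [resid, Prod.ext_iff, h, hres]
    have h1 := hr₀ z.2
    have h2 := hc' z.2 z.1
    have h3 : ((m * (2 * q) : ℕ) : ℤ) ∣ z.2 - r₀ % ((m * (2 * q) : ℕ) : ℤ) ↔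
        (m : ℤ) * (2 * q) ∣ z.2 - r₀ := by
      have e : z.2 - r₀ % ((m * (2 * q) : ℕ) : ℤ) = (z.2 - r₀) +
          ((m * (2 * q) : ℕ) : ℤ) * (r₀ / ((m * (2 * q) : ℕ) : ℤ)) := by
        have := Int.emod_add_mul_ediv r₀ ((m * (2 * q) : ℕ) : ℤ)
        linarith
      rw [e, dvd_add_left (dvd_mul_right _ _)]
      push_cast; rfl
    rw [mem_filter, mem_filter, h3, ← h1, sub_zero]
    have h4 : ((m * a * (2 * q) : ℕ) : ℤ) = ((m * a : ℕ) : ℤ) * (2 * q) := by push_cast; ring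
    rw [h4, ← h2]
    tauto
  · rw [hn]
    push_cast
    field_simp
    ring

open Classical in
lemma abs_card_normFiber_sub_le (hodd : Odd (Nat.card (NormGroup q))) {I : Ideal (Order q)}
    (hI : Cop I) {Y : ℕ} (hY : 0 < Y) (u : NormGroup q) :
    |(#{z ∈ Icc (-Y : ℤ) Y ×ˢ Icc (-Y : ℤ) Y | z.1 ^ 2 + q * z.2 ^ 2 ≤ (Y : ℤ) ∧
      (⟨z.1, z.2⟩ : Order q) ∈ I ∧ resid q z ∈ normFiber u} : ℝ) -
      #(normFiber (1 : NormGroup q)) * (quarterArea q / (q ^ 2 * idealNorm I)) * Y| ≤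
      12 * #(normFiber (1 : NormGroup q)) * √Y := by
  have h1 : #{z ∈ Icc (-Y : ℤ) Y ×ˢ Icc (-Y : ℤ) Y | z.1 ^ 2 + q * z.2 ^ 2 ≤ (Y : ℤ) ∧
      (⟨z.1, z.2⟩ : Order q) ∈ I ∧ resid q z ∈ normFiber u} =
      ∑ ρ ∈ normFiber u, #{z ∈ Icc (-Y : ℤ) Y ×ˢ Icc (-Y : ℤ) Y |
        z.1 ^ 2 + q * z.2 ^ 2 ≤ (Y : ℤ) ∧ (⟨z.1, z.2⟩ : Order q) ∈ I ∧ resid q z = ρ} := by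
    rw [card_eq_sum_card_fiberwise (f := resid q) (t := normFiber u)]
    · refine sum_congr rfl fun ρ hρ => ?_
      rw [filter_filter]
      congr 1
      ext z
      simp only [mem_filter]
      constructor
      · rintro ⟨h1, ⟨h2, h3, -⟩, h4⟩; exact ⟨h1, h2, h3, h4⟩
      · rintro ⟨h1, h2, h3, rfl⟩; exact ⟨h1, ⟨h2, h3, hρ⟩, rfl⟩
    · intro z hz
      rw [mem_coe, mem_filter] at hz
      exact hz.2.2.2
  rw [h1, ← card_normFiber hodd u, Nat.cast_sum, mul_assoc, ← nsmul_eq_mul, ← sum_const,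
    ← sum_sub_distrib]
  refine (abs_sum_le_sum_abs _ _).trans ?_
  refine (sum_le_sum fun ρ _ => abs_card_resid_sub_le hI hY ρ).trans ?_
  rw [sum_const, nsmul_eq_mul]
  apply le_of_eq; ring

end

section
variable {q : ℕ} [Fact q.Prime] [NeZero (2 * q)]

lemma resid_mem_normFiber {z : ℤ × ℤ} {u : NormGroup q} : resid q z ∈ normFiber u ↔
    Cop (Ideal.span {(⟨z.1, z.2⟩ : Order q)}) ∧
      normCls q (idealNorm (Ideal.span {(⟨z.1, z.2⟩ : Order q)})) = u := by
  rw [mem_normFiber, normRes_resid, ← idealNorm_span, Int.cast_natCast]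
  constructor
  · rintro ⟨w, hw, rfl⟩
    have h : (idealNorm (Ideal.span {(⟨z.1, z.2⟩ : Order q)})).Coprime (2 * q) := by
      rw [← ZMod.isUnit_iff_coprime, ← hw]
      exact w.isUnit
    refine ⟨cop_span ?_, ?_⟩
    · rw [← idealNorm_span]
      exact_mod_cast Nat.isCoprime_iff_coprime.mpr h
    · rw [normCls_of h]
      congr 1
      ext
      simp [hw]
  · rintro ⟨h, rfl⟩
    exact ⟨_, ZMod.coe_unitOfCoprime _ h.coprime_idealNorm, (normCls_of h.coprime_idealNorm).symm⟩

open Classical in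
/-- The ideals coprime to `2q` of norm at most `N` with a given class. -/
noncomputable def idealsOfClass (a : Additive (ClassGroup (Order q) × NormGroup q)) (N : ℕ) :
    Finset (Multiset (CopPrime q)) :=
  (Icc 1 N).biUnion fun k =>
    {s ∈ (copPrimeSystem q).integers k | (s.map fun P => bigCls P.1).sum = a}

omit [NeZero (2 * q)] in
lemma mem_idealsOfClass {a : Additive (ClassGroup (Order q) × NormGroup q)} {N : ℕ}
    {s : Multiset (CopPrime q)} :
    s ∈ idealsOfClass a N ↔ idealNorm (toIdeal s) ≤ N ∧ bigCls (toIdeal s) = a := by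
  simp only [idealsOfClass, mem_biUnion, mem_Icc, mem_filter, PrimeSystem.mem_integers,
    copPrimeSystem_normMul, bigCls_toIdeal]
  have := (cop_toIdeal s).idealNorm_pos
  constructor
  · rintro ⟨k, ⟨h1, h2⟩, rfl, h3⟩
    exact ⟨h2, h3⟩
  · rintro ⟨h1, h2⟩
    exact ⟨_, ⟨this, h1⟩, rfl, h2⟩

omit [NeZero (2 * q)] in
open Classical in
lemma sum_count (a : Additive (ClassGroup (Order q) × NormGroup q)) (N : ℕ) :
    ∑ k ∈ Icc 1 N, (copPrimeSystem q).count (fun P => bigCls P.1) a k = #(idealsOfClass a N) := by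
  rw [idealsOfClass, card_biUnion]
  · push_cast
    refine sum_congr rfl fun k _ => ?_
    rw [PrimeSystem.count, sum_boole]
  · intro i _ j _ hij
    rw [Function.onFun, disjoint_left]
    intro s hs hs'
    rw [mem_filter, PrimeSystem.mem_integers] at hs hs'
    exact hij (hs.1.symm.trans hs'.1)

open Classical in
lemma card_elements_eq {b : Ideal (Order q)} (hb : Cop b)
    {a : Additive (ClassGroup (Order q) × NormGroup q)} {u : NormGroup q}
    (h : bigCls b + a = Additive.ofMul (1, u)) (N : ℕ) {Y : ℕ} (hY : Y = idealNorm b * N) :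
    #{z ∈ Icc (-Y : ℤ) Y ×ˢ Icc (-Y : ℤ) Y | z.1 ^ 2 + q * z.2 ^ 2 ≤ (Y : ℤ) ∧
      (⟨z.1, z.2⟩ : Order q) ∈ b ∧ resid q z ∈ normFiber u} = #(idealsOfClass a N) * 2 := by
  have hq0 : 0 < q := (Fact.out : q.Prime).pos
  rw [← mul_one #(filter _ _)]
  refine card_mul_eq_card_mul (fun z s => Ideal.span {(⟨z.1, z.2⟩ : Order q)} = b * toIdeal s)
    ?_ ?_
  · intro z hz
    rw [mem_filter, resid_mem_normFiber] at hz
    obtain ⟨-, h1, h2, h3, h4⟩ := hz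
    obtain ⟨K, hK, h5⟩ := h3.exists_eq_mul ((Ideal.span_singleton_le_iff_mem _).mpr h2)
    obtain ⟨s, rfl⟩ := hK.exists_toIdeal
    rw [card_eq_one]
    refine ⟨s, ?_⟩
    ext t
    rw [mem_bipartiteAbove, mem_singleton, mem_idealsOfClass]
    constructor
    · rintro ⟨-, h6⟩
      exact toIdeal_injective (hb.mul_left_cancel (h6.symm.trans h5))
    · rintro rfl
      refine ⟨⟨?_, ?_⟩, h5⟩
      · have h6 := idealNorm_span (q := q) ⟨z.1, z.2⟩
        rw [h5, idealNorm_mul hb hK, order_norm] at h6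
        refine Nat.le_of_mul_le_mul_left ?_ hb.idealNorm_pos
        rw [← hY]
        zify at h6 ⊢
        rw [h6]
        exact h1
      · have h6 := bigCls_mul hb hK
        have h7 : (⟨z.1, z.2⟩ : Order q) ≠ 0 := by
          intro h0
          have := h3.idealNorm_pos
          zify at this
          rw [idealNorm_span, h0, Zsqrtd.norm_zero] at this
          exact this.false
        have h8 : bigCls (Ideal.span {(⟨z.1, z.2⟩ : Order q)}) = Additive.ofMul (1, u) := by
          rw [bigCls, cls_span h7, h4]
        rw [← h5, h8, ← h] at h6
        exact (eq_neg_add_of_add_eq h6.symm).trans (neg_add_cancel_left _ _)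
  · intro s hs
    rw [mem_idealsOfClass] at hs
    have hK := cop_toIdeal s
    have h1 : bigCls (b * toIdeal s) = Additive.ofMul (1, u) := by
      rw [bigCls_mul hb hK, hs.2, h]
    have h2 := congrArg (fun x => (Additive.toMul x).1) h1
    have h3 := congrArg (fun x => (Additive.toMul x).2) h1
    simp only [bigCls, toMul_ofMul] at h2 h3
    obtain ⟨x, hx, hx'⟩ := (cls_eq_one (hb.mul hK).inv).mp h2
    have h4 : x.re ^ 2 + q * x.im ^ 2 ≤ (Y : ℤ) := by
      rw [← order_norm, ← idealNorm_span, ← hx', idealNorm_mul hb hK, hY]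
      exact_mod_cast Nat.mul_le_mul_left _ hs.1
    have h5 : |x.re| ≤ Y := by
      have : |x.re| ≤ x.re ^ 2 := by rw [← sq_abs]; exact Int.le_self_sq _
      nlinarith [sq_nonneg x.im]
    have h6 : |x.im| ≤ Y := by
      have : |x.im| ≤ x.im ^ 2 := by rw [← sq_abs]; exact Int.le_self_sq _
      have hq1 : (1 : ℤ) ≤ q := by exact_mod_cast hq0
      nlinarith [sq_nonneg x.im, sq_nonneg x.re]
    rw [abs_le] at h5 h6
    have h7 : ((x.re, x.im) : ℤ × ℤ) ≠ (-x.re, -x.im) := by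
      intro h
      rw [Prod.ext_iff] at h
      apply hx
      ext
      · simp; linarith [h.1]
      · simp; linarith [h.2]
    rw [card_eq_two]
    refine ⟨_, _, h7, ?_⟩
    ext z
    rw [mem_bipartiteBelow, mem_insert, mem_singleton]
    have h8 : (z = (x.re, x.im) ∨ z = (-x.re, -x.im)) ↔
        Ideal.span {(⟨z.1, z.2⟩ : Order q)} = b * toIdeal s := by
      rw [hx', order_span_eq, Prod.ext_iff, Prod.ext_iff, Zsqrtd.ext_iff, Zsqrtd.ext_iff]
      simp
    rw [h8, and_iff_right_iff_imp]
    intro h9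
    rw [mem_filter, resid_mem_normFiber, h9]
    refine ⟨?_, ?_, ?_, hb.mul hK, h3⟩
    · rw [mem_product, mem_Icc, mem_Icc]
      rcases h8.mpr h9 with rfl | rfl <;> constructor <;> constructor <;> simp only <;> linarith
    · rcases h8.mpr h9 with rfl | rfl
      · exact h4
      · simpa using h4
    · exact Ideal.mul_le_left (h9 ▸ Ideal.mem_span_singleton_self _)

omit [NeZero (2 * q)] in
lemma exists_abs_count_sub_le (hq : q % 4 = 3) : ∃ c K : ℝ, 0 < c ∧
    ∀ (a : Additive (ClassGroup (Order q) × NormGroup q)) (N : ℕ),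
      |(#(idealsOfClass a N) : ℝ) - c * N| ≤ K * √N := by
  have hq0 : 0 < q := (Fact.out : q.Prime).pos
  have : NeZero (2 * q) := ⟨by positivity⟩
  have : Finite (ClassGroup (Order q)) := finite_classGroup (by omega)
  have hodd : Odd (Nat.card (NormGroup q)) := by
    have := odd_card_group hq
    rw [Nat.card_congr Additive.toMul, Nat.card_prod, Nat.odd_mul] at this
    exact this.2
  have := Fintype.ofFinite (ClassGroup (Order q))
  choose b hb hb' using exists_cop_cls (q := q) (by omega)
  set M := #(normFiber (1 : NormGroup q)) with hM
  refine ⟨M * quarterArea q / (2 * q ^ 2), ∑ C, 6 * M * √(idealNorm (b C)), ?_, ?_⟩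
  · have := card_normFiber_pos (q := q)
    have := quarterArea_pos (q := q)
    positivity
  intro a N
  rcases N.eq_zero_or_pos with rfl | hN
  · have : idealsOfClass a 0 = ∅ := by simp [idealsOfClass]
    simp [this]
  set C := (Additive.toMul a).1⁻¹ with hC
  have h1 : bigCls (b C) + a =
      Additive.ofMul (1, normCls q (idealNorm (b C)) * (Additive.toMul a).2) := by
    refine Additive.toMul.injective (Prod.ext ?_ rfl)
    rw [toMul_add, toMul_ofMul, Prod.fst_mul, bigCls, toMul_ofMul, hb', hC, inv_mul_cancel]
  have hn := (hb C).idealNorm_pos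
  have h2 := abs_card_normFiber_sub_le hodd (hb C) (Y := idealNorm (b C) * N) (by positivity)
    (normCls q (idealNorm (b C)) * (Additive.toMul a).2)
  rw [card_elements_eq (hb C) h1 N rfl] at h2
  push_cast at h2
  rw [Real.sqrt_mul (by positivity), ← hM] at h2
  have h3 : (M : ℝ) * (quarterArea q / (q ^ 2 * idealNorm (b C))) * (idealNorm (b C) * N) =
      2 * (M * quarterArea q / (2 * q ^ 2) * N) := by
    field_simp
  rw [h3, mul_comm _ (2 : ℝ), ← mul_sub, abs_mul, abs_two] at h2
  have h4 : 6 * M * √(idealNorm (b C)) ≤ ∑ C, 6 * M * √(idealNorm (b C)) :=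
    single_le_sum (f := fun C => 6 * (M : ℝ) * √(idealNorm (b C))) (fun _ _ => by positivity)
      (mem_univ C)
  calc _ ≤ 6 * M * √(idealNorm (b C)) * √N := by linarith
    _ ≤ _ := by gcongr

end
end SophieGermain

namespace SophieGermain
open Finset Filter Topology

open Classical in
lemma tendsto_good {q : ℕ} [Fact q.Prime] (hq : q % 4 = 3) :
    Tendsto (fun N : ℕ => (#{p ∈ Icc 1 N | p.Prime ∧ Good q p} : ℝ) / #{p ∈ Icc 1 N | p.Prime})
      atTop (𝓝 (1 / (Nat.card (ClassGroup (Order q)) * (q - 1 : ℕ)))) := by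
  have hq0 : q.Prime := Fact.out
  have : NeZero (2 * q) := ⟨mul_ne_zero two_ne_zero hq0.ne_zero⟩
  have : Finite (ClassGroup (Order q)) := finite_classGroup (by omega)
  have := Fintype.ofFinite (Additive (ClassGroup (Order q) × NormGroup q))
  obtain ⟨c, K, hc, h⟩ := exists_abs_count_sub_le hq
  have hodd := odd_card_group hq
  rw [Nat.card_eq_fintype_card] at hodd
  have h1 := (copPrimeSystem q).tendsto_primes (fun P => bigCls P.1) hodd hc
    (fun a N => by rw [sum_count]; exact h a N)
  have hcard : (Fintype.card (Additive (ClassGroup (Order q) × NormGroup q)) : ℝ) * 2 =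
      Nat.card (ClassGroup (Order q)) * (q - 1 : ℕ) := by
    rw [← Nat.card_eq_fintype_card, Nat.card_congr Additive.toMul, Nat.card_prod,
      ← card_normGroup hq0 (by omega)]
    push_cast
    ring
  refine tendsto_card_div_card (Good q) ?_
  rw [← hcard, ← div_div]
  refine (h1.div_const 2).congr fun N => ?_
  rw [div_right_comm, sum_div]
  congr 1
  rw [← filter_filter, sum_filter (Good q)]
  refine sum_congr rfl fun p hp => ?_
  have h2 : {P : CopPrime q | (copPrimeSystem q).norm P = p ∧ bigCls P.1 = 0}.ncard =
    if Good q p then 2 else 0 := ncard_bigCls_eq_zero hq (mem_filter.mp hp).2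
  rw [h2]
  split_ifs <;> simp

/-- The order `ℤ[√-q]` as a subring of `ℂ`. -/
noncomputable def orderEquiv (q : ℕ) (hq : 0 < q) :
    Order q ≃+* Algebra.adjoin ℤ {(Real.sqrt q : ℂ) * Complex.I} := by
  have hr : ((Real.sqrt q : ℂ) * Complex.I) * ((Real.sqrt q : ℂ) * Complex.I) =
      ((-(q : ℤ) : ℤ) : ℂ) := by
    have : (Real.sqrt q : ℂ) * (Real.sqrt q : ℂ) = q := by
      exact_mod_cast Real.mul_self_sqrt q.cast_nonneg
    push_cast
    linear_combination Complex.I * Complex.I * this + (q : ℂ) * Complex.I_mul_I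
  let f : Order q →ₐ[ℤ] ℂ := (Zsqrtd.lift ⟨_, hr⟩).toIntAlgHom
  have hf : Function.Injective f := Zsqrtd.lift_injective _ fun n => by nlinarith [mul_self_nonneg n]
  refine (AlgEquiv.ofInjective f hf).toRingEquiv.trans
    (Subalgebra.equivOfEq _ _ (le_antisymm ?_ ?_)).toRingEquiv
  · rintro _ ⟨z, rfl⟩
    have h := Algebra.self_mem_adjoin_singleton ℤ ((Real.sqrt q : ℂ) * Complex.I)
    exact add_mem (intCast_mem _ _) (mul_mem (intCast_mem _ _) h)
  · rw [Algebra.adjoin_le_iff, Set.singleton_subset_iff]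
    exact ⟨⟨0, 1⟩, by simp [f]⟩

end SophieGermain

/-- Let `g ≥ 5` be a Sophie Germain prime and `h` the cardinality of the class group of the
order `ℤ[√-(2g+1)]` (realized as the subring of `ℂ` generated by `√(2g+1)·i`).  Then the set
of primes `p ≠ 2g+1` with `p = x² + (2g+1)y²` and `p ≡ 1 (mod 2g+1)` has relative natural
density `1/(2hg)` among all primes. -/
theorem stmt_3 (g : ℕ) (hg5 : 5 ≤ g) (hg : Nat.Prime g) (hsg : Nat.Prime (2 * g + 1))
    (h : ℕ)
    (hh : h = Nat.card (ClassGroup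
      (Algebra.adjoin ℤ {(Real.sqrt (2 * g + 1) : ℂ) * Complex.I}))) :
    Filter.Tendsto
      (fun N : ℕ =>
        (({p : ℕ | p ≤ N ∧ p.Prime ∧ p ≠ 2 * g + 1 ∧
            (∃ x y : ℤ, (p : ℤ) = x ^ 2 + (2 * g + 1) * y ^ 2) ∧
            p % (2 * g + 1) = 1}.ncard : ℝ)) /
          ({p : ℕ | p ≤ N ∧ p.Prime}.ncard : ℝ))
      Filter.atTop
      (nhds (1 / (2 * (h : ℝ) * (g : ℝ)))) := by
  classical
  have : Fact (2 * g + 1).Prime := ⟨hsg⟩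
  have hodd : g % 2 = 1 := (hg.eq_two_or_odd).resolve_left (by omega)
  have key := SophieGermain.tendsto_good (q := 2 * g + 1) (by omega)
  have hcard : Nat.card (ClassGroup (SophieGermain.Order (2 * g + 1))) = h := by
    have e : 2 * (g : ℝ) + 1 = (2 * g + 1 : ℕ) := by push_cast; rfl
    rw [hh, e]
    exact Nat.card_congr
      (ClassGroup.mulEquiv (SophieGermain.orderEquiv (2 * g + 1) (by omega))).toEquiv
  rw [hcard, Nat.add_sub_cancel, Nat.cast_mul, Nat.cast_two, ← mul_assoc, mul_comm (h : ℝ)] at key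
  refine key.congr fun N => ?_
  rw [← Set.ncard_coe_finset, ← Set.ncard_coe_finset]
  congr 4
  · ext p
    rw [Finset.mem_coe, Finset.mem_filter, Finset.mem_Icc, Set.mem_ofPred_eq, SophieGermain.Good]
    push_cast
    constructor
    · rintro ⟨⟨-, h1⟩, h2⟩
      exact ⟨h1, h2⟩
    · rintro ⟨h1, h2⟩
      exact ⟨⟨h2.1.one_le, h1⟩, h2⟩
  · ext p
    rw [Finset.mem_coe, Finset.mem_filter, Finset.mem_Icc, Set.mem_ofPred_eq]
    exact ⟨fun ⟨⟨_, h1⟩, h2⟩ => ⟨h1, h2⟩, fun ⟨h1, h2⟩ => ⟨⟨h2.one_le, h1⟩, h2⟩⟩
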